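/- There exists an absolute constant C > 0 such that for all integers d ≥ 1, n ≥ 1, every integer b with 1 ≤ b ≤ n, and all reals a, τ > 0, there exists a finitely supported probability measure μ on [0,∞) with mean ∫ t dμ(t) ≤ C·(d³·a·b^{−1/2} + d⁴·τ^{1/(8d)}) such that MRBSA(d, n, a, τ) ≤ √b · ∫ MBSA(d, ⌊n/b⌋ + 1, t) dμ(t) + b. -/

import Mathlib

open Finset
open scoped Classical

/-- The embedding of `Bool` into `{-1, 1} ⊆ ℝ`. -/
noncomputable def chi (b : Bool) : ℝ := if b then 1 else -1

/-- Flip the `i`-th coordinate of a point of the Boolean cube. -/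
def flipAt {n : ℕ} (x : Fin n → Bool) (i : Fin n) : Fin n → Bool :=
  Function.update x i (!x i)

/-- The sensitivity of `f` at `x`: the number of coordinates whose flip changes `f`. -/
noncomputable def sens {n : ℕ} (f : (Fin n → Bool) → ℝ) (x : Fin n → Bool) : ℕ :=
  (Finset.univ.filter (fun i => f (flipAt x i) ≠ f x)).card

/-- The Boolean surface area `BSA[f] = E_x √(s_f(x))`, `x` uniform on the cube. -/
noncomputable def BSA {n : ℕ} (f : (Fin n → Bool) → ℝ) : ℝ :=
  (∑ x : Fin n → Bool, Real.sqrt (sens f x)) / 2 ^ n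

/-- Evaluation of a polynomial at a point of the cube `{-1,1}^n`. -/
noncomputable def pev {n : ℕ} (p : MvPolynomial (Fin n) ℝ) (x : Fin n → Bool) : ℝ :=
  MvPolynomial.eval (fun i => chi (x i)) p

/-- `f` is a degree-`d` polynomial threshold function: `f = sgn p` for some multilinear
polynomial `p` of total degree at most `d` that is nonvanishing on the cube. -/
def IsPTF (d : ℕ) {n : ℕ} (f : (Fin n → Bool) → ℝ) : Prop :=
  ∃ p : MvPolynomial (Fin n) ℝ,
    (∀ m ∈ p.support, ∀ i, m i ≤ 1) ∧ p.totalDegree ≤ d ∧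
    ∀ x, pev p x ≠ 0 ∧ f x = Real.sign (pev p x)

/-- The quantity `α(p) = E_{A,B} min(1, (D_B p(A))² / p(A)²)` with `A, B` independent
uniform on the cube, where `D_B p(A) = Σ_j B_j (p(A) - p(A^{⊕j}))/2`. -/
noncomputable def alphaP {n : ℕ} (p : MvPolynomial (Fin n) ℝ) : ℝ :=
  (∑ A : Fin n → Bool, ∑ B : Fin n → Bool,
    min 1 ((∑ j, chi (B j) * ((pev p A - pev p (flipAt A j)) / 2)) ^ 2 / (pev p A) ^ 2)) /
    (2 ^ n * 2 ^ n)

/-- The influence of coordinate `j` on the polynomial `p`, `Inf_j[p] = E_x (D_j p(x))²`. -/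
noncomputable def pInf {n : ℕ} (p : MvPolynomial (Fin n) ℝ) (j : Fin n) : ℝ :=
  (∑ x : Fin n → Bool, ((pev p x - pev p (flipAt x j)) / 2) ^ 2) / 2 ^ n

/-- The variance of `p` on the cube. -/
noncomputable def pVar {n : ℕ} (p : MvPolynomial (Fin n) ℝ) : ℝ :=
  (∑ x : Fin n → Bool, (pev p x) ^ 2) / 2 ^ n -
    ((∑ x : Fin n → Bool, pev p x) / 2 ^ n) ^ 2

/-- `p` is `τ`-regular: every coordinate influence is at most `τ·Var[p]`. -/
def PolyRegular {n : ℕ} (τ : ℝ) (p : MvPolynomial (Fin n) ℝ) : Prop :=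
  ∀ j, pInf p j ≤ τ * pVar p

/-- `MBSA(d, n, a)`: the supremum of `BSA[f]` over degree-`d` PTFs `f = sgn p` on
`{-1,1}^n` with `α(p) ≤ a` (`0` if there is no such PTF, as `sSup ∅ = 0` in `ℝ`). -/
noncomputable def MBSA (d n : ℕ) (a : ℝ) : ℝ :=
  sSup {s : ℝ | ∃ (f : (Fin n → Bool) → ℝ) (p : MvPolynomial (Fin n) ℝ),
    (∀ m ∈ p.support, ∀ i, m i ≤ 1) ∧ p.totalDegree ≤ d ∧
    (∀ x, pev p x ≠ 0 ∧ f x = Real.sign (pev p x)) ∧ alphaP p ≤ a ∧ s = BSA f}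

/-- `MRBSA(d, n, a, τ)`: as `MBSA` but restricted to `τ`-regular polynomials. -/
noncomputable def MRBSA (d n : ℕ) (a τ : ℝ) : ℝ :=
  sSup {s : ℝ | ∃ (f : (Fin n → Bool) → ℝ) (p : MvPolynomial (Fin n) ℝ),
    (∀ m ∈ p.support, ∀ i, m i ≤ 1) ∧ p.totalDegree ≤ d ∧
    (∀ x, pev p x ≠ 0 ∧ f x = Real.sign (pev p x)) ∧ alphaP p ≤ a ∧
    PolyRegular τ p ∧ s = BSA f}

section partA1

lemma poly_norm_le_in_disc (Q : Polynomial ℂ) (M : ℝ)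
    (hM : ∀ z : ℂ, ‖z‖ = 1 → ‖Q.eval z‖ ≤ M) (w : ℂ) (hw : ‖w‖ ≤ 1) : ‖Q.eval w‖ ≤ M := by
  have hb : Bornology.IsBounded (Metric.ball (0 : ℂ) 1) := Metric.isBounded_ball
  refine Complex.norm_le_of_forall_mem_frontier_norm_le (f := fun z => Q.eval z) hb
    (Q.differentiable.diffContOnCl) ?_ ?_
  · intro z hz
    rw [frontier_ball (0 : ℂ) one_ne_zero] at hz
    exact hM z (by simpa using hz)
  · rw [closure_ball (0 : ℂ) one_ne_zero]
    simpa using hw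

lemma poly_norm_le_out_disc (Q : Polynomial ℂ) (D : ℕ) (hQ : Q.natDegree ≤ D) (M : ℝ)
    (hM : ∀ z : ℂ, ‖z‖ = 1 → ‖Q.eval z‖ ≤ M) (w : ℂ) (hw : 1 ≤ ‖w‖) :
    ‖Q.eval w‖ ≤ M * ‖w‖ ^ D := by
  have key : ∀ x : ℂ, x ≠ 0 → (Polynomial.reflect D Q).eval x⁻¹ * x ^ D = Q.eval x := by
    intro x hx
    letI : Invertible x := invertibleOfNonzero hx
    have := Polynomial.eval₂_reflect_mul_pow (RingHom.id ℂ) x D Q hQ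
    simpa [Polynomial.eval₂_id, Polynomial.eval₂_eq_eval_map] using this
  have h1 : ∀ z : ℂ, ‖z‖ = 1 → ‖(Polynomial.reflect D Q).eval z‖ ≤ M := by
    intro z hz
    have hz0 : z ≠ 0 := by
      intro h; simp [h] at hz
    have := key z⁻¹ (inv_ne_zero hz0)
    rw [inv_inv] at this
    have h2 := hM z⁻¹ (by simp [hz])
    rw [← this] at h2
    simpa [hz] using h2
  have hw0 : w ≠ 0 := by
    intro h; simp [h] at hw; linarith
  rw [← key w hw0, norm_mul, norm_pow]
  refine mul_le_mul_of_nonneg_right ?_ (by positivity)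
  apply poly_norm_le_in_disc _ M h1
  rw [norm_inv]
  exact inv_le_one_of_one_le₀ hw

lemma poly_bernstein (Q : Polynomial ℂ) (D : ℕ) (hD : 1 ≤ D) (hQ : Q.natDegree ≤ D) (M : ℝ)
    (hM : ∀ z : ℂ, ‖z‖ = 1 → ‖Q.eval z‖ ≤ M) (z : ℂ) (hz : ‖z‖ = 1) :
    ‖Q.derivative.eval z‖ ≤ 3 * D * M := by
  have hM0 : 0 ≤ M := le_trans (norm_nonneg _) (hM 1 (by simp))
  have hDpos : (0 : ℝ) < D := by exact_mod_cast hD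
  have hpow : (1 + 1 / (D : ℝ)) ^ D ≤ 3 := by
    have h1 : (1 + 1 / (D : ℝ)) ≤ Real.exp (1 / D) := by
      have := Real.add_one_le_exp (1 / (D : ℝ)); linarith
    calc (1 + 1 / (D : ℝ)) ^ D ≤ (Real.exp (1 / D)) ^ D := by gcongr
      _ = Real.exp 1 := by
          rw [← Real.exp_nat_mul]; congr 1; field_simp
      _ ≤ 3 := by have := Real.exp_one_lt_d9; linarith
  have := Complex.norm_deriv_le_of_forall_mem_sphere_norm_le (f := fun z => Q.eval z) (c := z)
    (R := 1 / (D : ℝ)) (C := 3 * M) (by positivity) (Q.differentiable.diffContOnCl) (by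
      intro w hw
      have hw' : ‖w‖ ≤ 1 + 1 / (D : ℝ) := by
        have h1 : ‖w - z‖ = 1 / (D : ℝ) := by simpa [dist_eq_norm] using hw
        calc ‖w‖ = ‖z + (w - z)‖ := by ring_nf
          _ ≤ ‖z‖ + ‖w - z‖ := norm_add_le _ _
          _ = _ := by rw [hz, h1]
      rcases le_total 1 ‖w‖ with h | h
      · refine (poly_norm_le_out_disc Q D hQ M hM w h).trans ?_
        have : ‖w‖ ^ D ≤ 3 := le_trans (by gcongr) hpow
        nlinarith
      · have := poly_norm_le_in_disc Q M hM w h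
        show ‖Q.eval w‖ ≤ _
        linarith)
  rw [Polynomial.deriv] at this
  calc _ ≤ _ := this
    _ = 3 * D * M := by field_simp

/-- integral of the Lorentzian of sine -/
lemma integral_sin_lorentz (κ φ : ℝ) (hκ : 0 < κ) :
    ∫ t in (0 : ℝ)..(2 * Real.pi), κ ^ 2 / (Real.sin (t - φ) ^ 2 + κ ^ 2) ≤ Real.pi ^ 2 * κ := by
  set g : ℝ → ℝ := fun t => κ ^ 2 / (Real.sin t ^ 2 + κ ^ 2) with hg
  have hden : ∀ t, 0 < Real.sin t ^ 2 + κ ^ 2 := fun t => by positivity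
  have hgc : Continuous g := by
    refine Continuous.div (by fun_prop) (by fun_prop) (fun t => (hden t).ne')
  have hper : Function.Periodic g Real.pi := by
    intro t; simp [hg, Real.sin_add_pi]
  have h1 : ∫ t in (0 : ℝ)..(2 * Real.pi), κ ^ 2 / (Real.sin (t - φ) ^ 2 + κ ^ 2)
      = 2 * ∫ t in (-(Real.pi / 2))..(Real.pi / 2), g t := by
    have e1 : ∫ t in (0 : ℝ)..(2 * Real.pi), κ ^ 2 / (Real.sin (t - φ) ^ 2 + κ ^ 2)
      = ∫ t in (0 - φ)..(2 * Real.pi - φ), g t :=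
      intervalIntegral.integral_comp_sub_right (fun t => g t) φ
    rw [e1]
    have e2 := hper.intervalIntegral_add_eq_add (0 - φ) (0 - φ + Real.pi)
      (fun t₁ t₂ => hgc.intervalIntegrable _ _)
    have e3 : (0 - φ + Real.pi + Real.pi) = 2 * Real.pi - φ := by ring
    rw [e3] at e2
    rw [e2]
    have e4 := hper.intervalIntegral_add_eq (0 - φ + Real.pi) (0 - φ)
    have e5 := hper.intervalIntegral_add_eq (0 - φ) (-(Real.pi / 2))
    have e6 : -(Real.pi / 2) + Real.pi = Real.pi / 2 := by ring
    rw [e6] at e5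
    rw [e3] at e4
    first
      | rw [e4, e5]; ring
      | rw [e5]; ring
  rw [h1]
  set a : ℝ := Real.pi / 2 * κ with ha
  have hπ := Real.pi_pos
  have ha0 : 0 < a := by positivity
  have h2 : ∫ t in (-(Real.pi / 2))..(Real.pi / 2), g t ≤
      ∫ t in (-(Real.pi / 2))..(Real.pi / 2), 1 / (1 + (t / a) ^ 2) := by
    apply intervalIntegral.integral_mono_on (by linarith) (hgc.intervalIntegrable _ _)
    · apply Continuous.intervalIntegrable
      refine Continuous.div (by fun_prop) (by fun_prop) (fun t => by positivity)
    · intro t ht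
      have hs : (2 / Real.pi * t) ^ 2 ≤ Real.sin t ^ 2 := by
        rcases le_total 0 t with h0 | h0
        · have := Real.mul_le_sin h0 ht.2
          apply pow_le_pow_left₀ (by positivity) this
        · have := Real.mul_le_sin (x := -t) (by linarith) (by linarith [ht.1])
          rw [Real.sin_neg] at this
          have h3 : 0 ≤ 2 / Real.pi * (-t) := mul_nonneg (by positivity) (by linarith)
          have := pow_le_pow_left₀ h3 this 2
          nlinarith
      have e : 1 / (1 + (t / a) ^ 2) = κ ^ 2 / ((2 / Real.pi * t) ^ 2 + κ ^ 2) := by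
        rw [ha]; field_simp; ring
      rw [e]
      show κ ^ 2 / _ ≤ _
      gcongr
  have h3 : ∫ t in (-(Real.pi / 2))..(Real.pi / 2), 1 / (1 + (t / a) ^ 2) ≤ Real.pi * a := by
    rw [intervalIntegral.integral_comp_div (fun u => 1 / (1 + u ^ 2)) ha0.ne']
    rw [integral_one_div_one_add_sq, smul_eq_mul]
    have := Real.arctan_lt_pi_div_two (Real.pi / 2 / a)
    have := Real.neg_pi_div_two_lt_arctan (-(Real.pi / 2) / a)
    nlinarith
  have : Real.pi * a = Real.pi ^ 2 * κ / 2 := by rw [ha]; ring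
  linarith

end partA1

section partA2

/-- The basic ratio functional. -/
noncomputable def Phi (ε u v : ℝ) : ℝ := ε ^ 2 * v ^ 2 / (u ^ 2 + ε ^ 2 * v ^ 2)

lemma Phi_nonneg (ε u v : ℝ) : 0 ≤ Phi ε u v := by unfold Phi; positivity

lemma Phi_le_one (ε u v : ℝ) : Phi ε u v ≤ 1 := by
  unfold Phi
  apply div_le_one_of_le₀
  · nlinarith [sq_nonneg u]
  · positivity

lemma Phi_measurable (ε : ℝ) : Measurable (fun z : ℝ × ℝ => Phi ε z.1 z.2) := by
  unfold Phi; fun_prop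

lemma Phi_comp_intervalIntegrable (ε : ℝ) (P P' : ℝ → ℝ) (hP : Continuous P) (hP' : Continuous P')
    (a b : ℝ) : IntervalIntegrable (fun t => Phi ε (P t) (P' t)) MeasureTheory.volume a b := by
  rw [intervalIntegrable_iff]
  apply MeasureTheory.Measure.integrableOn_of_bounded (M := 1)
  · simp
  · exact ((Phi_measurable ε).comp (hP.measurable.prodMk hP'.measurable)).aestronglyMeasurable
  · filter_upwards with t
    rw [Real.norm_of_nonneg (Phi_nonneg _ _ _)]
    exact Phi_le_one _ _ _

lemma norm_exp_sub_ge (t : ℝ) (z : ℂ) :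
    Real.sin (t - z.arg) ^ 2 ≤ ‖Complex.exp (t * Complex.I) - z‖ ^ 2 := by
  have h1 : Complex.exp (t * Complex.I) - z =
      Complex.exp (z.arg * Complex.I) * (Complex.exp (((t - z.arg : ℝ) : ℂ) * Complex.I) - ‖z‖) := by
    rw [mul_sub, ← Complex.exp_add]
    conv_lhs => rw [← Complex.norm_mul_exp_arg_mul_I z]
    push_cast
    ring_nf
  rw [h1, norm_mul, Complex.norm_exp_ofReal_mul_I, one_mul, ← sq_abs (Real.sin _)]
  gcongr
  have h2 := Complex.abs_im_le_norm (Complex.exp (((t - z.arg : ℝ) : ℂ) * Complex.I) - ‖z‖)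
  rw [Complex.sub_im, Complex.exp_ofReal_mul_I_im, Complex.ofReal_im, sub_zero] at h2
  exact h2

lemma min_one_add_le (a b : ℝ) (ha : 0 ≤ a) (hb : 0 ≤ b) : min 1 (a + b) ≤ min 1 a + min 1 b := by
  rcases le_total 1 a with h | h <;> rcases le_total 1 b with h' | h' <;>
  simp [min_def] <;> split_ifs <;> linarith

lemma min_one_multiset (s : Multiset ℝ) (hs : ∀ x ∈ s, 0 ≤ x) :
    min 1 s.sum ≤ (s.map (fun x => min 1 x)).sum := by
  induction s using Multiset.induction_on with
  | empty => simp
  | cons a s ih =>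
    simp only [Multiset.sum_cons, Multiset.map_cons]
    have h1 := ih (fun x hx => hs x (Multiset.mem_cons_of_mem hx))
    have h2 := min_one_add_le a s.sum (hs a (Multiset.mem_cons_self _ _))
      (Multiset.sum_nonneg (fun x hx => hs x (Multiset.mem_cons_of_mem hx)))
    linarith

lemma multiset_sq_sum_le (s : Multiset ℝ) : s.sum ^ 2 ≤ s.card * (s.map (fun x => x ^ 2)).sum := by
  induction s using Multiset.induction_on with
  | empty => simp
  | cons a s ih =>
    simp only [Multiset.sum_cons, Multiset.map_cons, Multiset.card_cons]
    push_cast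
    rcases Nat.eq_zero_or_pos s.card with h | h
    · rw [Multiset.card_eq_zero] at h; subst h; simp
    · have hc : (0:ℝ) < s.card := by exact_mod_cast h
      set c : ℝ := (s.card : ℝ)
      set S := s.sum
      set T := (s.map (fun x => x ^ 2)).sum
      have h3 : 0 ≤ (c * a - S) ^ 2 := sq_nonneg _
      have h4 : c * (a + S) ^ 2 ≤ c * ((c + 1) * (a ^ 2 + T)) := by nlinarith
      exact le_of_mul_le_mul_left h4 hc

lemma min_one_div_le (κ w s : ℝ) (hκ : 0 < κ) (h : s ≤ w) (hs : 0 ≤ s) :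
    min 1 (κ ^ 2 * w⁻¹) ≤ 2 * (κ ^ 2 / (s + κ ^ 2)) := by
  have hk : 0 < κ ^ 2 := by positivity
  have h1 : min 1 (κ ^ 2 * w⁻¹) ≤ 2 * (κ ^ 2 / (w + κ ^ 2)) := by
    rcases le_total w (κ ^ 2) with h' | h'
    · apply (min_le_left _ _).trans
      rw [← mul_div_assoc, le_div_iff₀ (by linarith)]; linarith
    · apply (min_le_right _ _).trans
      have : 0 < w := by linarith
      rw [← mul_div_assoc, ← div_eq_mul_inv, div_le_div_iff₀ this (by linarith)]
      nlinarith
  refine h1.trans ?_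
  gcongr

lemma P_deriv_formula (d : ℕ) (Q : Polynomial ℂ) (P P' : ℝ → ℝ)
    (hP : ∀ t : ℝ, (P t : ℂ) = Complex.exp (-(d * t * Complex.I)) * Q.eval (Complex.exp (t * Complex.I)))
    (hP' : ∀ t, HasDerivAt P (P' t) t) (t : ℝ) :
    (P' t : ℂ) = -(d * Complex.I) * P t + Complex.exp (-(d * t * Complex.I)) *
      (Complex.I * Complex.exp (t * Complex.I) * Q.derivative.eval (Complex.exp (t * Complex.I))) := by
  have h1 : HasDerivAt (fun t : ℝ => (P t : ℂ)) (P' t : ℂ) t := (hP' t).ofReal_comp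
  have h2 : HasDerivAt (fun t : ℂ => Complex.exp (-(d * t * Complex.I)) * Q.eval (Complex.exp (t * Complex.I)))
      (Complex.exp (-(d * t * Complex.I)) * (-(d * 1 * Complex.I)) * Q.eval (Complex.exp (t * Complex.I)) +
      Complex.exp (-(d * t * Complex.I)) * (Q.derivative.eval (Complex.exp (t * Complex.I)) *
        (Complex.exp (t * Complex.I) * (1 * Complex.I)))) (t : ℂ) := by
    apply HasDerivAt.mul
    · exact ((((hasDerivAt_id (t:ℂ)).const_mul (d:ℂ)).mul_const Complex.I).neg).cexp
    · exact (Q.hasDerivAt _).comp (t:ℂ) (((hasDerivAt_id (t:ℂ)).mul_const Complex.I).cexp)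
  have h3 := h2.comp_ofReal
  have h4 : (fun t : ℝ => (P t : ℂ)) = fun t : ℝ => Complex.exp (-(d * t * Complex.I)) * Q.eval (Complex.exp (t * Complex.I)) := by
    funext t; exact hP t
  rw [h4] at h1
  rw [h1.unique h3, hP t]
  ring

lemma norm_exp_neg (d : ℕ) (t : ℝ) : ‖Complex.exp (-(d * t * Complex.I))‖ = 1 := by
  have : (-(d * t * Complex.I)) = ((-(d * t) : ℝ) : ℂ) * Complex.I := by push_cast; ring
  rw [this, Complex.norm_exp_ofReal_mul_I]

lemma W_pointwise (d : ℕ) (hd : 1 ≤ d) (Q : Polynomial ℂ) (hQ : Q.natDegree ≤ 2 * d) (hQ0 : Q ≠ 0)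
    (P P' : ℝ → ℝ)
    (hP : ∀ t : ℝ, (P t : ℂ) = Complex.exp (-(d * t * Complex.I)) * Q.eval (Complex.exp (t * Complex.I)))
    (hP' : ∀ t, HasDerivAt P (P' t) t) (ε : ℝ) (hε : 0 < ε) (t : ℝ) :
    Phi ε (P t) (P' t) ≤ √(2 * d + 1) * ε * d +
      (Q.roots.map (fun z => 2 * ((√(2 * d + 1) * ε) ^ 2 /
        (Real.sin (t - z.arg) ^ 2 + (√(2 * d + 1) * ε) ^ 2)))).sum := by
  set κ := √(2 * d + 1) * ε with hκ
  have hκ0 : 0 < κ := by positivity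
  set e := Complex.exp (t * Complex.I) with he
  have hne : ‖e‖ = 1 := Complex.norm_exp_ofReal_mul_I t
  have hκ2 : κ ^ 2 = (2 * d + 1) * ε ^ 2 := by
    rw [hκ, mul_pow, Real.sq_sqrt (by positivity)]
  have hterm : ∀ x ∈ Q.roots.map (fun z => 2 * (κ ^ 2 / (Real.sin (t - z.arg) ^ 2 + κ ^ 2))), 0 ≤ x := by
    intro x hx
    rw [Multiset.mem_map] at hx
    obtain ⟨z, _, rfl⟩ := hx
    positivity
  by_cases hz : Q.eval e = 0
  · have hmem : e ∈ Q.roots := by rw [Polynomial.mem_roots hQ0]; exact hz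
    have h1 := Multiset.single_le_sum hterm _ (Multiset.mem_map_of_mem _ hmem)
    have h2 : Real.sin (t - e.arg) ^ 2 = 0 := by
      have := norm_exp_sub_ge t e
      rw [← he, sub_self, norm_zero] at this
      nlinarith [sq_nonneg (Real.sin (t - e.arg))]
    rw [h2, zero_add, div_self (by positivity)] at h1
    have h3 := Phi_le_one ε (P t) (P' t)
    have : 0 ≤ κ * d := by positivity
    linarith
  · have hPt : (P t : ℂ) ≠ 0 := by
      rw [hP t]; exact mul_ne_zero (Complex.exp_ne_zero _) hz
    have hPt' : P t ≠ 0 := by exact_mod_cast hPt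
    have hform : ((P' t / P t : ℝ) : ℂ) = -(d * Complex.I) + Complex.I * e *
        (Q.roots.map (fun z => 1 / (e - z))).sum := by
      have h5 := Polynomial.Splits.eval_derivative_div_eval_of_ne_zero (IsAlgClosed.splits Q) hz
      rw [← h5]
      push_cast
      rw [P_deriv_formula d Q P P' hP hP' t, ← he, hP t]
      rw [← he]
      have := Complex.exp_ne_zero (-(d * t * Complex.I))
      field_simp
    have hab : |P' t / P t| ≤ d + (Q.roots.map (fun z => ‖e - z‖⁻¹)).sum := by
      rw [← Real.norm_eq_abs, ← Complex.norm_real, hform]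
      refine (norm_add_le _ _).trans ?_
      gcongr
      · simp
      · rw [norm_mul, norm_mul, hne, Complex.norm_I, one_mul, one_mul]
        refine (norm_multiset_sum_le _).trans ?_
        simp [Multiset.map_map, Function.comp_def]
    have hcard : Q.roots.card ≤ 2 * d := (Polynomial.card_roots' Q).trans hQ
    have hsq : (P' t / P t) ^ 2 ≤ (2 * d + 1) * (d ^ 2 + (Q.roots.map (fun z => (‖e - z‖ ^ 2)⁻¹)).sum) := by
      have h6 := multiset_sq_sum_le ((d : ℝ) ::ₘ (Q.roots.map (fun z => ‖e - z‖⁻¹)))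
      simp only [Multiset.sum_cons, Multiset.card_cons, Multiset.map_cons, Multiset.map_map,
        Function.comp_def, Multiset.card_map, inv_pow] at h6
      have h7 : (P' t / P t) ^ 2 ≤ (d + (Q.roots.map (fun z => ‖e - z‖⁻¹)).sum) ^ 2 := by
        rw [← sq_abs]; gcongr
      refine h7.trans (h6.trans ?_)
      have hnn : 0 ≤ (d:ℝ) ^ 2 + (Q.roots.map (fun z => (‖e - z‖ ^ 2)⁻¹)).sum := by
        have : 0 ≤ (Q.roots.map (fun z => (‖e - z‖ ^ 2)⁻¹)).sum := by
          apply Multiset.sum_nonneg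
          intro x hx
          rw [Multiset.mem_map] at hx
          obtain ⟨z, _, rfl⟩ := hx
          positivity
        positivity
      gcongr
      push_cast
      have : (Q.roots.card : ℝ) ≤ 2 * d := by exact_mod_cast hcard
      linarith
    have hPhi : Phi ε (P t) (P' t) ≤ min 1 (ε ^ 2 * (P' t / P t) ^ 2) := by
      apply le_min (Phi_le_one _ _ _)
      unfold Phi
      rw [div_pow, ← mul_div_assoc]
      have : 0 < P t ^ 2 := by positivity
      gcongr
      nlinarith [sq_nonneg (ε * P' t)]
    refine hPhi.trans ?_
    have h8 : ε ^ 2 * (P' t / P t) ^ 2 ≤ (((κ * d) ^ 2) ::ₘ (Q.roots.map (fun z => κ ^ 2 * (‖e - z‖ ^ 2)⁻¹))).sum := by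
      rw [Multiset.sum_cons, Multiset.sum_map_mul_left]
      have := mul_le_mul_of_nonneg_left hsq (sq_nonneg ε)
      rw [mul_pow, hκ2]
      linarith
    refine (min_le_min_left 1 h8).trans ?_
    refine (min_one_multiset _ ?_).trans ?_
    · intro x hx
      rw [Multiset.mem_cons, Multiset.mem_map] at hx
      rcases hx with rfl | ⟨z, _, rfl⟩ <;> positivity
    · rw [Multiset.map_cons, Multiset.sum_cons, Multiset.map_map]
      gcongr
      · have : 0 ≤ κ * d := by positivity
        rcases le_total 1 (κ * d) with h | h
        · exact (min_le_left _ _).trans h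
        · exact (min_le_right _ _).trans (by nlinarith)
      · apply Multiset.sum_map_le_sum_map
        intro z _
        simp only [Function.comp_apply]
        apply min_one_div_le _ _ _ hκ0 (norm_exp_sub_ge t z) (sq_nonneg _)

lemma lorentz_continuous (κ φ : ℝ) (hκ : 0 < κ) :
    Continuous (fun t => κ ^ 2 / (Real.sin (t - φ) ^ 2 + κ ^ 2)) := by
  apply Continuous.div (by fun_prop) (by fun_prop)
  intro t; positivity

lemma W_multiset (κ : ℝ) (hκ : 0 < κ) (s : Multiset ℂ) :
    Continuous (fun t : ℝ => (s.map (fun z => 2 * (κ ^ 2 / (Real.sin (t - z.arg) ^ 2 + κ ^ 2)))).sum) ∧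
    ∫ t in (0:ℝ)..(2 * Real.pi), (s.map (fun z => 2 * (κ ^ 2 / (Real.sin (t - z.arg) ^ 2 + κ ^ 2)))).sum
      ≤ s.card * (2 * (Real.pi ^ 2 * κ)) := by
  induction s using Multiset.induction_on with
  | empty => simp [continuous_const]
  | cons a s ih =>
    simp only [Multiset.sum_cons, Multiset.map_cons, Multiset.card_cons]
    have hc := lorentz_continuous κ a.arg hκ
    have hc2 : Continuous (fun t : ℝ => 2 * (κ ^ 2 / (Real.sin (t - a.arg) ^ 2 + κ ^ 2))) := by fun_prop
    refine ⟨hc2.add ih.1, ?_⟩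
    rw [intervalIntegral.integral_add (hc2.intervalIntegrable _ _) (ih.1.intervalIntegrable _ _),
      intervalIntegral.integral_const_mul]
    have := integral_sin_lorentz κ a.arg hκ
    push_cast
    linarith [ih.2]

lemma W_lemma (d : ℕ) (hd : 1 ≤ d) (Q : Polynomial ℂ) (hQ : Q.natDegree ≤ 2 * d)
    (P P' : ℝ → ℝ)
    (hP : ∀ t : ℝ, (P t : ℂ) = Complex.exp (-(d * t * Complex.I)) * Q.eval (Complex.exp (t * Complex.I)))
    (hP' : ∀ t, HasDerivAt P (P' t) t) (hc : Continuous P') (ε : ℝ) (hε : 0 < ε) :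
    ∫ t in (0:ℝ)..(2 * Real.pi), Phi ε (P t) (P' t) ≤ 100 * (d * √d) * ε := by
  have hPc : Continuous P := by
    rw [continuous_iff_continuousAt]; intro t; exact (hP' t).continuousAt
  have hpi : 0 ≤ 2 * Real.pi := by positivity
  by_cases hQ0 : Q = 0
  · have h0 : ∀ t, Phi ε (P t) (P' t) = 0 := by
      intro t
      have h1 := P_deriv_formula d Q P P' hP hP' t
      have h2 := hP t
      subst hQ0
      simp at h2
      rw [h2] at h1
      simp at h1
      simp [Phi, h1]
    simp only [h0, intervalIntegral.integral_zero]
    positivity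
  · set κ := √(2 * d + 1) * ε with hκ
    have hκ0 : 0 < κ := by positivity
    obtain ⟨w1, w2⟩ := W_multiset κ hκ0 Q.roots
    have h1 : ∫ t in (0:ℝ)..(2 * Real.pi), Phi ε (P t) (P' t) ≤
       ∫ t in (0:ℝ)..(2 * Real.pi), (κ * d + (Q.roots.map (fun z => 2 * (κ ^ 2 /
        (Real.sin (t - z.arg) ^ 2 + κ ^ 2)))).sum) := by
      apply intervalIntegral.integral_mono_on hpi
      · exact Phi_comp_intervalIntegrable _ _ _ hPc hc _ _
      · exact (continuous_const.add w1).intervalIntegrable _ _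
      · intro t _
        exact W_pointwise d hd Q hQ hQ0 P P' hP hP' ε hε t
    refine h1.trans ?_
    rw [intervalIntegral.integral_add (by simp) (w1.intervalIntegrable _ _), intervalIntegral.integral_const]
    have hcard : (Q.roots.card : ℝ) ≤ 2 * d := by exact_mod_cast (Polynomial.card_roots' Q).trans hQ
    have hpi2 := Real.pi_lt_d2
    have hpi3 := Real.pi_pos
    have hd1 : (1:ℝ) ≤ d := by exact_mod_cast hd
    have hk : κ ≤ 2 * √d * ε := by
      rw [hκ]
      gcongr
      rw [show 2 * √(d:ℝ) = √(2 ^ 2 * d) by rw [Real.sqrt_mul (by positivity), Real.sqrt_sq (by norm_num)]]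
      apply Real.sqrt_le_sqrt; linarith
    have h3 : (Q.roots.card : ℝ) * (2 * (Real.pi ^ 2 * κ)) ≤ 2 * d * (2 * (10 * κ)) := by
      have : Real.pi ^ 2 ≤ 10 := by nlinarith
      gcongr
    have h4 : (2 * Real.pi - 0) • (κ * (d:ℝ)) ≤ 7 * (κ * d) := by
      rw [smul_eq_mul]; gcongr; linarith
    have h5 : κ * d ≤ 2 * √d * ε * d := by gcongr
    nlinarith

end partA2

section partA3

lemma U_case1_pt (ε H u v : ℝ) (hε : 0 < ε) (hε1 : ε ≤ 1) (hH : 0 ≤ H) (h : |v| ≤ H * |u|) :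
    Phi ε u v ≤ ε * (1 + H) * Phi 1 u v := by
  by_cases hv : v = 0
  · simp [Phi, hv]
  have hu : u ≠ 0 := by
    rintro rfl
    simp at h; exact hv h
  unfold Phi
  have hu2 : 0 < u ^ 2 := by positivity
  have hv2 : 0 < v ^ 2 := by positivity
  rw [one_pow, one_mul, ← mul_div_assoc, div_le_div_iff₀ (by positivity) (by positivity)]
  have h2 : ε * v ^ 2 ≤ H * (u ^ 2 + ε ^ 2 * v ^ 2) := by
    have h3 : v ^ 2 ≤ H * |u| * |v| := by
      rw [← sq_abs v, sq]; gcongr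
    have h4 : ε * (|u| * |v|) ≤ u ^ 2 + ε ^ 2 * v ^ 2 := by
      rw [← sq_abs u, ← sq_abs v]
      nlinarith [sq_nonneg (|u| - ε * |v|), abs_nonneg u, abs_nonneg v, mul_nonneg (mul_nonneg (abs_nonneg u) (abs_nonneg v)) hε.le]
    calc ε * v ^ 2 ≤ ε * (H * |u| * |v|) := by gcongr
      _ = H * (ε * (|u| * |v|)) := by ring
      _ ≤ _ := by gcongr
  have h5 : ε * u ^ 2 ≤ u ^ 2 := by nlinarith
  have h6 : ε * (u ^ 2 + v ^ 2) ≤ (1 + H) * (u ^ 2 + ε ^ 2 * v ^ 2) := by nlinarith [sq_nonneg (ε * v)]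
  have : (ε * v ^ 2) * (ε * (u ^ 2 + v ^ 2)) ≤ (ε * v ^ 2) * ((1 + H) * (u ^ 2 + ε ^ 2 * v ^ 2)) := by gcongr
  linarith

lemma Phi_one_ge_half (u v : ℝ) (h : |u| < |v|) : 1 / 2 ≤ Phi 1 u v := by
  unfold Phi
  have h1 : u ^ 2 < v ^ 2 := sq_lt_sq.mpr h
  rw [div_le_div_iff₀ (by norm_num) (by nlinarith [sq_nonneg u])]
  nlinarith

lemma growth_pt (M B u v : ℝ) (hM : |u| ≤ M) (hv : |v| ≤ B * M) :
    -(4 * B * M ^ 2) * Phi 1 u v ≤ 2 * u ^ 2 + 2 * u * v := by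
  have hM0 : 0 ≤ M := (abs_nonneg u).trans hM
  have hBM : 0 ≤ B * M := (abs_nonneg v).trans hv
  have hphi := Phi_nonneg 1 u v
  have huv : -(|u| * |v|) ≤ u * v := by rw [← abs_mul]; exact neg_abs_le _
  rcases le_or_gt |v| |u| with h | h
  · have : |u| * |v| ≤ u ^ 2 := by rw [← sq_abs u, sq]; gcongr
    have h2 : 0 ≤ (B * M) * M * Phi 1 u v := by positivity
    nlinarith
  · have h1 := Phi_one_ge_half u v h
    have h2 : |u| * |v| ≤ M * (B * M) := by gcongr
    have h3 : (B * M) * M * (1 / 2) ≤ (B * M) * M * Phi 1 u v := by gcongr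
    nlinarith [sq_nonneg u]

lemma U_lemma : ∃ C : ℝ, 0 < C ∧ ∀ (d : ℕ) (_ : 1 ≤ d) (Q : Polynomial ℂ) (_ : Q.natDegree ≤ 2 * d)
    (P P' : ℝ → ℝ)
    (_ : ∀ t : ℝ, (P t : ℂ) = Complex.exp (-(d * t * Complex.I)) * Q.eval (Complex.exp (t * Complex.I)))
    (_ : ∀ t, HasDerivAt P (P' t) t) (_ : Continuous P') (ε : ℝ) (_ : 0 < ε) (_ : ε ≤ 1),
    ∫ t in (0:ℝ)..(2 * Real.pi), Phi ε (P t) (P' t) ≤ C * (d ^ 2 * √d) * ε *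
      ∫ t in (0:ℝ)..(2 * Real.pi), Phi 1 (P t) (P' t) := by
  set E := Real.exp (-(4 * Real.pi)) with hE
  have hE0 : 0 < E := Real.exp_pos _
  refine ⟨5600 / E + (1 + 7 * √(2 / E)), by positivity, ?_⟩
  intro d hd Q hQ P P' hP hP' hc ε hε hε1
  have hd1 : (1:ℝ) ≤ d := by exact_mod_cast hd
  have hsd : 1 ≤ √(d:ℝ) := by rw [Real.one_le_sqrt]; exact hd1
  have hPc : Continuous P := by
    rw [continuous_iff_continuousAt]; intro t; exact (hP' t).continuousAt
  -- maximum
  obtain ⟨z0, hz0, hmax⟩ := (isCompact_sphere (0:ℂ) 1).exists_isMaxOn ⟨1, by simp⟩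
    (f := fun z => ‖Q.eval z‖) (by fun_prop)
  set M := ‖Q.eval z0‖ with hM
  have hMall : ∀ z : ℂ, ‖z‖ = 1 → ‖Q.eval z‖ ≤ M := by
    intro z hz; exact hmax (by simpa using hz)
  have habsP : ∀ t : ℝ, |P t| = ‖Q.eval (Complex.exp (t * Complex.I))‖ := by
    intro t
    rw [← Real.norm_eq_abs, ← Complex.norm_real, hP t, norm_mul, norm_exp_neg, one_mul]
  have hPM : ∀ t, |P t| ≤ M := by
    intro t; rw [habsP]; exact hMall _ (Complex.norm_exp_ofReal_mul_I t)
  have hM0 : 0 ≤ M := norm_nonneg _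
  have hP'M : ∀ t, |P' t| ≤ 7 * d * M := by
    intro t
    rw [← Real.norm_eq_abs, ← Complex.norm_real, P_deriv_formula d Q P P' hP hP' t]
    refine (norm_add_le _ _).trans ?_
    have hb := poly_bernstein Q (2 * d) (by omega) hQ M hMall _ (Complex.norm_exp_ofReal_mul_I t)
    rw [norm_mul, norm_mul, norm_mul, norm_mul, norm_exp_neg, Complex.norm_exp_ofReal_mul_I, Complex.norm_I]
    have h1 : ‖-((d:ℂ) * Complex.I)‖ = d := by simp
    rw [h1, Complex.norm_real, Real.norm_eq_abs]
    have h2 : d * |P t| ≤ d * M := by gcongr; exact hPM t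
    push_cast at hb
    linarith
  set ts := z0.arg with hts
  have hPts : P ts ^ 2 = M ^ 2 := by
    rw [← sq_abs, habsP, hM]
    congr 3
    have := Complex.norm_mul_exp_arg_mul_I z0
    rw [show ‖z0‖ = 1 by simpa using hz0] at this
    simpa using congrArg id this
  -- periodicity
  have hexp1 : ∀ t : ℝ, Complex.exp (((t + 2 * Real.pi : ℝ) : ℂ) * Complex.I) = Complex.exp (t * Complex.I) := by
    intro t
    push_cast
    rw [add_mul, Complex.exp_add, Complex.exp_two_pi_mul_I, mul_one]
  have hexp2 : ∀ t : ℝ, Complex.exp (-(d * ((t + 2 * Real.pi : ℝ) : ℂ) * Complex.I)) = Complex.exp (-(d * t * Complex.I)) := by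
    intro t
    rw [Complex.exp_neg, Complex.exp_neg]
    congr 1
    rw [mul_assoc, mul_assoc, Complex.exp_nat_mul, Complex.exp_nat_mul, hexp1]
  have hPper : ∀ t : ℝ, P (t + 2 * Real.pi) = P t := by
    intro t
    have : (P (t + 2 * Real.pi) : ℂ) = P t := by rw [hP, hP, hexp1, hexp2]
    exact_mod_cast this
  have hP'per : ∀ t : ℝ, P' (t + 2 * Real.pi) = P' t := by
    intro t
    have : (P' (t + 2 * Real.pi) : ℂ) = P' t := by
      rw [P_deriv_formula d Q P P' hP hP', P_deriv_formula d Q P P' hP hP', hexp1, hexp2, hPper]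
    exact_mod_cast this
  have hshift : ∀ e : ℝ, ∫ t in (0:ℝ)..(2 * Real.pi), Phi e (P t) (P' t) =
      ∫ t in ts..(ts + 2 * Real.pi), Phi e (P t) (P' t) := by
    intro e
    have hper : Function.Periodic (fun t => Phi e (P t) (P' t)) (2 * Real.pi) := by
      intro t; simp only [hPper, hP'per]
    have := hper.intervalIntegral_add_eq 0 ts
    simpa using this
  set J := ∫ t in (0:ℝ)..(2 * Real.pi), Phi 1 (P t) (P' t) with hJ
  have hpi := Real.pi_pos
  have hJ0 : 0 ≤ J := intervalIntegral.integral_nonneg (by positivity) (fun t _ => Phi_nonneg _ _ _)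
  rcases le_or_gt (56 * d * J) E with hcase | hcase
  · -- small J
    have hlow : ∀ t ∈ Set.Icc ts (ts + 2 * Real.pi), M ^ 2 * (E / 2) ≤ P t ^ 2 := by
      intro t ht
      have hder : ∀ s, HasDerivAt (fun s => Real.exp (2 * s) * P s ^ 2)
          (Real.exp (2 * s) * (2 * P s ^ 2 + 2 * P s * P' s)) s := by
        intro s
        have h1 : HasDerivAt (fun s => Real.exp (2 * s)) (Real.exp (2 * s) * (2 * 1)) s :=
          ((hasDerivAt_id s).const_mul 2).exp
        have h2 := h1.mul ((hP' s).pow 2)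
        refine HasDerivAt.congr_deriv h2 ?_
        simp only [Pi.pow_apply]
        push_cast
        ring
      have hcont : Continuous (fun s => Real.exp (2 * s) * (2 * P s ^ 2 + 2 * P s * P' s)) := by fun_prop
      have hftc := intervalIntegral.integral_eq_sub_of_hasDerivAt (a := ts) (b := t)
        (fun s _ => hder s) (hcont.intervalIntegrable _ _)
      have hlb : ∫ s in ts..t, (-(28 * d * M ^ 2) * Real.exp (2 * t)) * Phi 1 (P s) (P' s) ≤
          ∫ s in ts..t, Real.exp (2 * s) * (2 * P s ^ 2 + 2 * P s * P' s) := by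
        apply intervalIntegral.integral_mono_on ht.1
        · exact (Phi_comp_intervalIntegrable _ _ _ hPc hc _ _).const_mul _
        · exact hcont.intervalIntegrable _ _
        · intro s hs
          have h1 := growth_pt M (7 * d) (P s) (P' s) (hPM s) (hP'M s)
          have h2 : Real.exp (2 * s) ≤ Real.exp (2 * t) := Real.exp_le_exp.mpr (by linarith [hs.2])
          have h3 : 0 ≤ 28 * d * M ^ 2 * Phi 1 (P s) (P' s) := by
            have := Phi_nonneg 1 (P s) (P' s); positivity
          have h4 := mul_le_mul_of_nonneg_right h2 h3
          have h5 := mul_le_mul_of_nonneg_left h1 (Real.exp_pos (2 * s)).le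
          nlinarith
      rw [intervalIntegral.integral_const_mul, hftc] at hlb
      have hJt : ∫ s in ts..t, Phi 1 (P s) (P' s) ≤ J := by
        rw [hJ, hshift 1]
        apply intervalIntegral.integral_mono_interval le_rfl ht.1 ht.2
        · filter_upwards with s using Phi_nonneg _ _ _
        · exact Phi_comp_intervalIntegrable _ _ _ hPc hc _ _
      have hJt2 : (28 * d * M ^ 2) * Real.exp (2 * t) * ∫ s in ts..t, Phi 1 (P s) (P' s) ≤
        (28 * d * M ^ 2) * Real.exp (2 * t) * J := by gcongr
      rw [hPts] at hlb
      have hexp : E * Real.exp (2 * t) ≤ Real.exp (2 * ts) := by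
        rw [hE, ← Real.exp_add]; apply Real.exp_le_exp.mpr; linarith [ht.2]
      have hfin : Real.exp (2 * t) * (M ^ 2 * (E / 2)) ≤ Real.exp (2 * t) * P t ^ 2 := by
        have k1 : Real.exp (2 * t) * M ^ 2 * (56 * d * J) ≤ Real.exp (2 * t) * M ^ 2 * E := by gcongr
        have k2 : M ^ 2 * (E * Real.exp (2 * t)) ≤ M ^ 2 * Real.exp (2 * ts) := by gcongr
        nlinarith
      exact le_of_mul_le_mul_left hfin (Real.exp_pos _)
    set H := 7 * √(2 / E) with hH
    have hH0 : 0 ≤ H := by positivity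
    have hpt : ∀ t ∈ Set.Icc ts (ts + 2 * Real.pi),
        Phi ε (P t) (P' t) ≤ ε * (1 + H * d) * Phi 1 (P t) (P' t) := by
      intro t ht
      apply U_case1_pt _ _ _ _ hε hε1 (by positivity)
      refine (hP'M t).trans ?_
      have h1 := hlow t ht
      have h2 : M ≤ √(2 / E) * |P t| := by
        rw [← Real.sqrt_sq_eq_abs, ← Real.sqrt_mul (by positivity)]
        apply Real.le_sqrt_of_sq_le
        rw [div_mul_eq_mul_div, le_div_iff₀ hE0]
        linarith
      rw [hH]
      calc 7 * d * M ≤ 7 * d * (√(2 / E) * |P t|) := by gcongr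
        _ = _ := by ring
    have hIntg : ∫ t in (0:ℝ)..(2 * Real.pi), Phi ε (P t) (P' t) ≤ ε * (1 + H * d) * J := by
      rw [hshift, hJ, hshift, ← intervalIntegral.integral_const_mul]
      apply intervalIntegral.integral_mono_on (by linarith)
      · exact Phi_comp_intervalIntegrable _ _ _ hPc hc _ _
      · exact (Phi_comp_intervalIntegrable _ _ _ hPc hc _ _).const_mul _
      · exact hpt
    refine hIntg.trans ?_
    rw [mul_comm ε]
    refine mul_le_mul_of_nonneg_right (mul_le_mul_of_nonneg_right ?_ hε.le) hJ0
    have : 0 ≤ 5600 / E := by positivity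
    have h7 : (d:ℝ) ≤ d ^ 2 * √d := by nlinarith [mul_nonneg (sq_nonneg (d:ℝ)) (sub_nonneg.mpr hsd)]
    have h8 : (1:ℝ) ≤ d ^ 2 * √d := hd1.trans h7
    nlinarith [mul_nonneg hH0 (sub_nonneg.mpr h7), mul_nonneg this (sub_nonneg.mpr h8)]
  · refine (W_lemma d hd Q hQ P P' hP hP' hc ε hε).trans ?_
    have h1 : 1 ≤ 56 * d * J / E := by rw [le_div_iff₀ hE0]; linarith
    calc 100 * (d * √d) * ε = 100 * (d * √d) * ε * 1 := by ring
      _ ≤ 100 * (d * √d) * ε * (56 * d * J / E) := by gcongr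
      _ = 5600 / E * (d ^ 2 * √d) * ε * J := by field_simp; ring
      _ ≤ _ := by
        gcongr
        have : 0 ≤ 1 + 7 * √(2 / E) := by positivity
        linarith

end partA3

section partB1

/-- Multilinear polynomial with coefficient family `c`. -/
noncomputable def ml {ι : Type*} [Fintype ι] (c : Finset ι → ℝ) (x : ι → ℝ) : ℝ :=
  ∑ S, c S * ∏ i ∈ S, x i

/-- Coefficients of the part of `ml c` free of the variable `i`. -/
noncomputable def rc {ι : Type*} (i : ι) (c : Finset ι → ℝ) : Finset ι → ℝ :=
  fun S => if i ∈ S then 0 else c S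

/-- Coefficients of the partial derivative in the variable `i`. -/
noncomputable def dc {ι : Type*} (i : ι) (c : Finset ι → ℝ) : Finset ι → ℝ :=
  fun S => if i ∈ S then 0 else c (insert i S)

/-- Degree at most `d`. -/
def DegLe {ι : Type*} (d : ℕ) (c : Finset ι → ℝ) : Prop := ∀ S, d < S.card → c S = 0

lemma sum_finset_split {ι : Type*} [Fintype ι] (i : ι) (f : Finset ι → ℝ) :
    ∑ S, f S = ∑ S, (if i ∈ S then 0 else f S) + ∑ S, (if i ∈ S then 0 else f (insert i S)) := by
  have h1 : ∀ S, f S = (if i ∈ S then 0 else f S) + (if i ∈ S then f S else 0) := by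
    intro S; split_ifs <;> simp
  rw [Finset.sum_congr rfl (fun S _ => h1 S), Finset.sum_add_distrib]
  congr 1
  have h2 : ∑ S, (if i ∈ S then 0 else f (insert i S)) = ∑ S with i ∉ S, f (insert i S) := by
    rw [Finset.sum_filter]; apply Finset.sum_congr rfl; intro S _; split_ifs <;> rfl
  rw [← Finset.sum_filter, h2]
  refine Finset.sum_nbij' (fun S => S.erase i) (fun S => insert i S) ?_ ?_ ?_ ?_ ?_
  · intro S _; simp
  · intro S _; simp
  · intro S hS; simp at hS; exact Finset.insert_erase hS
  · intro S hS; simp at hS; exact Finset.erase_insert hS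
  · intro S hS; simp at hS; simp [Finset.insert_erase hS]

lemma ml_split {ι : Type*} [Fintype ι] (i : ι) (c : Finset ι → ℝ) (x : ι → ℝ) :
    ml c x = ml (rc i c) x + x i * ml (dc i c) x := by
  unfold ml
  rw [sum_finset_split i, Finset.mul_sum]
  congr 1
  · apply Finset.sum_congr rfl; intro S _; unfold rc; split_ifs <;> simp
  · apply Finset.sum_congr rfl; intro S _; unfold dc; split_ifs with h
    · simp
    · rw [Finset.prod_insert h]; ring

lemma ml_update_of_free {ι : Type*} [Fintype ι] (i : ι) (c : Finset ι → ℝ)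
    (hc : ∀ S, i ∈ S → c S = 0) (x : ι → ℝ) (s : ℝ) :
    ml c (Function.update x i s) = ml c x := by
  unfold ml
  apply Finset.sum_congr rfl
  intro S _
  by_cases h : i ∈ S
  · rw [hc S h]; simp
  · congr 1
    apply Finset.prod_congr rfl
    intro j hj
    rw [Function.update_of_ne]
    rintro rfl; exact h hj

lemma ml_update {ι : Type*} [Fintype ι] (i : ι) (c : Finset ι → ℝ) (x : ι → ℝ) (s : ℝ) :
    ml c (Function.update x i s) = ml (rc i c) x + s * ml (dc i c) x := by
  rw [ml_split i, ml_update_of_free i (rc i c), ml_update_of_free i (dc i c), Function.update_self]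
  · intro S hS; simp [dc, hS]
  · intro S hS; simp [rc, hS]

lemma sum_sq_split {ι : Type*} [Fintype ι] (i : ι) (c : Finset ι → ℝ) :
    ∑ S, c S ^ 2 = ∑ S, rc i c S ^ 2 + ∑ S, dc i c S ^ 2 := by
  rw [sum_finset_split i]
  congr 1 <;> (apply Finset.sum_congr rfl; intro S _; simp only [rc, dc]; split_ifs <;> simp)

lemma sum_dc_sq {ι : Type*} [Fintype ι] (i : ι) (c : Finset ι → ℝ) :
    ∑ S, dc i c S ^ 2 = ∑ S, if i ∈ S then c S ^ 2 else 0 := by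
  rw [sum_finset_split i (fun S => if i ∈ S then c S ^ 2 else 0)]
  have : ∑ S : Finset ι, (if i ∈ S then 0 else if i ∈ S then c S ^ 2 else 0) = 0 := by
    apply Finset.sum_eq_zero; intro S _; split_ifs <;> rfl
  rw [this, zero_add]
  apply Finset.sum_congr rfl; intro S _; simp only [dc]; split_ifs <;> simp_all

lemma DegLe.rc {ι : Type*} {d : ℕ} {c : Finset ι → ℝ} (h : DegLe d c) (i : ι) : DegLe d (rc i c) := by
  intro S hS; simp [_root_.rc, h S hS]

lemma DegLe.dc {ι : Type*} {d : ℕ} {c : Finset ι → ℝ} (h : DegLe d c) (i : ι) :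
    DegLe (d - 1) (dc i c) := by
  intro S hS
  unfold _root_.dc
  split_ifs with hi
  · rfl
  · apply h; rw [Finset.card_insert_of_notMem hi]; omega

lemma DegLe.mono {ι : Type*} {d e : ℕ} {c : Finset ι → ℝ} (h : DegLe d c) (hde : d ≤ e) : DegLe e c :=
  fun S hS => h S (by omega)

/-- Polynomial functions on `ι → ℝ`. -/
def IsPolyF {ι : Type*} (f : (ι → ℝ) → ℝ) : Prop :=
  ∃ q : MvPolynomial ι ℝ, ∀ x, f x = MvPolynomial.eval x q

namespace IsPolyF
variable {ι : Type*} {f g : (ι → ℝ) → ℝ}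
lemma const (a : ℝ) : IsPolyF (fun _ : ι → ℝ => a) := ⟨MvPolynomial.C a, by simp⟩
lemma coord (i : ι) : IsPolyF (fun x : ι → ℝ => x i) := ⟨MvPolynomial.X i, by simp⟩
lemma add (hf : IsPolyF f) (hg : IsPolyF g) : IsPolyF (fun x => f x + g x) := by
  obtain ⟨p, hp⟩ := hf; obtain ⟨q, hq⟩ := hg
  exact ⟨p + q, by simp [hp, hq]⟩
lemma mul (hf : IsPolyF f) (hg : IsPolyF g) : IsPolyF (fun x => f x * g x) := by
  obtain ⟨p, hp⟩ := hf; obtain ⟨q, hq⟩ := hg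
  exact ⟨p * q, by simp [hp, hq]⟩
lemma pow (hf : IsPolyF f) (k : ℕ) : IsPolyF (fun x => f x ^ k) := by
  obtain ⟨p, hp⟩ := hf
  exact ⟨p ^ k, by simp [hp]⟩
lemma sum {α : Type*} (s : Finset α) (F : α → (ι → ℝ) → ℝ) (hF : ∀ a ∈ s, IsPolyF (F a)) :
    IsPolyF (fun x => ∑ a ∈ s, F a x) := by
  classical
  induction s using Finset.induction_on with
  | empty => simpa using const 0
  | insert a s ha ih =>
    simp only [Finset.sum_insert ha]
    exact (hF a (by simp)).add (ih (fun b hb => hF b (by simp [hb])))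
lemma prod {α : Type*} (s : Finset α) (F : α → (ι → ℝ) → ℝ) (hF : ∀ a ∈ s, IsPolyF (F a)) :
    IsPolyF (fun x => ∏ a ∈ s, F a x) := by
  classical
  induction s using Finset.induction_on with
  | empty => simpa using const 1
  | insert a s ha ih =>
    simp only [Finset.prod_insert ha]
    exact (hF a (by simp)).mul (ih (fun b hb => hF b (by simp [hb])))
lemma continuous (hf : IsPolyF f) : Continuous f := by
  obtain ⟨p, hp⟩ := hf
  rw [show f = fun x => MvPolynomial.eval x p from funext hp]
  exact MvPolynomial.continuous_eval p
end IsPolyF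

lemma ml_isPolyF {ι : Type*} [Fintype ι] (c : Finset ι → ℝ) : IsPolyF (ml c) := by
  unfold ml
  apply IsPolyF.sum
  intro S _
  exact (IsPolyF.const _).mul (IsPolyF.prod _ _ (fun i _ => IsPolyF.coord i))

lemma ml_continuous {ι : Type*} [Fintype ι] (c : Finset ι → ℝ) : Continuous (ml c) :=
  (ml_isPolyF c).continuous

open MeasureTheory

/-- Symmetric normalized measure with all moments and fourth moment at most `3`. -/
structure Good (ν : Measure ℝ) : Prop where
  mom : ∀ k : ℕ, Integrable (fun x : ℝ => x ^ k) ν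
  symm : ∀ f : ℝ → ℝ, ∫ x, f (-x) ∂ν = ∫ x, f x ∂ν
  two : ∫ x, x ^ 2 ∂ν = 1
  four : ∫ x, x ^ 4 ∂ν ≤ 3

lemma Good.integral_neg {ν : Measure ℝ} (h : Good ν) (f : ℝ → ℝ) :
    ∫ x, f (-x) ∂ν = ∫ x, f x ∂ν := h.symm f

lemma Good.one {ν : Measure ℝ} (h : Good ν) : ∫ x, x ∂ν = 0 := by
  have := h.integral_neg (fun x => x)
  rw [MeasureTheory.integral_neg] at this
  linarith

lemma Good.three {ν : Measure ℝ} (h : Good ν) : ∫ x, x ^ 3 ∂ν = 0 := by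
  have := h.integral_neg (fun x => x ^ 3)
  have h2 : ∀ x : ℝ, (-x) ^ 3 = -(x ^ 3) := by intro x; ring
  simp only [h2] at this
  rw [MeasureTheory.integral_neg] at this
  linarith

lemma poly_integrable {ι : Type*} [Fintype ι] (ν : ι → Measure ℝ) [∀ i, IsProbabilityMeasure (ν i)]
    (hν : ∀ i, Good (ν i)) {f : (ι → ℝ) → ℝ} (hf : IsPolyF f) : Integrable f (Measure.pi ν) := by
  obtain ⟨p, hp⟩ := hf
  rw [show f = fun x => MvPolynomial.eval x p from funext hp]
  simp only [MvPolynomial.eval_eq']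
  apply integrable_finsetSum
  intro m _
  apply Integrable.const_mul
  exact Integrable.fintype_prod (f := fun i (s : ℝ) => s ^ (m i)) (fun i => (hν i).mom (m i))

lemma resample {ι : Type*} [Fintype ι] (ν ν' : ι → Measure ℝ) [∀ i, IsProbabilityMeasure (ν i)]
    [∀ i, IsProbabilityMeasure (ν' i)] (i : ι) (h : ∀ j, j ≠ i → ν' j = ν j) :
    MeasurePreserving (fun z : (ι → ℝ) × ℝ => Function.update z.1 i z.2)
      ((Measure.pi ν).prod (ν' i)) (Measure.pi ν') := by
  have hm : Measurable (fun z : (ι → ℝ) × ℝ => Function.update z.1 i z.2) := by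
    rw [measurable_pi_iff]
    intro j
    by_cases hj : j = i
    · subst hj; simp; exact measurable_snd
    · simp [Function.update_of_ne hj]; exact (measurable_pi_apply j).comp measurable_fst
  refine ⟨hm, ?_⟩
  symm
  apply Measure.pi_eq
  intro s hs
  rw [Measure.map_apply hm (MeasurableSet.univ_pi hs)]
  have hpre : (fun z : (ι → ℝ) × ℝ => Function.update z.1 i z.2) ⁻¹' (Set.univ.pi s) =
      (Set.univ.pi (Function.update s i Set.univ)) ×ˢ (s i) := by
    ext ⟨x, t⟩
    simp only [Set.mem_preimage, Set.mem_pi, Set.mem_univ, true_implies, Set.mem_prod]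
    constructor
    · intro hx
      refine ⟨fun j => ?_, by simpa using hx i⟩
      by_cases hj : j = i
      · subst hj; simp
      · have := hx j; simpa [Function.update_of_ne hj] using this
    · rintro ⟨h1, h2⟩ j
      by_cases hj : j = i
      · subst hj; simpa using h2
      · have := h1 j; simpa [Function.update_of_ne hj] using this
  rw [hpre, Measure.prod_prod, Measure.pi_pi, ← Finset.mul_prod_erase _ _ (Finset.mem_univ i),
    ← Finset.mul_prod_erase univ (fun j => ν' j (s j)) (Finset.mem_univ i)]
  simp only [Function.update_self, measure_univ, one_mul]
  rw [mul_comm]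
  congr 1
  apply Finset.prod_congr rfl
  intro j hj
  have hj' := Finset.ne_of_mem_erase hj
  rw [Function.update_of_ne hj', h j hj']

lemma resample_integral {ι : Type*} [Fintype ι] (ν ν' : ι → Measure ℝ) [∀ i, IsProbabilityMeasure (ν i)]
    [∀ i, IsProbabilityMeasure (ν' i)] (i : ι) (h : ∀ j, j ≠ i → ν' j = ν j) (F : (ι → ℝ) → ℝ)
    (hF : Integrable F (Measure.pi ν')) :
    ∫ x, F x ∂(Measure.pi ν') = ∫ x, ∫ s, F (Function.update x i s) ∂(ν' i) ∂(Measure.pi ν) := by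
  have hr := resample ν ν' i h
  rw [← hr.map_eq]
  rw [← hr.map_eq] at hF
  rw [integral_map hr.measurable.aemeasurable hF.aestronglyMeasurable]
  exact integral_prod _ (hF.comp_measurable hr.measurable)

lemma indep_integral {ι : Type*} [Fintype ι] (ν : ι → Measure ℝ) [∀ i, IsProbabilityMeasure (ν i)]
    (hν : ∀ i, Good (ν i)) (i : ι) (f : (ι → ℝ) → ℝ) (hf : IsPolyF f)
    (hfi : ∀ x s, f (Function.update x i s) = f x) (k : ℕ) :
    ∫ x, x i ^ k * f x ∂(Measure.pi ν) = (∫ s, s ^ k ∂(ν i)) * ∫ x, f x ∂(Measure.pi ν) := by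
  rw [resample_integral ν ν i (fun _ _ => rfl) (fun x => x i ^ k * f x)
    (poly_integrable ν hν (((IsPolyF.coord i).pow k).mul hf))]
  simp only [Function.update_self, hfi, integral_mul_const]
  rw [integral_const_mul]

lemma moments {ι : Type*} [Fintype ι] (ν : ι → Measure ℝ) [∀ i, IsProbabilityMeasure (ν i)]
    (hν : ∀ i, Good (ν i)) (A : Finset ι) : ∀ (d : ℕ) (c : Finset ι → ℝ), DegLe d c →
    (∀ S, ¬ S ⊆ A → c S = 0) →
    ∫ x, ml c x ^ 2 ∂(Measure.pi ν) = ∑ S, c S ^ 2 ∧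
    ∫ x, ml c x ^ 4 ∂(Measure.pi ν) ≤ 9 ^ d * (∑ S, c S ^ 2) ^ 2 := by
  induction A using Finset.induction_on with
  | empty =>
    intro d c hd hc
    have h1 : ∀ x, ml c x = c ∅ := by
      intro x
      unfold ml
      rw [Finset.sum_eq_single ∅]
      · simp
      · intro S _ hS; rw [hc S (by simpa using hS)]; simp
      · simp
    have h2 : ∑ S, c S ^ 2 = c ∅ ^ 2 := by
      rw [Finset.sum_eq_single ∅]
      · intro S _ hS; rw [hc S (by simpa using hS)]; simp
      · simp
    simp only [h1, h2, integral_const, probReal_univ, one_smul, true_and]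
    have : (1:ℝ) ≤ 9 ^ d := one_le_pow₀ (by norm_num)
    nlinarith [sq_nonneg (c ∅ ^ 2)]
  | insert i A hi ih =>
    intro d c hd hc
    have hrA : ∀ S, ¬ S ⊆ A → rc i c S = 0 := by
      intro S hS; unfold rc; split_ifs with h
      · rfl
      · apply hc; intro h2; exact hS ((Finset.subset_insert_iff_of_notMem h).mp h2)
    have hdA : ∀ S, ¬ S ⊆ A → dc i c S = 0 := by
      intro S hS; unfold dc; split_ifs with h
      · rfl
      · apply hc; intro h2
        apply hS
        exact (Finset.subset_insert_iff_of_notMem h).mp ((Finset.subset_insert i S).trans h2)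
    have hr2 := ih d (rc i c) (hd.rc i) hrA
    have hd2 := ih (d - 1) (dc i c) (hd.dc i) hdA
    set a := ml (rc i c) with ha
    set b := ml (dc i c) with hb
    have hap : IsPolyF a := ml_isPolyF _
    have hbp : IsPolyF b := ml_isPolyF _
    have hai : ∀ x s, a (Function.update x i s) = a x := by
      intro x s; apply ml_update_of_free; intro S hS; simp [rc, hS]
    have hbi : ∀ x s, b (Function.update x i s) = b x := by
      intro x s; apply ml_update_of_free; intro S hS; simp [dc, hS]
    have hsp : ∀ x, ml c x = a x + x i * b x := fun x => ml_split i c x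
    have hI : ∀ {f : (ι → ℝ) → ℝ}, IsPolyF f → Integrable f (Measure.pi ν) := fun h => poly_integrable ν hν h
    have hX := IsPolyF.coord (ι := ι) i
    have e2 : ∀ x, ml c x ^ 2 = a x ^ 2 + 2 * (x i ^ 1 * (a x * b x)) + x i ^ 2 * b x ^ 2 := by
      intro x; rw [hsp]; ring
    have e4 : ∀ x, ml c x ^ 4 = a x ^ 4 + 4 * (x i ^ 1 * (a x ^ 3 * b x)) + 6 * (x i ^ 2 * (a x ^ 2 * b x ^ 2))
        + 4 * (x i ^ 3 * (a x * b x ^ 3)) + x i ^ 4 * b x ^ 4 := by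
      intro x; rw [hsp]; ring
    have hone : ∫ s, s ^ 1 ∂(ν i) = 0 := by simpa using (hν i).one
    have i1 : ∫ x, x i ^ 1 * (a x * b x) ∂(Measure.pi ν) = 0 := by
      rw [indep_integral ν hν i (fun x => a x * b x) (hap.mul hbp) (by intro x s; simp only [hai, hbi]), hone, zero_mul]
    have i2 : ∫ x, x i ^ 2 * b x ^ 2 ∂(Measure.pi ν) = ∫ x, b x ^ 2 ∂(Measure.pi ν) := by
      rw [indep_integral ν hν i (fun x => b x ^ 2) (hbp.pow 2) (by intro x s; simp only [hbi]), (hν i).two, one_mul]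
    have i3 : ∫ x, x i ^ 1 * (a x ^ 3 * b x) ∂(Measure.pi ν) = 0 := by
      rw [indep_integral ν hν i (fun x => a x ^ 3 * b x) ((hap.pow 3).mul hbp) (by intro x s; simp only [hai, hbi]), hone, zero_mul]
    have i4 : ∫ x, x i ^ 2 * (a x ^ 2 * b x ^ 2) ∂(Measure.pi ν) = ∫ x, a x ^ 2 * b x ^ 2 ∂(Measure.pi ν) := by
      rw [indep_integral ν hν i (fun x => a x ^ 2 * b x ^ 2) ((hap.pow 2).mul (hbp.pow 2)) (by intro x s; simp only [hai, hbi]), (hν i).two, one_mul]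
    have i5 : ∫ x, x i ^ 3 * (a x * b x ^ 3) ∂(Measure.pi ν) = 0 := by
      rw [indep_integral ν hν i (fun x => a x * b x ^ 3) (hap.mul (hbp.pow 3)) (by intro x s; simp only [hai, hbi]), (hν i).three, zero_mul]
    have i6 : ∫ x, x i ^ 4 * b x ^ 4 ∂(Measure.pi ν) ≤ 3 * ∫ x, b x ^ 4 ∂(Measure.pi ν) := by
      rw [indep_integral ν hν i (fun x => b x ^ 4) (hbp.pow 4) (by intro x s; simp only [hbi])]
      have : 0 ≤ ∫ x, b x ^ 4 ∂(Measure.pi ν) := integral_nonneg (fun x => by positivity)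
      exact mul_le_mul_of_nonneg_right (hν i).four this
    set α := ∑ S, rc i c S ^ 2 with hα
    set β := ∑ S, dc i c S ^ 2 with hβ
    have hα0 : 0 ≤ α := Finset.sum_nonneg (fun _ _ => sq_nonneg _)
    have hβ0 : 0 ≤ β := Finset.sum_nonneg (fun _ _ => sq_nonneg _)
    rw [sum_sq_split i c, ← hα, ← hβ]
    constructor
    · simp only [e2]
      rw [integral_add, integral_add, integral_const_mul, i1, i2, hr2.1, hd2.1]
      · ring
      · exact hI (hap.pow 2)
      · exact hI ((IsPolyF.const 2).mul ((hX.pow 1).mul (hap.mul hbp)))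
      · exact hI ((hap.pow 2).add ((IsPolyF.const 2).mul ((hX.pow 1).mul (hap.mul hbp))))
      · exact hI ((hX.pow 2).mul (hbp.pow 2))
    · simp only [e4]
      have p1 := hap.pow 4
      have p2 := (IsPolyF.const 4).mul ((hX.pow 1).mul ((hap.pow 3).mul hbp))
      have p3 := (IsPolyF.const 6).mul ((hX.pow 2).mul ((hap.pow 2).mul (hbp.pow 2)))
      have p4 := (IsPolyF.const 4).mul ((hX.pow 3).mul (hap.mul (hbp.pow 3)))
      have p5 := (hX.pow 4).mul (hbp.pow 4)
      rw [integral_add (hI (((p1.add p2).add p3).add p4)) (hI p5), integral_add (hI ((p1.add p2).add p3)) (hI p4),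
        integral_add (hI (p1.add p2)) (hI p3), integral_add (hI p1) (hI p2),
        integral_const_mul, integral_const_mul, integral_const_mul, i3, i4, i5]
      by_cases hd0 : d = 0
      · have hb0 : ∀ S, dc i c S = 0 := by
          intro S; unfold dc; split_ifs with h
          · rfl
          · apply hd; rw [Finset.card_insert_of_notMem h]; omega
        have hb0' : ∀ x, b x = 0 := by intro x; rw [hb]; simp [ml, hb0]
        have hβ00 : β = 0 := by rw [hβ]; simp [hb0]
        simp only [hb0']
        rw [hβ00]
        simp
        simpa using hr2.2
      · obtain ⟨e, rfl⟩ : ∃ e, d = e + 1 := ⟨d - 1, by omega⟩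
        have hd4 := hd2.2
        simp only [Nat.add_sub_cancel] at hd4
        have hr4 := hr2.2
        have h9 : (0:ℝ) < 9 ^ e := by positivity
        have hCS : ∫ x, a x ^ 2 * b x ^ 2 ∂(Measure.pi ν) ≤ 3 * 9 ^ e * (α * β) := by
          -- pointwise weighted AM-GM
          have hst : ∀ s : ℝ, 0 < s → 2 * ∫ x, a x ^ 2 * b x ^ 2 ∂(Measure.pi ν) ≤
              s * (9 * 9 ^ e * α ^ 2) + s⁻¹ * (9 ^ e * β ^ 2) := by
            intro s hs
            calc 2 * ∫ x, a x ^ 2 * b x ^ 2 ∂(Measure.pi ν)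
                = ∫ x, 2 * (a x ^ 2 * b x ^ 2) ∂(Measure.pi ν) := by rw [integral_const_mul]
              _ ≤ ∫ x, (s * a x ^ 4 + s⁻¹ * b x ^ 4) ∂(Measure.pi ν) := by
                apply integral_mono
                · exact hI ((IsPolyF.const 2).mul ((hap.pow 2).mul (hbp.pow 2)))
                · exact hI (((IsPolyF.const s).mul (hap.pow 4)).add ((IsPolyF.const s⁻¹).mul (hbp.pow 4)))
                · intro x
                  have h1 : 0 ≤ s⁻¹ * (s * a x ^ 2 - b x ^ 2) ^ 2 := by positivity
                  have h2 : s⁻¹ * (s * a x ^ 2 - b x ^ 2) ^ 2 = s * a x ^ 4 + s⁻¹ * b x ^ 4 - 2 * (a x ^ 2 * b x ^ 2) := by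
                    field_simp; ring
                  simp only
                  linarith
              _ = s * ∫ x, a x ^ 4 ∂(Measure.pi ν) + s⁻¹ * ∫ x, b x ^ 4 ∂(Measure.pi ν) := by
                rw [integral_add (hI ((IsPolyF.const s).mul (hap.pow 4))) (hI ((IsPolyF.const s⁻¹).mul (hbp.pow 4))),
                  integral_const_mul, integral_const_mul]
              _ ≤ _ := by
                rw [pow_succ, mul_comm (9 ^ e : ℝ) 9] at hr4
                gcongr
          rcases eq_or_lt_of_le hα0 with h0 | h0
          · rw [← h0]
            have h1 := fun s hs => hst s hs
            rw [← h0] at h1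
            by_contra hcon
            push Not at hcon
            have hpos : 0 < ∫ x, a x ^ 2 * b x ^ 2 ∂(Measure.pi ν) := by simpa using hcon
            set I := ∫ x, a x ^ 2 * b x ^ 2 ∂(Measure.pi ν)
            have h2 := h1 ((9 ^ e * β ^ 2 + 1) / I) (by positivity)
            have h3 : ((9 ^ e * β ^ 2 + 1) / I)⁻¹ * (9 ^ e * β ^ 2) ≤ I := by
              rw [inv_div, div_mul_eq_mul_div, div_le_iff₀ (by positivity)]
              nlinarith
            nlinarith
          · rcases eq_or_lt_of_le hβ0 with h1 | h1
            · have hb0 : ∀ S, dc i c S = 0 := by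
                intro S
                have := (Finset.sum_eq_zero_iff_of_nonneg (fun S _ => sq_nonneg (dc i c S))).mp (hβ ▸ h1.symm) S (Finset.mem_univ S)
                exact pow_eq_zero_iff (two_ne_zero) |>.mp this
              have hb0' : ∀ x, b x = 0 := by intro x; rw [hb]; simp [ml, hb0]
              simp only [hb0']
              rw [← h1]; simp
            · have h2 := hst (β / (3 * α)) (by positivity)
              have h3 : β / (3 * α) * (9 * 9 ^ e * α ^ 2) + (β / (3 * α))⁻¹ * (9 ^ e * β ^ 2) = 6 * 9 ^ e * (α * β) := by
                field_simp; ring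
              linarith
        rw [pow_succ] at hr4 ⊢
        nlinarith [mul_nonneg hα0 hβ0, mul_nonneg h9.le (mul_nonneg hα0 hβ0), mul_nonneg h9.le (sq_nonneg β)]

lemma ml_second {ι : Type*} [Fintype ι] (ν : ι → Measure ℝ) [∀ i, IsProbabilityMeasure (ν i)]
    (hν : ∀ i, Good (ν i)) (c : Finset ι → ℝ) :
    ∫ x, ml c x ^ 2 ∂(Measure.pi ν) = ∑ S, c S ^ 2 := by
  refine (moments ν hν univ (Fintype.card ι) c ?_ ?_).1
  · intro S hS; have := Finset.card_le_univ S; omega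
  · intro S hS; exact absurd (Finset.subset_univ S) hS

lemma ml_fourth {ι : Type*} [Fintype ι] (ν : ι → Measure ℝ) [∀ i, IsProbabilityMeasure (ν i)]
    (hν : ∀ i, Good (ν i)) (d : ℕ) (c : Finset ι → ℝ) (hd : DegLe d c) :
    ∫ x, ml c x ^ 4 ∂(Measure.pi ν) ≤ 9 ^ d * (∑ S, c S ^ 2) ^ 2 := by
  refine (moments ν hν univ d c hd ?_).2
  intro S hS; exact absurd (Finset.subset_univ S) hS

end partB1

section partB2
open MeasureTheory

set_option maxHeartbeats 1600000 in
lemma lindeberg_alg (a b e α β γ s : ℝ) (ha : 1 ≤ a) (hb : 0 ≤ b) (he : e ^ 2 ≤ a * b)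
    (hα : |α| ≤ a) (hγ : |γ| ≤ b) (hβ : β ^ 2 ≤ 4 * (a * b))
    (hD1 : 1 ≤ a + 2 * e * s + b * s ^ 2) (hD2 : 1 ≤ a - 2 * e * s + b * s ^ 2) :
    |((α + β * s + γ * s ^ 2) / (a + 2 * e * s + b * s ^ 2) +
      (α - β * s + γ * s ^ 2) / (a - 2 * e * s + b * s ^ 2)) / 2 - α / a -
      ((α * b + γ * a - 2 * β * e) - α / a * (2 * a * b - 4 * e ^ 2)) / a ^ 2 * s ^ 2| ≤ 34 * b ^ 2 * s ^ 4 := by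
  set f0 := α / a with hf0
  set d1 := 2 * a * b - 4 * e ^ 2 with hd1
  set n1 := α * b + γ * a - 2 * β * e with hn1
  set f1 := (n1 - f0 * d1) / a ^ 2 with hf1
  have ha0 : 0 < a := by linarith
  have hab : 0 ≤ a * b := by positivity
  set DD := (a + 2 * e * s + b * s ^ 2) * (a - 2 * e * s + b * s ^ 2) with hDD
  have hDD1 : 1 ≤ DD := by rw [hDD]; nlinarith
  have hDDpos : 0 < DD := by linarith
  have hid : ((α + β * s + γ * s ^ 2) / (a + 2 * e * s + b * s ^ 2) +
      (α - β * s + γ * s ^ 2) / (a - 2 * e * s + b * s ^ 2)) / 2 - f0 - f1 * s ^ 2 =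
      s ^ 4 * ((γ * b - f0 * b ^ 2 - f1 * d1) - s ^ 2 * f1 * b ^ 2) / DD := by
    have hα' : α = f0 * a := by rw [hf0]; field_simp
    have hn1' : n1 - f0 * d1 = f1 * a ^ 2 := by rw [hf1]; field_simp
    rw [div_add_div _ _ (by linarith) (by linarith), ← hDD, div_div, mul_comm DD 2, eq_div_iff hDDpos.ne']
    have h1 : ((α + β * s + γ * s ^ 2) * (a - 2 * e * s + b * s ^ 2) +
      (a + 2 * e * s + b * s ^ 2) * (α - β * s + γ * s ^ 2)) = 2 * (α * a + n1 * s ^ 2 + γ * b * s ^ 4) := by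
      rw [hn1]; ring
    rw [h1, mul_div_mul_left _ _ (two_ne_zero), sub_mul, sub_mul, div_mul_cancel₀ _ hDDpos.ne']
    have h2 : DD = a ^ 2 + d1 * s ^ 2 + b ^ 2 * s ^ 4 := by rw [hDD, hd1]; ring
    rw [h2]
    have h3 : n1 = f1 * a ^ 2 + f0 * d1 := by linarith
    rw [h3]
    clear_value f0 f1 d1 n1
    subst hα'
    ring
  rw [hid, abs_div, abs_of_pos hDDpos, div_le_iff₀ hDDpos, abs_mul, abs_of_nonneg (by positivity : (0:ℝ) ≤ s ^ 4)]
  have b0 : |f0| ≤ 1 := by rw [hf0, abs_div, abs_of_pos ha0, div_le_one ha0]; exact hα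
  have bβe : |2 * β * e| ≤ 4 * (a * b) := by
    apply abs_le_of_sq_le_sq _ (by positivity)
    have : (2 * β * e) ^ 2 = 4 * (β ^ 2 * e ^ 2) := by ring
    rw [this]
    have : β ^ 2 * e ^ 2 ≤ (4 * (a * b)) * (a * b) := by gcongr
    nlinarith
  have bn1 : |n1| ≤ 6 * (a * b) := by
    have h1 : |α * b| ≤ a * b := by rw [abs_mul, abs_of_nonneg hb]; gcongr
    have h2 : |γ * a| ≤ a * b := by rw [abs_mul, abs_of_pos ha0, mul_comm]; gcongr
    rw [abs_le] at *
    constructor <;> linarith [h1.1, h1.2, h2.1, h2.2, bβe.1, bβe.2]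
  have bd1 : |d1| ≤ 2 * (a * b) := by rw [abs_le]; constructor <;> nlinarith [sq_nonneg e]
  have bf0d1 : |f0 * d1| ≤ 2 * (a * b) := by
    rw [abs_mul]
    calc |f0| * |d1| ≤ 1 * (2 * (a * b)) := by gcongr
      _ = _ := by ring
  have bf1 : a * |f1| ≤ 8 * b := by
    rw [hf1, abs_div, abs_of_pos (by positivity : 0 < a ^ 2), ← mul_div_assoc, div_le_iff₀ (by positivity)]
    have : |n1 - f0 * d1| ≤ 8 * (a * b) := (abs_sub _ _).trans (by linarith)
    calc a * |n1 - f0 * d1| ≤ a * (8 * (a * b)) := by gcongr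
      _ = _ := by ring
  have brb : s ^ 2 * b ≤ 2 * a * DD := by
    have hge : (b * s ^ 2 - a) ^ 2 ≤ DD := by
      rw [hDD]; nlinarith [mul_nonneg (sub_nonneg.mpr he) (sq_nonneg s)]
    rcases le_total (b * s ^ 2) (2 * a) with h | h
    · nlinarith
    · nlinarith [mul_nonneg (sub_nonneg.mpr h) (sub_nonneg.mpr ha)]
  have b3 : |f1 * d1| ≤ 16 * b ^ 2 := by
    rw [abs_mul]
    calc |f1| * |d1| ≤ |f1| * (2 * (a * b)) := by gcongr
      _ = 2 * b * (a * |f1|) := by ring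
      _ ≤ 2 * b * (8 * b) := by gcongr
      _ = _ := by ring
  have b4 : |s ^ 2 * f1 * b ^ 2| ≤ 16 * b ^ 2 * DD := by
    rw [abs_mul, abs_mul, abs_of_nonneg (sq_nonneg s), abs_of_nonneg (sq_nonneg b)]
    calc s ^ 2 * |f1| * b ^ 2 = (s ^ 2 * b) * (|f1| * b) := by ring
      _ ≤ (2 * a * DD) * (|f1| * b) := by gcongr
      _ = 2 * DD * b * (a * |f1|) := by ring
      _ ≤ 2 * DD * b * (8 * b) := by gcongr
      _ = _ := by ring
  have b1 : |γ * b| ≤ b ^ 2 := by rw [abs_mul, abs_of_nonneg hb, sq]; gcongr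
  have b2 : |f0 * b ^ 2| ≤ b ^ 2 := by
    rw [abs_mul, abs_of_nonneg (sq_nonneg b)]
    calc |f0| * b ^ 2 ≤ 1 * b ^ 2 := by gcongr
      _ = _ := by ring
  have hsum : |γ * b - f0 * b ^ 2 - f1 * d1 - s ^ 2 * f1 * b ^ 2| ≤ 34 * b ^ 2 * DD := by
    have h5 : b ^ 2 ≤ b ^ 2 * DD := by nlinarith [sq_nonneg b]
    have h6 : |γ * b - f0 * b ^ 2 - f1 * d1 - s ^ 2 * f1 * b ^ 2| ≤ |γ * b| + |f0 * b ^ 2| + |f1 * d1| + |s ^ 2 * f1 * b ^ 2| := by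
      refine (abs_sub _ _).trans ?_
      gcongr
      refine (abs_sub _ _).trans ?_
      gcongr
      exact abs_sub _ _
    linarith
  calc s ^ 4 * _ ≤ s ^ 4 * (34 * b ^ 2 * DD) := by gcongr
    _ = _ := by ring

lemma lindeberg_one (ν : Measure ℝ) [IsProbabilityMeasure ν] (hν : Good ν) (a b e α β γ : ℝ) (ha : 1 ≤ a) (hb : 0 ≤ b) (he : e ^ 2 ≤ a * b)
    (hα : |α| ≤ a) (hγ : |γ| ≤ b) (hβ : β ^ 2 ≤ 4 * (a * b))
    (hD : ∀ s, 1 ≤ a + 2 * e * s + b * s ^ 2)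
    (hN : ∀ s, |(α + β * s + γ * s ^ 2) / (a + 2 * e * s + b * s ^ 2)| ≤ 1) :
    |∫ s, (α + β * s + γ * s ^ 2) / (a + 2 * e * s + b * s ^ 2) ∂ν - (α / a +
      ((α * b + γ * a - 2 * β * e) - α / a * (2 * a * b - 4 * e ^ 2)) / a ^ 2)| ≤ 102 * b ^ 2 := by
  set f1 := ((α * b + γ * a - 2 * β * e) - α / a * (2 * a * b - 4 * e ^ 2)) / a ^ 2 with hf1
  set g : ℝ → ℝ := fun s => (α + β * s + γ * s ^ 2) / (a + 2 * e * s + b * s ^ 2) with hg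
  have hgc : Continuous g := by
    apply Continuous.div (by fun_prop) (by fun_prop)
    intro s; linarith [hD s]
  have hgi : Integrable g ν := by
    apply Integrable.of_bound hgc.aestronglyMeasurable 1
    filter_upwards with s using hN s
  have hgi' : Integrable (fun s => g (-s)) ν := by
    apply Integrable.of_bound (hgc.comp continuous_neg).aestronglyMeasurable 1
    filter_upwards with s using hN (-s)
  have h2 := hν.mom 2
  have h4 := hν.mom 4
  have heq : ∫ s, g s ∂ν - (α / a + f1) = ∫ s, ((g s + g (-s)) / 2 - α / a - f1 * s ^ 2) ∂ν := by
    rw [integral_sub, integral_sub, integral_div, integral_add hgi hgi', hν.integral_neg g,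
      integral_const_mul, hν.two]
    · simp; ring
    · exact (hgi.add hgi').div_const _
    · exact integrable_const _
    · exact ((hgi.add hgi').div_const _).sub (integrable_const _)
    · exact h2.const_mul _
  rw [heq]
  refine (abs_integral_le_integral_abs).trans ?_
  calc ∫ s, |(g s + g (-s)) / 2 - α / a - f1 * s ^ 2| ∂ν ≤ ∫ s, 34 * b ^ 2 * s ^ 4 ∂ν := by
        apply integral_mono
        · exact ((((hgi.add hgi').div_const _).sub (integrable_const _)).sub (h2.const_mul _)).abs
        · exact h4.const_mul _
        · intro s
          have hneg : g (-s) = (α - β * s + γ * s ^ 2) / (a - 2 * e * s + b * s ^ 2) := by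
            rw [hg]; simp only; congr 1 <;> ring
          have hDs := hD (-s)
          simp only [hneg]
          apply lindeberg_alg a b e α β γ s ha hb he hα hγ hβ (hD s)
          linarith
    _ = 34 * b ^ 2 * ∫ s, s ^ 4 ∂ν := by rw [integral_const_mul]
    _ ≤ 34 * b ^ 2 * 3 := by gcongr; exact hν.four
    _ = _ := by ring

/-- The two smooth test functions, `k = 0`: `1/(1+u²+w²)`, `k = 1`: `w²/(1+u²+w²)`. -/
noncomputable def tf (k : Bool) (u w : ℝ) : ℝ := (if k then w ^ 2 else 1) / (1 + u ^ 2 + w ^ 2)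

lemma tf_nonneg (k : Bool) (u w : ℝ) : 0 ≤ tf k u w := by unfold tf; split_ifs <;> positivity

lemma tf_le_one (k : Bool) (u w : ℝ) : tf k u w ≤ 1 := by
  unfold tf; rw [div_le_one (by positivity)]; split_ifs <;> nlinarith [sq_nonneg u, sq_nonneg w]

lemma tf_cont (k : Bool) : Continuous (fun z : ℝ × ℝ => tf k z.1 z.2) := by
  unfold tf
  apply Continuous.div
  · split_ifs <;> fun_prop
  · fun_prop
  · intro z; positivity

lemma lindeberg_step (ν₁ ν₂ : Measure ℝ) [IsProbabilityMeasure ν₁] [IsProbabilityMeasure ν₂] (h1 : Good ν₁) (h2 : Good ν₂)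
    (k : Bool) (u0 u1 w0 w1 : ℝ) :
    |∫ s, tf k (u0 + s * u1) (w0 + s * w1) ∂ν₁ - ∫ s, tf k (u0 + s * u1) (w0 + s * w1) ∂ν₂| ≤
      408 * (u1 ^ 4 + w1 ^ 4) := by
  set a := 1 + u0 ^ 2 + w0 ^ 2 with ha
  set b := u1 ^ 2 + w1 ^ 2 with hb
  set e := u0 * u1 + w0 * w1 with he
  set α := if k then w0 ^ 2 else 1 with hα
  set β := if k then 2 * w0 * w1 else 0 with hβ
  set γ := if k then w1 ^ 2 else 0 with hγ
  have hDen : ∀ s, 1 + (u0 + s * u1) ^ 2 + (w0 + s * w1) ^ 2 = a + 2 * e * s + b * s ^ 2 := by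
    intro s; rw [ha, hb, he]; ring
  have htf : ∀ s, tf k (u0 + s * u1) (w0 + s * w1) = (α + β * s + γ * s ^ 2) / (a + 2 * e * s + b * s ^ 2) := by
    intro s
    unfold tf
    rw [hDen]
    congr 1
    rw [hα, hβ, hγ]
    split_ifs <;> ring
  have hD : ∀ s, 1 ≤ a + 2 * e * s + b * s ^ 2 := by
    intro s; rw [← hDen]; nlinarith [sq_nonneg (u0 + s * u1), sq_nonneg (w0 + s * w1)]
  have hN : ∀ s, |(α + β * s + γ * s ^ 2) / (a + 2 * e * s + b * s ^ 2)| ≤ 1 := by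
    intro s; rw [← htf, abs_of_nonneg (tf_nonneg _ _ _)]; exact tf_le_one _ _ _
  have ha1 : 1 ≤ a := by rw [ha]; nlinarith [sq_nonneg u0, sq_nonneg w0]
  have hb0 : 0 ≤ b := by positivity
  have he2 : e ^ 2 ≤ a * b := by
    rw [ha, hb, he]; nlinarith [sq_nonneg (u0 * w1 - w0 * u1), sq_nonneg u1, sq_nonneg w1]
  have hα' : |α| ≤ a := by
    rw [hα, ha, abs_of_nonneg (by split_ifs <;> positivity)]
    split_ifs <;> nlinarith [sq_nonneg u0, sq_nonneg w0]
  have hγ' : |γ| ≤ b := by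
    rw [hγ, hb, abs_of_nonneg (by split_ifs <;> positivity)]
    split_ifs <;> nlinarith [sq_nonneg u1, sq_nonneg w1]
  have hβ' : β ^ 2 ≤ 4 * (a * b) := by
    rw [hβ]
    split_ifs
    · rw [ha, hb]
      have : (2 * w0 * w1) ^ 2 = 4 * (w0 ^ 2 * w1 ^ 2) := by ring
      rw [this]
      gcongr <;> nlinarith [sq_nonneg u0, sq_nonneg w0, sq_nonneg u1]
    · simp; positivity
  have e1 := lindeberg_one ν₁ h1 a b e α β γ ha1 hb0 he2 hα' hγ' hβ' hD hN
  have e2 := lindeberg_one ν₂ h2 a b e α β γ ha1 hb0 he2 hα' hγ' hβ' hD hN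
  simp only [htf]
  have hbb : b ^ 2 ≤ 2 * (u1 ^ 4 + w1 ^ 4) := by rw [hb]; nlinarith [sq_nonneg (u1 ^ 2 - w1 ^ 2)]
  rw [abs_le] at *
  constructor <;> linarith [e1.1, e1.2, e2.1, e2.2]

/-- Hybrid product measure. -/
noncomputable def hyb {ι : Type*} (ν₁ ν₂ : Measure ℝ) (A : Finset ι) : ι → Measure ℝ :=
  fun i => if i ∈ A then ν₂ else ν₁

instance hyb_prob {ι : Type*} (ν₁ ν₂ : Measure ℝ) [IsProbabilityMeasure ν₁] [IsProbabilityMeasure ν₂]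
    (A : Finset ι) (i : ι) : IsProbabilityMeasure (hyb ν₁ ν₂ A i) := by
  unfold hyb; split_ifs <;> infer_instance

lemma tf_ml_integrable {ι : Type*} [Fintype ι] (μ : Measure (ι → ℝ)) [IsProbabilityMeasure μ]
    (k : Bool) (U W : (ι → ℝ) → ℝ) (hU : Continuous U) (hW : Continuous W) :
    Integrable (fun x => tf k (U x) (W x)) μ := by
  apply Integrable.of_bound ((tf_cont k).comp (hU.prodMk hW)).aestronglyMeasurable 1
  filter_upwards with x
  simp only [Function.comp]
  rw [Real.norm_of_nonneg (tf_nonneg _ _ _)]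
  exact tf_le_one _ _ _

lemma lindeberg {ι : Type*} [Fintype ι] (ν₁ ν₂ : Measure ℝ) [IsProbabilityMeasure ν₁] [IsProbabilityMeasure ν₂]
    (h1 : Good ν₁) (h2 : Good ν₂) (k : Bool) (d : ℕ) (cu cw : Finset ι → ℝ) (hu : DegLe d cu) (hw : DegLe d cw)
    (A : Finset ι) :
    |∫ x, tf k (ml cu x) (ml cw x) ∂(Measure.pi (fun _ : ι => ν₁)) -
      ∫ x, tf k (ml cu x) (ml cw x) ∂(Measure.pi (hyb ν₁ ν₂ A))| ≤
      ∑ i ∈ A, 408 * 9 ^ d * ((∑ S, dc i cu S ^ 2) ^ 2 + (∑ S, dc i cw S ^ 2) ^ 2) := by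
  induction A using Finset.induction_on with
  | empty =>
    have h0 : hyb ν₁ ν₂ (∅ : Finset ι) = fun _ => ν₁ := by funext i; simp [hyb]
    simp [h0]
  | insert i A hi ih =>
    rw [Finset.sum_insert hi]
    have hg : ∀ j, Good (hyb ν₁ ν₂ A j) := by
      intro j; unfold hyb; split_ifs <;> assumption
    set F := fun x : ι → ℝ => tf k (ml cu x) (ml cw x) with hF
    have hIntg : ∀ μ : Measure (ι → ℝ), IsProbabilityMeasure μ → Integrable F μ := fun μ _ =>
      tf_ml_integrable μ k _ _ (ml_continuous cu) (ml_continuous cw)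
    have r1 := resample_integral (hyb ν₁ ν₂ A) (hyb ν₁ ν₂ A) i (fun _ _ => rfl) F (hIntg _ inferInstance)
    have r2 := resample_integral (hyb ν₁ ν₂ A) (hyb ν₁ ν₂ (insert i A)) i (by
      intro j hj; simp [hyb, hj]) F (hIntg _ inferInstance)
    have m1 : hyb ν₁ ν₂ A i = ν₁ := by simp [hyb, hi]
    have m2 : hyb ν₁ ν₂ (insert i A) i = ν₂ := by simp [hyb]
    have hcu := ml_isPolyF (dc i cu)
    have hcw := ml_isPolyF (dc i cw)
    have hmeas : ∀ ν : Measure ℝ, IsProbabilityMeasure ν → Integrable (fun x => ∫ s, F (Function.update x i s) ∂ν)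
        (Measure.pi (hyb ν₁ ν₂ A)) := by
      intro ν _
      have hc : Continuous (fun z : (ι → ℝ) × ℝ => F (Function.update z.1 i z.2)) := by
        have : Continuous F := (tf_cont k).comp ((ml_continuous cu).prodMk (ml_continuous cw))
        apply this.comp
        exact continuous_fst.update i continuous_snd
      have hI : Integrable (fun z : (ι → ℝ) × ℝ => F (Function.update z.1 i z.2)) ((Measure.pi (hyb ν₁ ν₂ A)).prod ν) := by
        apply Integrable.of_bound hc.aestronglyMeasurable 1
        filter_upwards with z
        rw [Real.norm_of_nonneg (tf_nonneg _ _ _)]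
        exact tf_le_one _ _ _
      exact hI.integral_prod_left
    have hstep : |∫ x, F x ∂(Measure.pi (hyb ν₁ ν₂ A)) - ∫ x, F x ∂(Measure.pi (hyb ν₁ ν₂ (insert i A)))| ≤
        408 * 9 ^ d * ((∑ S, dc i cu S ^ 2) ^ 2 + (∑ S, dc i cw S ^ 2) ^ 2) := by
      rw [r1, r2, ← integral_sub]
      · refine abs_integral_le_integral_abs.trans ?_
        have hpI : Integrable (fun x => 408 * (ml (dc i cu) x ^ 4 + ml (dc i cw) x ^ 4)) (Measure.pi (hyb ν₁ ν₂ A)) :=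
          poly_integrable _ hg ((IsPolyF.const 408).mul ((hcu.pow 4).add (hcw.pow 4)))
        calc _ ≤ ∫ x, 408 * (ml (dc i cu) x ^ 4 + ml (dc i cw) x ^ 4) ∂(Measure.pi (hyb ν₁ ν₂ A)) := by
              apply integral_mono _ hpI
              · intro x
                simp only [hF, ml_update]
                apply lindeberg_step
                · rw [m1]; exact h1
                · rw [m2]; exact h2
              · exact ((hmeas _ inferInstance).sub (hmeas _ inferInstance)).abs
          _ = 408 * (∫ x, ml (dc i cu) x ^ 4 ∂(Measure.pi (hyb ν₁ ν₂ A)) + ∫ x, ml (dc i cw) x ^ 4 ∂(Measure.pi (hyb ν₁ ν₂ A))) := by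
              rw [integral_const_mul, integral_add (poly_integrable _ hg (hcu.pow 4)) (poly_integrable _ hg (hcw.pow 4))]
          _ ≤ 408 * (9 ^ d * (∑ S, dc i cu S ^ 2) ^ 2 + 9 ^ d * (∑ S, dc i cw S ^ 2) ^ 2) := by
              gcongr
              · exact ml_fourth _ hg d _ ((hu.dc i).mono (by omega))
              · exact ml_fourth _ hg d _ ((hw.dc i).mono (by omega))
          _ = _ := by ring
      · exact hmeas _ inferInstance
      · exact hmeas _ inferInstance
    have := abs_sub_le (∫ x, F x ∂(Measure.pi (fun _ : ι => ν₁))) (∫ x, F x ∂(Measure.pi (hyb ν₁ ν₂ A))) (∫ x, F x ∂(Measure.pi (hyb ν₁ ν₂ (insert i A))))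
    linarith

lemma lindeberg_full {ι : Type*} [Fintype ι] (ν₁ ν₂ : Measure ℝ) [IsProbabilityMeasure ν₁] [IsProbabilityMeasure ν₂]
    (h1 : Good ν₁) (h2 : Good ν₂) (k : Bool) (d : ℕ) (cu cw : Finset ι → ℝ) (hu : DegLe d cu) (hw : DegLe d cw) :
    |∫ x, tf k (ml cu x) (ml cw x) ∂(Measure.pi (fun _ : ι => ν₁)) -
      ∫ x, tf k (ml cu x) (ml cw x) ∂(Measure.pi (fun _ : ι => ν₂))| ≤
      408 * 9 ^ d * ∑ i, ((∑ S, dc i cu S ^ 2) ^ 2 + (∑ S, dc i cw S ^ 2) ^ 2) := by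
  have := lindeberg ν₁ ν₂ h1 h2 k d cu cw hu hw univ
  rw [← Finset.mul_sum] at this
  have h0 : hyb ν₁ ν₂ (univ : Finset ι) = fun _ => ν₂ := by funext i; simp [hyb]
  simp only [h0] at this
  exact this

end partB2

section partB3
open MeasureTheory ProbabilityTheory

/-- Uniform measure on `Bool`. -/
noncomputable def ub : Measure Bool := (2⁻¹ : ENNReal) • Measure.count

lemma ub_singleton (b : Bool) : ub {b} = 2⁻¹ := by simp [ub]

instance ub_prob : IsProbabilityMeasure ub := ⟨by
  simp only [ub, Measure.smul_apply, smul_eq_mul, Measure.count_univ]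
  simp
  exact ENNReal.inv_mul_cancel (a := 2) two_ne_zero ENNReal.ofNat_ne_top⟩

/-- The Rademacher measure. -/
noncomputable def rad : Measure ℝ := ub.map chi

lemma chi_measurable : Measurable chi := measurable_of_finite _

instance rad_prob : IsProbabilityMeasure rad := Measure.isProbabilityMeasure_map chi_measurable.aemeasurable

lemma integral_rad_pi {ι : Type*} [Fintype ι] (F : (ι → ℝ) → ℝ) (hF : Measurable F) :
    ∫ x, F x ∂(Measure.pi (fun _ : ι => rad)) = (∑ x : ι → Bool, F (fun i => chi (x i))) / 2 ^ (Fintype.card ι) := by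
  have h1 : Measure.pi (fun _ : ι => rad) = (Measure.pi (fun _ : ι => ub)).map (fun x i => chi (x i)) := by
    rw [Measure.pi_map_pi (fun _ => chi_measurable.aemeasurable)]
    rfl
  rw [h1, integral_map (measurable_of_finite _).aemeasurable hF.aestronglyMeasurable, integral_fintype (Integrable.of_finite)]
  rw [Finset.sum_div]
  apply Finset.sum_congr rfl
  intro x _
  rw [measureReal_def, Measure.pi_singleton]
  simp [ub_singleton, div_eq_inv_mul]

lemma integral_rad (f : ℝ → ℝ) : ∫ x, f x ∂rad = (f 1 + f (-1)) / 2 := by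
  have hE : MeasurableEmbedding chi := by
    refine ⟨?_, chi_measurable, fun {s} _ => ?_⟩
    · intro a b h; cases a <;> cases b <;> simp [chi] at h ⊢ <;> norm_num at h
    · exact (Set.toFinite _).measurableSet
  rw [rad, hE.integral_map, integral_fintype (Integrable.of_finite)]
  simp [measureReal_def, ub_singleton, chi]
  ring

lemma rad_integrable (f : ℝ → ℝ) (hf : Measurable f) : Integrable f rad := by
  rw [rad, integrable_map_measure hf.aestronglyMeasurable chi_measurable.aemeasurable]
  exact Integrable.of_finite

lemma good_rad : Good rad where
  mom k := rad_integrable _ (by fun_prop)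
  symm f := by rw [integral_rad, integral_rad, neg_neg, add_comm]
  two := by rw [integral_rad]; norm_num
  four := by rw [integral_rad]; norm_num

/-- The standard Gaussian. -/
noncomputable abbrev gam : Measure ℝ := gaussianReal 0 1

lemma gam_mom (k : ℕ) : Integrable (fun x : ℝ => x ^ k) gam := by
  have h := (memLp_id_gaussianReal (μ := 0) (v := 1) (k : NNReal))
  have := h.integrable_norm_pow'
  refine (integrable_norm_iff (by fun_prop)).mp ?_
  simpa [norm_pow] using this

lemma gam_two : ∫ x, x ^ 2 ∂gam = 1 := by
  have h := variance_fun_id_gaussianReal (μ := 0) (v := 1)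
  rw [variance_eq_integral (by fun_prop)] at h
  simpa using h

lemma gam_rot (θ : ℝ) : MeasurePreserving (fun z : ℝ × ℝ => (Real.cos θ * z.1 + Real.sin θ * z.2, -Real.sin θ * z.1 + Real.cos θ * z.2))
    (gam.prod gam) (gam.prod gam) := by
  refine ⟨by fun_prop, ?_⟩
  have := IsGaussian.map_rotation_eq_self (μ := gam) (by simp) θ
  convert this using 2
  funext z
  simp [ContinuousLinearMap.rotation_apply]

lemma good_gam : Good gam where
  mom := gam_mom
  symm f := by
    have h : gam.map (fun x => -x) = gam := by rw [gaussianReal_map_neg]; simp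
    conv_rhs => rw [← h]
    exact (MeasureTheory.integral_map_equiv (MeasurableEquiv.neg ℝ) f).symm
  two := gam_two
  four := by
    set c := Real.cos (Real.pi / 4) with hc
    have hcc : c = √2 / 2 := Real.cos_pi_div_four
    have hss : Real.sin (Real.pi / 4) = c := by rw [hcc, Real.sin_pi_div_four]
    have hc2 : c ^ 2 = 1 / 2 := by rw [hcc, div_pow, Real.sq_sqrt (by norm_num)]; norm_num
    have hrot := gam_rot (Real.pi / 4)
    have i1 : ∀ k l : ℕ, ∫ z : ℝ × ℝ, z.1 ^ k * z.2 ^ l ∂(gam.prod gam) = (∫ x, x ^ k ∂gam) * ∫ x, x ^ l ∂gam := by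
      intro k l; exact integral_prod_mul (fun x : ℝ => x ^ k) (fun x : ℝ => x ^ l)
    have ii : ∀ k l : ℕ, Integrable (fun z : ℝ × ℝ => z.1 ^ k * z.2 ^ l) (gam.prod gam) := by
      intro k l; exact (gam_mom k).mul_prod (gam_mom l)
    have e1 : ∫ z : ℝ × ℝ, z.1 ^ 4 ∂(gam.prod gam) = ∫ x, x ^ 4 ∂gam := by
      have := i1 4 0
      simpa using this
    have e2 : ∫ z : ℝ × ℝ, (c * z.1 + c * z.2) ^ 4 ∂(gam.prod gam) = ∫ z : ℝ × ℝ, z.1 ^ 4 ∂(gam.prod gam) := by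
      conv_rhs => rw [← hrot.map_eq]
      rw [integral_map hrot.measurable.aemeasurable (by fun_prop)]
      simp only [hss, ← hc]
    have e3 : ∀ z : ℝ × ℝ, (c * z.1 + c * z.2) ^ 4 = (1 / 4) * (z.1 ^ 4 * z.2 ^ 0) + ((z.1 ^ 3 * z.2 ^ 1) +
      ((3 / 2) * (z.1 ^ 2 * z.2 ^ 2) + ((z.1 ^ 1 * z.2 ^ 3) + (1 / 4) * (z.1 ^ 0 * z.2 ^ 4)))) := by
      intro z
      have : (c * z.1 + c * z.2) ^ 4 = (c ^ 2) ^ 2 * (z.1 + z.2) ^ 4 := by ring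
      rw [this, hc2]; ring
    simp only [e3] at e2
    have j4 : Integrable (fun z : ℝ × ℝ => (z.1 ^ 1 * z.2 ^ 3) + (1 / 4) * (z.1 ^ 0 * z.2 ^ 4)) (gam.prod gam) :=
      (ii 1 3).add ((ii 0 4).const_mul _)
    have j3 : Integrable (fun z : ℝ × ℝ => (3 / 2) * (z.1 ^ 2 * z.2 ^ 2) + ((z.1 ^ 1 * z.2 ^ 3) + (1 / 4) * (z.1 ^ 0 * z.2 ^ 4)))
      (gam.prod gam) := ((ii 2 2).const_mul _).add j4
    have j2 : Integrable (fun z : ℝ × ℝ => (z.1 ^ 3 * z.2 ^ 1) + ((3 / 2) * (z.1 ^ 2 * z.2 ^ 2) + ((z.1 ^ 1 * z.2 ^ 3) +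
      (1 / 4) * (z.1 ^ 0 * z.2 ^ 4)))) (gam.prod gam) := (ii 3 1).add j3
    rw [integral_add ((ii 4 0).const_mul _) j2, integral_add (ii 3 1) j3, integral_add ((ii 2 2).const_mul _) j4,
      integral_add (ii 1 3) ((ii 0 4).const_mul _), integral_const_mul, integral_const_mul, integral_const_mul,
      i1, i1, i1, i1, i1, e1, gam_two] at e2
    have h1 : ∫ x, x ^ 1 ∂gam = 0 := by simp
    rw [h1] at e2
    simp at e2
    have : ∫ x, x ^ 4 ∂gam = ∫ x, x ^ 4 ∂(gaussianReal 0 1) := rfl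
    linarith

instance gamn_gaussian (n : ℕ) : IsGaussian (Measure.pi (fun _ : Fin n => gam)) := by
  have h1 : iIndepFun (fun (i : Fin n) (ω : Fin n → ℝ) => ω i) (Measure.pi (fun _ : Fin n => gam)) :=
    iIndepFun_pi (X := fun _ (x : ℝ) => x) (fun i => by fun_prop)
  have h2 : ∀ i : Fin n, HasGaussianLaw (fun ω : Fin n → ℝ => ω i) (Measure.pi (fun _ : Fin n => gam)) := by
    intro i
    constructor
    have := (measurePreserving_eval (fun _ : Fin n => gam) i).map_eq
    have h3 : (Measure.pi (fun _ : Fin n => gam)).map (fun ω => ω i) = gam := this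
    rw [h3]
    infer_instance
  have h3 := (iIndepFun.hasGaussianLaw h2 h1).isGaussian_map
  simpa using h3

lemma gamn_mean (n : ℕ) : ∫ x, x ∂(Measure.pi (fun _ : Fin n => gam)) = 0 := by
  ext i
  have hI : Integrable (fun x : Fin n → ℝ => x) (Measure.pi (fun _ : Fin n => gam)) := IsGaussian.integrable_id
  rw [eval_integral (fun j => hI.eval j)]
  have := indep_integral (fun _ : Fin n => gam) (fun _ => good_gam) i (fun _ => 1) (IsPolyF.const 1) (by simp) 1
  simpa using this

lemma gamn_rot (n : ℕ) (θ : ℝ) : MeasurePreserving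
    (fun z : (Fin n → ℝ) × (Fin n → ℝ) => (Real.cos θ • z.1 + Real.sin θ • z.2, -Real.sin θ • z.1 + Real.cos θ • z.2))
    ((Measure.pi (fun _ : Fin n => gam)).prod (Measure.pi (fun _ : Fin n => gam)))
    ((Measure.pi (fun _ : Fin n => gam)).prod (Measure.pi (fun _ : Fin n => gam))) := by
  refine ⟨by fun_prop, ?_⟩
  have := IsGaussian.map_rotation_eq_self (μ := Measure.pi (fun _ : Fin n => gam)) (by simpa using gamn_mean n) θ
  convert this using 2
  funext z
  simp [ContinuousLinearMap.rotation_apply]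

lemma gamn_linear (n : ℕ) (a : Fin n → ℝ) :
    (Measure.pi (fun _ : Fin n => gam)).map (fun y => ∑ j, a j * y j) =
      gaussianReal 0 (∑ j, a j ^ 2).toNNReal := by
  set L : StrongDual ℝ (Fin n → ℝ) := ∑ j, a j • ContinuousLinearMap.proj j with hL
  have hLf : (fun y : Fin n → ℝ => ∑ j, a j * y j) = L := by
    funext y; simp [hL]
  rw [hLf, IsGaussian.map_eq_gaussianReal L]
  have hI : Integrable id (Measure.pi (fun _ : Fin n => gam)) := IsGaussian.integrable_id
  have h0 : ∫ x, L x ∂(Measure.pi (fun _ : Fin n => gam)) = 0 := by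
    have := L.integral_comp_comm hI
    simp only [id] at this
    rw [this, gamn_mean, map_zero]
  rw [h0]
  congr 2
  rw [variance_of_integral_eq_zero (by fun_prop) h0]
  set c : Finset (Fin n) → ℝ := fun S => ∑ j, if S = {j} then a j else 0 with hc
  have hml : ∀ y, L y = ml c y := by
    intro y
    rw [← hLf]
    unfold ml
    simp only [hc, Finset.sum_mul]
    rw [Finset.sum_comm]
    apply Finset.sum_congr rfl
    intro j _
    rw [Finset.sum_eq_single {j}]
    · simp
    · intro S _ hS; simp [hS]
    · simp
  simp only [hml]
  rw [ml_second _ (fun _ => good_gam)]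
  have : ∀ S, c S ^ 2 = ∑ j, if S = {j} then a j ^ 2 else 0 := by
    intro S
    by_cases h : ∃ j, S = {j}
    · obtain ⟨j, rfl⟩ := h
      simp [hc]
    · push Not at h
      simp [hc, h]
  simp only [this]
  rw [Finset.sum_comm]
  apply Finset.sum_congr rfl
  intro j _
  simp

end partB3

section partC1
open MeasureTheory ProbabilityTheory

/-- Directional derivative of `ml c`. -/
noncomputable def vv {ι : Type*} [Fintype ι] (c : Finset ι → ℝ) (x y : ι → ℝ) : ℝ :=
  ∑ j, y j * ml (dc j c) x

lemma ml_hasDerivAt {ι : Type*} [Fintype ι] (c : Finset ι → ℝ) (X : ℝ → ι → ℝ) (X' : ι → ℝ) (t : ℝ)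
    (h : ∀ i, HasDerivAt (fun s => X s i) (X' i) t) :
    HasDerivAt (fun s => ml c (X s)) (vv c (X t) X') t := by
  have h1 : ∀ S : Finset ι, HasDerivAt (fun s => c S * ∏ i ∈ S, X s i)
      (c S * ∑ i ∈ S, (∏ j ∈ S.erase i, X t j) * X' i) t := by
    intro S
    have := (HasDerivAt.fun_finsetProd (u := S) (f := fun i s => X s i) (f' := X') (x := t) (fun i _ => h i)).const_mul (c S)
    simpa using this
  have h2 := HasDerivAt.fun_sum (u := (univ : Finset (Finset ι))) (fun S _ => h1 S)
  unfold ml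
  refine h2.congr_deriv ?_
  symm
  unfold vv
  have h3 : ∀ S : Finset ι, c S * ∑ i ∈ S, (∏ j ∈ S.erase i, X t j) * X' i =
      ∑ i, if i ∈ S then X' i * (c S * ∏ j ∈ S.erase i, X t j) else 0 := by
    intro S
    rw [← Finset.sum_filter]
    simp only [Finset.filter_univ_mem]
    rw [Finset.mul_sum]
    apply Finset.sum_congr rfl; intro i _; ring
  simp only [h3]
  rw [Finset.sum_comm]
  apply Finset.sum_congr rfl
  intro i _
  rw [sum_finset_split i]
  have h4 : ∑ S : Finset ι, (if i ∈ S then 0 else if i ∈ S then X' i * (c S * ∏ j ∈ S.erase i, X t j) else 0) = 0 := by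
    apply Finset.sum_eq_zero; intro S _; split_ifs <;> rfl
  rw [h4, zero_add]
  unfold ml
  rw [Finset.mul_sum]
  apply Finset.sum_congr rfl
  intro S _
  unfold dc
  split_ifs with hi
  · simp
  · simp [Finset.erase_insert hi]
  · rename_i hx
    exact absurd (Finset.mem_insert_self i S) hx

lemma vv_continuous {ι : Type*} [Fintype ι] (c : Finset ι → ℝ) :
    Continuous (fun z : (ι → ℝ) × (ι → ℝ) => vv c z.1 z.2) := by
  unfold vv
  have := fun j => ml_continuous (dc j c)
  fun_prop

/-- The polynomial on the circle. -/
noncomputable def circQ {n : ℕ} (d : ℕ) (c : Finset (Fin n) → ℝ) (x y : Fin n → ℝ) : Polynomial ℂ :=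
  ∑ S : Finset (Fin n), if S.card ≤ d then Polynomial.C (c S : ℂ) * Polynomial.X ^ (d - S.card) *
    ∏ j ∈ S, (Polynomial.C ((x j - y j * Complex.I) / 2) * Polynomial.X ^ 2 +
      Polynomial.C ((x j + y j * Complex.I) / 2)) else 0

lemma circQ_natDegree {n : ℕ} (d : ℕ) (c : Finset (Fin n) → ℝ) (x y : Fin n → ℝ) :
    (circQ d c x y).natDegree ≤ 2 * d := by
  unfold circQ
  apply Polynomial.natDegree_sum_le_of_forall_le
  intro S _
  split_ifs with hS
  swap
  · simp
  have h1 : (∏ j ∈ S, (Polynomial.C ((x j - y j * Complex.I) / 2) * Polynomial.X ^ 2 +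
      Polynomial.C ((x j + y j * Complex.I) / 2))).natDegree ≤ S.card * 2 := by
    refine (Polynomial.natDegree_prod_le _ _).trans ?_
    apply Finset.sum_le_card_nsmul
    intro j _
    compute_degree
  refine Polynomial.natDegree_mul_le.trans ?_
  have h2 : (Polynomial.C (c S : ℂ) * Polynomial.X ^ (d - S.card)).natDegree ≤ d - S.card :=
    Polynomial.natDegree_C_mul_X_pow_le _ _
  omega

lemma circQ_eval {n : ℕ} (d : ℕ) (c : Finset (Fin n) → ℝ) (hc : DegLe d c) (x y : Fin n → ℝ) (t : ℝ) :
    (ml c (Real.cos t • x + Real.sin t • y) : ℂ) =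
      Complex.exp (-(d * t * Complex.I)) * (circQ d c x y).eval (Complex.exp (t * Complex.I)) := by
  unfold circQ ml
  rw [Polynomial.eval_finsetSum, Finset.mul_sum]
  push_cast
  apply Finset.sum_congr rfl
  intro S _
  split_ifs with hS
  swap
  · simp [hc S (by omega)]
  simp only [Polynomial.eval_mul, Polynomial.eval_C, Polynomial.eval_pow, Polynomial.eval_X, Polynomial.eval_prod,
    Polynomial.eval_add]
  set z := Complex.exp (t * Complex.I) with hz
  have hz0 : z ≠ 0 := Complex.exp_ne_zero _
  have hzd : Complex.exp (-(d * t * Complex.I)) = (z ^ d)⁻¹ := by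
    rw [hz, ← Complex.exp_nat_mul, ← Complex.exp_neg]; ring_nf
  have hzi : Complex.exp (-t * Complex.I) = z⁻¹ := by
    rw [hz, ← Complex.exp_neg]; ring_nf
  have hx : ∀ j, ((Real.cos t • x + Real.sin t • y) j : ℂ) =
      z⁻¹ * ((x j - y j * Complex.I) / 2 * z ^ 2 + (x j + y j * Complex.I) / 2) := by
    intro j
    simp only [Pi.add_apply, Pi.smul_apply, smul_eq_mul]
    push_cast
    rw [Complex.cos, Complex.sin, ← hz, hzi]
    field_simp
    ring_nf
  rw [Finset.prod_congr rfl (fun j _ => hx j), Finset.prod_mul_distrib, Finset.prod_const, hzd]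
  have : (z ^ d)⁻¹ * z ^ (d - S.card) = z⁻¹ ^ S.card := by
    have h : z ^ d = z ^ (d - S.card) * z ^ S.card := by rw [← pow_add]; congr 1; omega
    rw [h, inv_pow]
    field_simp
  rw [← this]
  ring

/-- Standard Gaussian measure on `ℝ^n`. -/
noncomputable abbrev gamn (n : ℕ) : Measure (Fin n → ℝ) := Measure.pi (fun _ : Fin n => gam)

lemma Phi_vv_integrable {n : ℕ} (μ : Measure ((Fin n → ℝ) × (Fin n → ℝ))) [IsFiniteMeasure μ] (c : Finset (Fin n) → ℝ) (ε : ℝ) :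
    Integrable (fun z => Phi ε (ml c z.1) (vv c z.1 z.2)) μ := by
  apply Integrable.of_bound (C := 1)
  · apply Measurable.aestronglyMeasurable
    exact (Phi_measurable ε).comp (((ml_continuous c).measurable.comp measurable_fst).prodMk (vv_continuous c).measurable)
  · filter_upwards with z
    rw [Real.norm_of_nonneg (Phi_nonneg _ _ _)]
    exact Phi_le_one _ _ _

lemma gauss_circ {n : ℕ} (c : Finset (Fin n) → ℝ) (ε : ℝ) :
    2 * Real.pi * ∫ z, Phi ε (ml c z.1) (vv c z.1 z.2) ∂((gamn n).prod (gamn n)) =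
    ∫ z, (∫ t in (0:ℝ)..(2 * Real.pi), Phi ε (ml c (Real.cos t • z.1 + Real.sin t • z.2))
      (vv c (Real.cos t • z.1 + Real.sin t • z.2) (-Real.sin t • z.1 + Real.cos t • z.2))) ∂((gamn n).prod (gamn n)) := by
  set μ := (gamn n).prod (gamn n) with hμ
  have h0 : (0:ℝ) ≤ 2 * Real.pi := by positivity
  simp only [intervalIntegral.integral_of_le h0]
  rw [integral_integral_swap]
  · have : ∀ t : ℝ, ∫ z, Phi ε (ml c (Real.cos t • z.1 + Real.sin t • z.2))
      (vv c (Real.cos t • z.1 + Real.sin t • z.2) (-Real.sin t • z.1 + Real.cos t • z.2)) ∂μ =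
        ∫ z, Phi ε (ml c z.1) (vv c z.1 z.2) ∂μ := by
      intro t
      have hr := gamn_rot n t
      conv_rhs => rw [hμ, ← hr.map_eq]
      rw [integral_map hr.measurable.aemeasurable]
      apply Integrable.aestronglyMeasurable
      exact Phi_vv_integrable _ c ε
    simp only [this]
    simp [h0]
  · apply Integrable.of_bound (C := 1)
    · apply Measurable.aestronglyMeasurable
      have h1 : Continuous (fun q : ((Fin n → ℝ) × (Fin n → ℝ)) × ℝ =>
        ((Real.cos q.2 • q.1.1 + Real.sin q.2 • q.1.2), (-Real.sin q.2 • q.1.1 + Real.cos q.2 • q.1.2))) := by fun_prop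
      exact (Phi_measurable ε).comp ((((ml_continuous c).measurable.comp measurable_fst).prodMk (vv_continuous c).measurable).comp h1.measurable)
    · filter_upwards with z
      rw [Function.uncurry, Real.norm_of_nonneg (Phi_nonneg _ _ _)]
      exact Phi_le_one _ _ _

lemma gauss_main : ∃ C : ℝ, 0 < C ∧ ∀ (n d : ℕ) (_ : 1 ≤ d) (c : Finset (Fin n) → ℝ) (_ : DegLe d c) (ε : ℝ) (_ : 0 < ε) (_ : ε ≤ 1),
    ∫ z, Phi ε (ml c z.1) (vv c z.1 z.2) ∂((gamn n).prod (gamn n)) ≤ C * (d ^ 2 * √d) * ε *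
      ∫ z, Phi 1 (ml c z.1) (vv c z.1 z.2) ∂((gamn n).prod (gamn n)) := by
  obtain ⟨C, hC, hU⟩ := U_lemma
  refine ⟨C, hC, ?_⟩
  intro n d hd c hc ε hε hε1
  have hpi : 0 < 2 * Real.pi := by positivity
  rw [← mul_le_mul_iff_right₀ hpi, mul_left_comm, gauss_circ, gauss_circ, ← integral_const_mul]
  have hIntg : ∀ ε : ℝ, Integrable (fun z : (Fin n → ℝ) × (Fin n → ℝ) => ∫ t in (0:ℝ)..(2 * Real.pi), Phi ε (ml c (Real.cos t • z.1 + Real.sin t • z.2))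
      (vv c (Real.cos t • z.1 + Real.sin t • z.2) (-Real.sin t • z.1 + Real.cos t • z.2))) ((gamn n).prod (gamn n)) := by
    intro ε
    simp only [intervalIntegral.integral_of_le hpi.le]
    apply Integrable.integral_prod_left (f := fun q : ((Fin n → ℝ) × (Fin n → ℝ)) × ℝ => Phi ε (ml c (Real.cos q.2 • q.1.1 + Real.sin q.2 • q.1.2))
      (vv c (Real.cos q.2 • q.1.1 + Real.sin q.2 • q.1.2) (-Real.sin q.2 • q.1.1 + Real.cos q.2 • q.1.2)))
    apply Integrable.of_bound (C := 1)
    · apply Measurable.aestronglyMeasurable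
      have h1 : Continuous (fun q : ((Fin n → ℝ) × (Fin n → ℝ)) × ℝ =>
        ((Real.cos q.2 • q.1.1 + Real.sin q.2 • q.1.2), (-Real.sin q.2 • q.1.1 + Real.cos q.2 • q.1.2))) := by fun_prop
      exact (Phi_measurable ε).comp ((((ml_continuous c).measurable.comp measurable_fst).prodMk (vv_continuous c).measurable).comp h1.measurable)
    · filter_upwards with z
      rw [Real.norm_of_nonneg (Phi_nonneg _ _ _)]
      exact Phi_le_one _ _ _
  apply integral_mono (hIntg ε) ((hIntg 1).const_mul _)
  intro z
  refine hU d hd (circQ d c z.1 z.2) (circQ_natDegree _ _ _ _) (fun t => ml c (Real.cos t • z.1 + Real.sin t • z.2))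
    (fun t => vv c (Real.cos t • z.1 + Real.sin t • z.2) (-Real.sin t • z.1 + Real.cos t • z.2))
    (fun t => circQ_eval d c hc _ _ t) ?_ ?_ ε hε hε1
  · intro t
    apply ml_hasDerivAt c (fun t => Real.cos t • z.1 + Real.sin t • z.2)
    intro i
    simp only [Pi.add_apply, Pi.smul_apply, smul_eq_mul]
    exact ((Real.hasDerivAt_cos t).mul_const _).add ((Real.hasDerivAt_sin t).mul_const _)
  · have h1 : Continuous (fun t : ℝ =>
        ((Real.cos t • z.1 + Real.sin t • z.2), (-Real.sin t • z.1 + Real.cos t • z.2))) := by fun_prop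
    exact (vv_continuous c).comp h1

end partC1

section partD1
open MeasureTheory ProbabilityTheory

lemma gam_le : gam ≤ (ENNReal.ofReal (2 / 5)) • (volume : Measure ℝ) := by
  rw [gam, gaussianReal_of_var_ne_zero 0 one_ne_zero, ← withDensity_const]
  apply withDensity_mono
  filter_upwards with x
  unfold gaussianPDF
  apply ENNReal.ofReal_le_ofReal
  rw [gaussianPDFReal]
  have h1 : Real.exp (-(x - 0) ^ 2 / (2 * ((1 : NNReal) : ℝ))) ≤ 1 := by
    rw [Real.exp_le_one_iff]
    have := sq_nonneg (x - 0)
    simp only [NNReal.coe_one]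
    linarith
  have h2 : (√(2 * Real.pi * ((1 : NNReal) : ℝ)))⁻¹ ≤ 2 / 5 := by
    rw [inv_le_comm₀ (by simp [Real.pi_pos]) (by norm_num)]
    apply Real.le_sqrt_of_sq_le
    have := Real.pi_gt_d2
    simp only [NNReal.coe_one]
    norm_num
    linarith
  calc _ ≤ (2 / 5 : ℝ) * 1 := mul_le_mul h2 h1 (Real.exp_pos _).le (by norm_num)
    _ = _ := mul_one _

lemma gam_compare (f : ℝ → ℝ) (h0 : ∀ x, 0 ≤ f x) (hf : Integrable f) :
    Integrable f gam ∧ ∫ x, f x ∂gam ≤ 2 / 5 * ∫ x, f x := by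
  have h1 : Integrable f ((ENNReal.ofReal (2 / 5)) • (volume : Measure ℝ)) := hf.smul_measure (by simp)
  refine ⟨h1.mono_measure gam_le, ?_⟩
  have := integral_mono_measure gam_le (Filter.Eventually.of_forall h0) h1
  rw [integral_smul_measure] at this
  simpa [ENNReal.toReal_ofReal (show (0:ℝ) ≤ 2 / 5 by norm_num)] using this

lemma gam_cauchy (a m r : ℝ) (ha : 0 < a) (hr : 0 < r) :
    ∫ x, a / (a + (m + r * x) ^ 2) ∂gam ≤ 63 / 50 * (√a / r) := by
  have hk : r / √a ≠ 0 := by positivity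
  have hsa : 0 < √a := Real.sqrt_pos.mpr ha
  have hfun : ∀ x, a / (a + (m + r * x) ^ 2) = (1 + ((r / √a) * (x + m / r)) ^ 2)⁻¹ := by
    intro x
    have h2 : √a ^ 2 = a := Real.sq_sqrt ha.le
    have h3 : ((r / √a) * (x + m / r)) ^ 2 = (m + r * x) ^ 2 / a := by
      rw [← h2]; field_simp; rw [Real.sqrt_sq hsa.le]; ring
    rw [h3]
    field_simp
  have hI : Integrable (fun x : ℝ => a / (a + (m + r * x) ^ 2)) := by
    simp only [hfun]
    exact (integrable_inv_one_add_sq.comp_mul_left' hk).comp_add_right (m / r)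
  have hv : ∫ x : ℝ, a / (a + (m + r * x) ^ 2) = Real.pi * (√a / r) := by
    simp only [hfun]
    rw [integral_add_right_eq_self (fun x => (1 + ((r / √a) * x) ^ 2)⁻¹) (m / r),
      Measure.integral_comp_mul_left (fun x => (1 + x ^ 2)⁻¹), integral_univ_inv_one_add_sq, inv_div,
      abs_of_pos (by positivity), smul_eq_mul, mul_comm]
  refine (gam_compare _ (fun x => by positivity) hI).2.trans ?_
  rw [hv, ← mul_assoc]
  apply mul_le_mul_of_nonneg_right _ (by positivity)
  have := Real.pi_lt_d2
  linarith

lemma gam_neg_moment (s : ℝ) (hs : 0 < s) (hs1 : s ≤ 2 / 3) :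
    Integrable (fun x : ℝ => |x| ^ (-s)) gam ∧ ∫ x, |x| ^ (-s) ∂gam ≤ 1 + 12 / 5 * s := by
  set k : ℝ → ℝ := Set.indicator (Set.Ioc 0 1) (fun x => x ^ (-s) - 1) with hk
  have hii : IntervalIntegrable (fun x : ℝ => x ^ (-s) - 1) volume 0 1 :=
    (intervalIntegral.intervalIntegrable_rpow' (by linarith)).sub (by simp)
  have hkI : Integrable k := by
    rw [hk, integrable_indicator_iff measurableSet_Ioc]
    exact (intervalIntegrable_iff_integrableOn_Ioc_of_le zero_le_one).mp hii
  have hki : ∫ x, k x = 1 / (1 - s) - 1 := by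
    rw [hk, integral_indicator measurableSet_Ioc, ← intervalIntegral.integral_of_le zero_le_one,
      intervalIntegral.integral_sub (intervalIntegral.intervalIntegrable_rpow' (by linarith)) (by simp),
      integral_rpow (Or.inl (by linarith))]
    simp [Real.zero_rpow (show -s + 1 ≠ 0 by linarith)]
    ring_nf
  have hk0 : ∀ x, 0 ≤ k x := by
    intro x
    apply Set.indicator_nonneg
    intro y hy
    rw [sub_nonneg]
    exact Real.one_le_rpow_of_pos_of_le_one_of_nonpos hy.1 hy.2 (by linarith)
  have hle : ∀ x : ℝ, |x| ^ (-s) ≤ 1 + (k x + k (-x)) := by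
    have hpos : ∀ x : ℝ, 0 < x → |x| ^ (-s) ≤ 1 + k x := by
      intro x hx
      rw [abs_of_pos hx]
      by_cases h1 : x ≤ 1
      · have hm : x ∈ Set.Ioc (0:ℝ) 1 := ⟨hx, h1⟩
        rw [hk, Set.indicator_of_mem hm]; linarith
      · have := Real.rpow_le_one_of_one_le_of_nonpos (x := x) (z := -s) (by linarith) (by linarith)
        linarith [hk0 x]
    intro x
    rcases lt_trichotomy x 0 with h | h | h
    · have := hpos (-x) (by linarith)
      rw [abs_neg] at this
      linarith [hk0 x]
    · rw [h, abs_zero, Real.zero_rpow (by linarith)]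
      linarith [hk0 0, hk0 (-0)]
    · linarith [hpos x h, hk0 (-x)]
  have hI2 : Integrable (fun x => k x + k (-x)) := hkI.add hkI.comp_neg
  obtain ⟨hI3, hI4⟩ := gam_compare _ (fun x => add_nonneg (hk0 x) (hk0 (-x))) hI2
  have hv : ∫ x, (k x + k (-x)) = 2 * (1 / (1 - s) - 1) := by
    rw [integral_add hkI hkI.comp_neg, integral_neg_eq_self, hki]; ring
  have hI5 : Integrable (fun x => 1 + (k x + k (-x))) gam := (integrable_const 1).add hI3
  have hI6 : Integrable (fun x : ℝ => |x| ^ (-s)) gam := by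
    apply hI5.mono'
    · exact (Measurable.pow_const (by fun_prop) _).aestronglyMeasurable
    · filter_upwards with x
      rw [Real.norm_of_nonneg (by positivity)]
      exact hle x
  refine ⟨hI6, (integral_mono hI6 hI5 hle).trans ?_⟩
  rw [integral_add (integrable_const 1) hI3]
  simp only [integral_const, probReal_univ, smul_eq_mul, mul_one]
  rw [hv] at hI4
  have : 1 / (1 - s) - 1 ≤ 3 * s := by
    rw [sub_le_iff_le_add, div_le_iff₀ (by linarith)]
    nlinarith
  linarith

lemma lin_meas (n : ℕ) (a : Fin n → ℝ) : AEMeasurable (fun y : Fin n → ℝ => ∑ j, a j * y j) (gamn n) := by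
  apply Continuous.aemeasurable
  fun_prop

/-- Expectation of a function of a Gaussian linear form. -/
lemma lin_map (n : ℕ) (a : Fin n → ℝ) :
    (gamn n).map (fun y => ∑ j, a j * y j) = gam.map (fun x => √(∑ j, a j ^ 2) * x) := by
  rw [gamn, gamn_linear, gam, gaussianReal_map_const_mul]
  congr 1
  · simp
  · ext; simp only [mul_one]
    rw [Real.coe_toNNReal _ (by positivity)]
    exact (Real.sq_sqrt (by positivity)).symm

lemma lin_integral (n : ℕ) (a : Fin n → ℝ) (f : ℝ → ℝ) (hf : Measurable f) :
    ∫ y, f (∑ j, a j * y j) ∂(gamn n) = ∫ x, f (√(∑ j, a j ^ 2) * x) ∂gam := by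
  have h1 := integral_map (μ := gamn n) (φ := fun y => ∑ j, a j * y j) (lin_meas n a) (f := f) hf.aestronglyMeasurable
  have h2 := integral_map (μ := gam) (φ := fun x => √(∑ j, a j ^ 2) * x) (by fun_prop) (f := f) hf.aestronglyMeasurable
  rw [← h1, ← h2, lin_map]

lemma lin_integrable (n : ℕ) (a : Fin n → ℝ) (f : ℝ → ℝ) (hf : Measurable f)
    (h : Integrable (fun x => f (√(∑ j, a j ^ 2) * x)) gam) :
    Integrable (fun y => f (∑ j, a j * y j)) (gamn n) := by
  have h1 := integrable_map_measure (μ := gamn n) (f := fun y => ∑ j, a j * y j) (g := f) hf.aestronglyMeasurable (lin_meas n a)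
  have h2 := integrable_map_measure (μ := gam) (f := fun x => √(∑ j, a j ^ 2) * x) (g := f) hf.aestronglyMeasurable (by fun_prop)
  refine h1.mp ?_
  rw [lin_map]
  exact h2.mpr h

lemma lin_sq (n : ℕ) (a : Fin n → ℝ) :
    Integrable (fun y => (∑ j, a j * y j) ^ 2) (gamn n) ∧ ∫ y, (∑ j, a j * y j) ^ 2 ∂(gamn n) = ∑ j, a j ^ 2 := by
  have hA : (0:ℝ) ≤ ∑ j, a j ^ 2 := by positivity
  constructor
  · apply lin_integrable n a (fun x => x ^ 2) (by fun_prop)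
    simp only [mul_pow]
    exact (gam_mom 2).const_mul _
  · rw [lin_integral n a (fun x => x ^ 2) (by fun_prop)]
    simp only [mul_pow, Real.sq_sqrt hA]
    rw [integral_const_mul, gam_two, mul_one]

lemma lin_ae_ne (n : ℕ) (a : Fin n → ℝ) (hA : 0 < ∑ j, a j ^ 2) :
    ∀ᵐ y ∂(gamn n), ∑ j, a j * y j ≠ 0 := by
  have h : ∀ᵐ x ∂((gamn n).map (fun y => ∑ j, a j * y j)), x ≠ 0 := by
    rw [gamn, gamn_linear]
    have : NullSingletonClass (gaussianReal 0 (∑ j, a j ^ 2).toNNReal) := nullSingletonClass_gaussianReal (by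
      simpa using hA)
    rw [ae_iff]
    simp
  exact ae_of_ae_map (p := fun x => x ≠ 0) (lin_meas n a) h

end partD1

section partD2
open MeasureTheory ProbabilityTheory

/-- Coefficients in `x` of the directional derivative in direction `y`. -/
noncomputable def vcf {ι : Type*} [Fintype ι] (c : Finset ι → ℝ) (y : ι → ℝ) : Finset ι → ℝ :=
  fun T => ∑ j, dc j c T * y j

lemma vv_eq_ml {ι : Type*} [Fintype ι] (c : Finset ι → ℝ) (x y : ι → ℝ) : vv c x y = ml (vcf c y) x := by
  unfold vv ml vcf
  simp only [Finset.sum_mul, Finset.mul_sum]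
  rw [Finset.sum_comm]
  apply Finset.sum_congr rfl; intro S _
  apply Finset.sum_congr rfl; intro j _
  ring

lemma vcf_deg {ι : Type*} [Fintype ι] {d : ℕ} {c : Finset ι → ℝ} (h : DegLe d c) (y : ι → ℝ) :
    DegLe (d - 1) (vcf c y) := by
  intro S hS
  unfold vcf
  apply Finset.sum_eq_zero
  intro j _
  rw [h.dc j S hS, zero_mul]

/-- Total squared weight. -/
noncomputable def nsq {ι : Type*} [Fintype ι] (c : Finset ι → ℝ) : ℝ := ∑ S, c S ^ 2

/-- Coefficients without the constant term. -/
noncomputable def nc {ι : Type*} (c : Finset ι → ℝ) : Finset ι → ℝ := fun S => if S = ∅ then 0 else c S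

/-- Variance. -/
noncomputable def vsq {ι : Type*} [Fintype ι] (c : Finset ι → ℝ) : ℝ := nsq (nc c)

/-- Total influence. -/
noncomputable def dsq {ι : Type*} [Fintype ι] (c : Finset ι → ℝ) : ℝ := ∑ S, (S.card : ℝ) * c S ^ 2

lemma nsq_nonneg {ι : Type*} [Fintype ι] (c : Finset ι → ℝ) : 0 ≤ nsq c := by unfold nsq; positivity

lemma vsq_nonneg {ι : Type*} [Fintype ι] (c : Finset ι → ℝ) : 0 ≤ vsq c := nsq_nonneg _

lemma ml_nc {ι : Type*} [Fintype ι] (c : Finset ι → ℝ) (x : ι → ℝ) : ml c x = c ∅ + ml (nc c) x := by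
  unfold ml nc
  rw [← Finset.add_sum_erase _ _ (Finset.mem_univ (∅ : Finset ι)),
    ← Finset.add_sum_erase _ (fun S => (if S = ∅ then 0 else c S) * ∏ i ∈ S, x i) (Finset.mem_univ (∅ : Finset ι))]
  simp only [prod_empty, mul_one, if_true, zero_add]
  congr 1
  apply Finset.sum_congr rfl
  intro S hS
  rw [if_neg (Finset.ne_of_mem_erase hS)]

lemma nsq_eq {ι : Type*} [Fintype ι] (c : Finset ι → ℝ) : nsq c = c ∅ ^ 2 + vsq c := by
  unfold vsq nsq nc
  rw [← Finset.add_sum_erase _ _ (Finset.mem_univ (∅ : Finset ι)),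
    ← Finset.add_sum_erase _ (fun S => (if S = ∅ then 0 else c S) ^ 2) (Finset.mem_univ (∅ : Finset ι))]
  simp only [if_true]
  rw [zero_pow two_ne_zero, zero_add]
  congr 1
  apply Finset.sum_congr rfl
  intro S hS
  rw [if_neg (Finset.ne_of_mem_erase hS)]

lemma vsq_le_dsq {ι : Type*} [Fintype ι] (c : Finset ι → ℝ) : vsq c ≤ dsq c := by
  unfold vsq dsq nsq nc
  apply Finset.sum_le_sum
  intro S _
  split_ifs with h
  · subst h; simp
  · have : (1:ℝ) ≤ S.card := by exact_mod_cast Finset.card_pos.mpr (Finset.nonempty_iff_ne_empty.mpr h)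
    nlinarith [sq_nonneg (c S)]

lemma dsq_le {ι : Type*} [Fintype ι] (d : ℕ) (c : Finset ι → ℝ) (hc : DegLe d c) : dsq c ≤ d * vsq c := by
  unfold vsq dsq nsq nc
  rw [Finset.mul_sum]
  apply Finset.sum_le_sum
  intro S _
  split_ifs with h
  · subst h; simp
  · by_cases h1 : S.card ≤ d
    · have : (S.card:ℝ) ≤ d := by exact_mod_cast h1
      nlinarith [sq_nonneg (c S)]
    · rw [hc S (by omega)]; simp

lemma sum_dc_eq_dsq {ι : Type*} [Fintype ι] (c : Finset ι → ℝ) : ∑ j, ∑ T, dc j c T ^ 2 = dsq c := by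
  simp only [sum_dc_sq]
  rw [Finset.sum_comm]
  unfold dsq
  apply Finset.sum_congr rfl
  intro S _
  rw [← Finset.sum_filter]
  simp

lemma integral_nsq_vcf {n : ℕ} (c : Finset (Fin n) → ℝ) :
    Integrable (fun y => nsq (vcf c y)) (gamn n) ∧ ∫ y, nsq (vcf c y) ∂(gamn n) = dsq c := by
  unfold nsq vcf
  have h := fun T => lin_sq n (fun j => dc j c T)
  refine ⟨integrable_finsetSum _ (fun T _ => (h T).1), ?_⟩
  rw [integral_finsetSum _ (fun T _ => (h T).1), ← sum_dc_eq_dsq, Finset.sum_comm]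
  exact Finset.sum_congr rfl (fun T _ => (h T).2)

lemma neg_jensen {α : Type*} (s : Finset α) (w x : α → ℝ) (hw : ∀ i ∈ s, 0 ≤ w i) (hw1 : ∑ i ∈ s, w i = 1)
    (hx : ∀ i ∈ s, 0 < x i) (r : ℝ) (hr : 0 ≤ r) :
    (∑ i ∈ s, w i * x i) ^ (-r) ≤ ∑ i ∈ s, w i * x i ^ (-r) := by
  have h1 := Real.geom_mean_le_arith_mean_weighted s w x hw hw1 (fun i hi => (hx i hi).le)
  have h2 := Real.geom_mean_le_arith_mean_weighted s w (fun i => x i ^ (-r)) hw hw1 (fun i hi => by have := hx i hi; positivity)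
  have h0 : 0 < ∏ i ∈ s, x i ^ w i := Finset.prod_pos (fun i hi => Real.rpow_pos_of_pos (hx i hi) _)
  refine (Real.rpow_le_rpow_of_nonpos h0 h1 (by linarith)).trans (le_trans (le_of_eq ?_) h2)
  rw [← Real.finsetProd_rpow _ _ (fun i hi => (Real.rpow_pos_of_pos (hx i hi) _).le)]
  apply Finset.prod_congr rfl
  intro i hi
  rw [← Real.rpow_mul (hx i hi).le, ← Real.rpow_mul (hx i hi).le, mul_comm]

lemma neg_q {n : ℕ} (c : Finset (Fin n) → ℝ) (hv : 0 < vsq c) (s : ℝ) (hs : 0 < s) (hs1 : s ≤ 2 / 3) :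
    ∃ G : (Fin n → ℝ) → ℝ, Integrable G (gamn n) ∧ ∫ y, G y ∂(gamn n) ≤ 1 + 12 / 5 * s ∧
      ∀ᵐ y ∂(gamn n), 0 < nsq (vcf c y) ∧ (vsq c / nsq (vcf c y)) ^ (s / 2) ≤ G y := by
  set A : Finset (Fin n) → ℝ := fun T => ∑ j, dc j c T ^ 2 with hA
  have hA0 : ∀ T, 0 ≤ A T := fun T => by rw [hA]; positivity
  have hAs : ∑ T, A T = dsq c := by rw [← sum_dc_eq_dsq, Finset.sum_comm]
  have hd : 0 < dsq c := hv.trans_le (vsq_le_dsq c)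
  set P : Finset (Finset (Fin n)) := univ.filter (fun T => 0 < A T) with hP
  have hPA : ∑ T ∈ P, A T = dsq c := by
    rw [← hAs, hP, Finset.sum_filter_of_ne]
    intro T _ hT; exact lt_of_le_of_ne (hA0 T) hT.symm
  obtain ⟨hgI, hgv⟩ := gam_neg_moment s hs hs1
  have hT : ∀ T ∈ P, Integrable (fun y : Fin n → ℝ => |(∑ j, dc j c T * y j) / √(A T)| ^ (-s)) (gamn n) ∧
      ∫ y : Fin n → ℝ, |(∑ j, dc j c T * y j) / √(A T)| ^ (-s) ∂(gamn n) ≤ 1 + 12 / 5 * s := by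
    intro T hT
    have hpos : 0 < A T := (Finset.mem_filter.mp hT).2
    have hsq : √(A T) ≠ 0 := (Real.sqrt_pos.mpr hpos).ne'
    have hm : Measurable (fun x : ℝ => |x / √(A T)| ^ (-s)) := Measurable.pow_const (by fun_prop) _
    have he : ∀ x : ℝ, |√(∑ j, dc j c T ^ 2) * x / √(A T)| ^ (-s) = |x| ^ (-s) := by
      intro x
      rw [show √(∑ j, dc j c T ^ 2) = √(A T) from rfl, mul_div_cancel_left₀ _ hsq]
    constructor
    · apply lin_integrable n (fun j => dc j c T) (fun x => |x / √(A T)| ^ (-s)) hm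
      simp only [he]; exact hgI
    · rw [lin_integral n (fun j => dc j c T) (fun x => |x / √(A T)| ^ (-s)) hm]
      simp only [he]; exact hgv
  have hIntg : ∀ T ∈ P, Integrable (fun y : Fin n → ℝ => (A T / dsq c) * |(∑ j, dc j c T * y j) / √(A T)| ^ (-s)) (gamn n) :=
    fun T h => ((hT T h).1).const_mul _
  refine ⟨fun y => ∑ T ∈ P, (A T / dsq c) * |(∑ j, dc j c T * y j) / √(A T)| ^ (-s), integrable_finsetSum _ hIntg, ?_, ?_⟩
  · rw [integral_finsetSum _ hIntg]
    calc _ ≤ ∑ T ∈ P, (A T / dsq c) * (1 + 12 / 5 * s) := by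
          apply Finset.sum_le_sum
          intro T h
          rw [integral_const_mul]
          exact mul_le_mul_of_nonneg_left (hT T h).2 (div_nonneg (hA0 T) hd.le)
      _ = _ := by rw [← Finset.sum_mul, ← Finset.sum_div, hPA, div_self hd.ne', one_mul]
  · have hae : ∀ᵐ y ∂(gamn n), ∀ T ∈ P, ∑ j, dc j c T * y j ≠ 0 := by
      rw [Finset.eventually_all]
      intro T h
      exact lin_ae_ne n (fun j => dc j c T) (Finset.mem_filter.mp h).2
    filter_upwards [hae] with y hy
    have hq : ∑ T ∈ P, (A T / dsq c) * ((∑ j, dc j c T * y j) ^ 2 / A T) ≤ nsq (vcf c y) / dsq c := by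
      unfold nsq vcf
      rw [Finset.sum_div]
      calc _ = ∑ T ∈ P, (∑ j, dc j c T * y j) ^ 2 / dsq c := by
            apply Finset.sum_congr rfl
            intro T h
            have := (Finset.mem_filter.mp h).2
            field_simp
        _ ≤ _ := Finset.sum_le_sum_of_subset_of_nonneg (Finset.subset_univ _) (fun T _ _ => by positivity)
    have hx : ∀ T ∈ P, 0 < (∑ j, dc j c T * y j) ^ 2 / A T := by
      intro T h
      have := hy T h
      have := (Finset.mem_filter.mp h).2
      positivity
    have hw1 : ∑ T ∈ P, A T / dsq c = 1 := by rw [← Finset.sum_div, hPA, div_self hd.ne']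
    have hPne : P.Nonempty := by
      by_contra hne
      rw [Finset.not_nonempty_iff_eq_empty] at hne
      rw [hne] at hw1; simp at hw1
    have hpos : 0 < ∑ T ∈ P, (A T / dsq c) * ((∑ j, dc j c T * y j) ^ 2 / A T) := by
      apply Finset.sum_pos _ hPne
      intro T h
      have := (Finset.mem_filter.mp h).2
      exact mul_pos (by positivity) (hx T h)
    have hqpos : 0 < nsq (vcf c y) := by
      have := hpos.trans_le hq
      by_contra hneg
      have h0 : nsq (vcf c y) / dsq c ≤ 0 := div_nonpos_of_nonpos_of_nonneg (not_lt.mp hneg) hd.le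
      linarith
    refine ⟨hqpos, ?_⟩
    calc (vsq c / nsq (vcf c y)) ^ (s / 2) ≤ (dsq c / nsq (vcf c y)) ^ (s / 2) := by
          apply Real.rpow_le_rpow (by positivity) _ (by positivity)
          exact div_le_div_of_nonneg_right (vsq_le_dsq c) hqpos.le
      _ = (nsq (vcf c y) / dsq c) ^ (-(s / 2)) := by
          rw [Real.rpow_neg (by positivity), ← Real.inv_rpow (by positivity), inv_div]
      _ ≤ (∑ T ∈ P, (A T / dsq c) * ((∑ j, dc j c T * y j) ^ 2 / A T)) ^ (-(s / 2)) :=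
          Real.rpow_le_rpow_of_nonpos hpos hq (by linarith)
      _ ≤ _ := neg_jensen P _ _ (fun T _ => div_nonneg (hA0 T) hd.le) hw1 hx _ (by positivity)
      _ = _ := by
          apply Finset.sum_congr rfl
          intro T h
          have hAT := (Finset.mem_filter.mp h).2
          congr 1
          have : (∑ j, dc j c T * y j) ^ 2 / A T = |(∑ j, dc j c T * y j) / √(A T)| ^ (2:ℝ) := by
            rw [Real.rpow_two, sq_abs, div_pow, Real.sq_sqrt hAT.le]
          rw [this, ← Real.rpow_mul (abs_nonneg _)]
          congr 1; ring

lemma cheb_pt (y m l : ℝ) (hy : 0 ≤ y) (hm : m ≠ 0) : y / (y + (m + l) ^ 2) ≤ 4 * y / m ^ 2 + 4 * l ^ 2 / m ^ 2 := by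
  have hm2 : 0 < m ^ 2 := by positivity
  rw [← add_div]
  by_cases h : m ^ 2 ≤ 4 * l ^ 2
  · calc _ ≤ (1:ℝ) := div_le_one_of_le₀ (by nlinarith [sq_nonneg (m + l)]) (by positivity)
      _ ≤ _ := by rw [le_div_iff₀ hm2]; linarith
  · push Not at h
    have h4 : m ^ 2 ≤ 4 * (m + l) ^ 2 := by
      have h5 : |2 * l| ≤ |m| := by apply sq_le_sq.mp; nlinarith
      have h6 : |m| ≤ |2 * (m + l)| := by
        have h7 : |m| * 2 ≤ |2 * (m + l)| + |2 * l| := by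
          calc |m| * 2 = |2 * (m + l) - 2 * l| := by rw [show 2 * (m + l) - 2 * l = m * 2 by ring, abs_mul]; norm_num
            _ ≤ _ := abs_sub _ _
        linarith
      have := sq_le_sq.mpr h6
      nlinarith
    calc y / (y + (m + l) ^ 2) ≤ y / (m ^ 2 / 4) := by
          apply div_le_div_of_nonneg_left hy (by positivity)
          linarith
      _ = 4 * y / m ^ 2 := by field_simp
      _ ≤ _ := by apply div_le_div_of_nonneg_right _ hm2.le; nlinarith [sq_nonneg l]

lemma cheb_int {n : ℕ} (c e : Finset (Fin n) → ℝ) (hm : c ∅ ≠ 0) :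
    ∫ x, ml e x ^ 2 / (ml e x ^ 2 + ml c x ^ 2) ∂(gamn n) ≤ (4 * nsq e + 4 * vsq c) / (c ∅) ^ 2 := by
  have hI1 : Integrable (fun x => 4 * ml e x ^ 2 / (c ∅) ^ 2) (gamn n) :=
    ((poly_integrable _ (fun _ => good_gam) ((ml_isPolyF e).pow 2)).const_mul 4).div_const _
  have hI2 : Integrable (fun x => 4 * ml (nc c) x ^ 2 / (c ∅) ^ 2) (gamn n) :=
    ((poly_integrable _ (fun _ => good_gam) ((ml_isPolyF (nc c)).pow 2)).const_mul 4).div_const _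
  have hI : Integrable (fun x => 4 * ml e x ^ 2 / (c ∅) ^ 2 + 4 * ml (nc c) x ^ 2 / (c ∅) ^ 2) (gamn n) := hI1.add hI2
  calc _ ≤ ∫ x, (4 * ml e x ^ 2 / (c ∅) ^ 2 + 4 * ml (nc c) x ^ 2 / (c ∅) ^ 2) ∂(gamn n) := by
        apply integral_mono_of_nonneg
        · filter_upwards with x; positivity
        · exact hI
        · filter_upwards with x
          rw [ml_nc c x]
          exact cheb_pt _ _ _ (by positivity) hm
    _ = _ := by
        rw [integral_add hI1 hI2, integral_div, integral_div, integral_const_mul, integral_const_mul,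
          ml_second _ (fun _ => good_gam), ml_second _ (fun _ => good_gam), ← add_div]
        rfl

/-- Smoothed small-ball quantity. -/
noncomputable def Lam {n : ℕ} (a : ℝ) (c : Finset (Fin n) → ℝ) : ℝ := ∫ x, a / (a + ml c x ^ 2) ∂(gamn n)

lemma Lam_pt_cont {n : ℕ} (a : ℝ) (ha : 0 < a) (c : Finset (Fin n) → ℝ) : Continuous (fun x => a / (a + ml c x ^ 2)) := by
  apply Continuous.div continuous_const
  · have := ml_continuous c; fun_prop
  · intro x; positivity

lemma Lam_integrable {n : ℕ} (a : ℝ) (ha : 0 < a) (c : Finset (Fin n) → ℝ) :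
    Integrable (fun x => a / (a + ml c x ^ 2)) (gamn n) := by
  apply Integrable.of_bound (Lam_pt_cont a ha c).aestronglyMeasurable 1
  filter_upwards with x
  rw [Real.norm_of_nonneg (by positivity)]
  apply div_le_one_of_le₀ _ (by positivity)
  nlinarith [sq_nonneg (ml c x)]

lemma Lam_nonneg {n : ℕ} (a : ℝ) (ha : 0 < a) (c : Finset (Fin n) → ℝ) : 0 ≤ Lam a c :=
  integral_nonneg (fun x => by dsimp only; positivity)

lemma Lam_le_one {n : ℕ} (a : ℝ) (ha : 0 < a) (c : Finset (Fin n) → ℝ) : Lam a c ≤ 1 := by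
  have := integral_mono (Lam_integrable a ha c) (integrable_const (1:ℝ)) (fun x => by
    apply div_le_one_of_le₀ _ (by positivity)
    nlinarith [sq_nonneg (ml c x)])
  simpa [Lam] using this

lemma Lam_cheb {n : ℕ} (a : ℝ) (ha : 0 < a) (c : Finset (Fin n) → ℝ) (hm : c ∅ ≠ 0) :
    Lam a c ≤ (4 * a + 4 * vsq c) / (c ∅) ^ 2 := by
  have h := cheb_int c (fun S => if S = ∅ then √a else 0) hm
  have h1 : ∀ x, ml (fun S : Finset (Fin n) => if S = ∅ then √a else 0) x = √a := by
    intro x; simp [ml]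
  have h2 : nsq (fun S : Finset (Fin n) => if S = ∅ then √a else 0) = a := by
    simp [nsq, ite_pow, Real.sq_sqrt ha.le]
  simp only [h1, h2, Real.sq_sqrt ha.le] at h
  exact h

end partD2

section partD3
open MeasureTheory ProbabilityTheory

lemma ml_deg_one {n : ℕ} (c : Finset (Fin n) → ℝ) (hc : DegLe 1 c) :
    (∀ x, ml c x = c ∅ + ∑ j, c {j} * x j) ∧ vsq c = ∑ j, c {j} ^ 2 := by
  have key : ∀ f : Finset (Fin n) → ℝ, (∀ S, 1 < S.card → f S = 0) → f ∅ = 0 → ∑ S, f S = ∑ j, f {j} := by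
    intro f hf h0
    rw [← Finset.sum_image (f := f) (s := (univ : Finset (Fin n))) (g := fun j => {j}) (by
      intro a _ b _ h; simpa using h)]
    symm
    apply Finset.sum_subset (Finset.subset_univ _)
    intro S _ hS
    by_cases h1 : 1 < S.card
    · exact hf S h1
    · by_cases h2 : S.card = 0
      · rw [Finset.card_eq_zero.mp h2, h0]
      · obtain ⟨j, rfl⟩ := Finset.card_eq_one.mp (show S.card = 1 by omega)
        simp at hS
  constructor
  · intro x
    rw [ml_nc, ml, key]
    · simp [nc]
    · intro S hS; simp [nc, hc S hS]
    · simp [nc]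
  · rw [vsq, nsq, key]
    · simp [nc]
    · intro S hS; simp [nc, hc S hS]
    · simp [nc]

lemma cw_small {n : ℕ} (d : ℕ) (c : Finset (Fin n) → ℝ) (hN : 0 < nsq c) (η : ℝ) (hη : 0 < η) (hη1 : η ≤ 1 / 16)
    (hs : vsq c ≤ η * nsq c) : Lam (nsq c * η ^ (2 * d + 1)) c ≤ 16 * η := by
  have ha : 0 < nsq c * η ^ (2 * d + 1) := by positivity
  have hm : nsq c / 2 ≤ c ∅ ^ 2 := by have := nsq_eq c; nlinarith
  have hm2 : 0 < c ∅ ^ 2 := by linarith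
  have hm0 : c ∅ ≠ 0 := by intro h; rw [h] at hm2; simp at hm2
  refine (Lam_cheb _ ha c hm0).trans ?_
  rw [div_le_iff₀ hm2]
  have h1 : η ^ (2 * d + 1) ≤ η := by
    rw [pow_succ]
    have : η ^ (2 * d) ≤ 1 := pow_le_one₀ hη.le (by linarith)
    nlinarith
  nlinarith [mul_le_mul_of_nonneg_left h1 hN.le, mul_le_mul_of_nonneg_left hm hη.le]

lemma cw_base {n : ℕ} (c : Finset (Fin n) → ℝ) (hc : DegLe 1 c) (hN : 0 < nsq c) (η : ℝ) (hη : 0 < η) :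
    Lam (nsq c * η ^ (2 * 1 + 1)) c ≤ 16 * η := by
  have ha : 0 < nsq c * η ^ (2 * 1 + 1) := by positivity
  by_cases h16 : 1 / 16 ≤ η
  · exact (Lam_le_one _ ha c).trans (by linarith)
  push Not at h16
  by_cases hs : vsq c ≤ η * nsq c
  · exact cw_small 1 c hN η hη h16.le hs
  push Not at hs
  obtain ⟨h1, h2⟩ := ml_deg_one c hc
  have hv : 0 < vsq c := lt_trans (by positivity) hs
  unfold Lam
  simp only [h1]
  set a := nsq c * η ^ (2 * 1 + 1) with hadef
  rw [lin_integral n (fun j => c {j}) (fun z => a / (a + (c ∅ + z) ^ 2)) (by fun_prop), ← h2]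
  refine (gam_cauchy a (c ∅) (√(vsq c)) ha (Real.sqrt_pos.mpr hv)).trans ?_
  have h3 : √a / √(vsq c) ≤ η := by
    rw [← Real.sqrt_div ha.le]
    apply Real.sqrt_le_iff.mpr ⟨hη.le, ?_⟩
    rw [div_le_iff₀ hv, hadef]
    calc nsq c * η ^ (2 * 1 + 1) = η ^ 2 * (η * nsq c) := by ring
      _ ≤ _ := mul_le_mul_of_nonneg_left hs.le (by positivity)
  linarith

lemma Phi1_bound {n : ℕ} (d : ℕ) (hd : 1 ≤ d) (c : Finset (Fin n) → ℝ) (hc : DegLe d c) (hN : 0 < nsq c) :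
    ∫ z, Phi 1 (ml c z.1) (vv c z.1 z.2) ∂((gamn n).prod (gamn n)) ≤ 4 * (√d * √(vsq c / nsq c)) := by
  have hd' : (1:ℝ) ≤ d := by exact_mod_cast hd
  have hle1 : ∫ z, Phi 1 (ml c z.1) (vv c z.1 z.2) ∂((gamn n).prod (gamn n)) ≤ 1 := by
    have := integral_mono (Phi_vv_integrable ((gamn n).prod (gamn n)) c 1) (integrable_const (1:ℝ)) (fun z => Phi_le_one _ _ _)
    simpa using this
  have hI0 : 0 ≤ ∫ z, Phi 1 (ml c z.1) (vv c z.1 z.2) ∂((gamn n).prod (gamn n)) :=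
    integral_nonneg (fun z => Phi_nonneg _ _ _)
  set I := ∫ z, Phi 1 (ml c z.1) (vv c z.1 z.2) ∂((gamn n).prod (gamn n)) with hI
  rw [← Real.sqrt_mul (by positivity)]
  have hv := vsq_nonneg c
  set w := (d:ℝ) * (vsq c / nsq c) with hw
  have hw0 : 0 ≤ w := by positivity
  have key : I ≤ 16 * w := by
    by_cases hs : nsq c / 2 ≤ vsq c
    · have : 1 / 2 ≤ vsq c / nsq c := by rw [le_div_iff₀ hN]; linarith
      have : 1 / 2 ≤ w := by nlinarith
      linarith
    push Not at hs
    have hm : nsq c / 2 ≤ c ∅ ^ 2 := by have := nsq_eq c; linarith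
    have hm2 : 0 < c ∅ ^ 2 := by linarith
    have hm0 : c ∅ ≠ 0 := by intro h; rw [h] at hm2; simp at hm2
    have hIntg := Phi_vv_integrable ((gamn n).prod (gamn n)) c 1
    have h1 : I ≤ ∫ y, (4 * nsq (vcf c y) + 4 * vsq c) / (c ∅) ^ 2 ∂(gamn n) := by
      rw [hI, integral_prod_symm _ hIntg]
      apply integral_mono_of_nonneg
      · filter_upwards with y; exact integral_nonneg (fun x => Phi_nonneg _ _ _)
      · exact (((integral_nsq_vcf c).1.const_mul 4).add (integrable_const _)).div_const _
      · filter_upwards with y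
        refine le_trans (le_of_eq ?_) (cheb_int c (vcf c y) hm0)
        congr 1
        funext x
        simp only [Phi, vv_eq_ml]
        ring_nf
    have h2 : ∫ y, (4 * nsq (vcf c y) + 4 * vsq c) / (c ∅) ^ 2 ∂(gamn n) = (4 * dsq c + 4 * vsq c) / (c ∅) ^ 2 := by
      rw [integral_div, integral_add ((integral_nsq_vcf c).1.const_mul 4) (integrable_const _), integral_const_mul,
        (integral_nsq_vcf c).2]
      simp
    refine h1.trans (h2.le.trans ?_)
    have h3 := dsq_le d c hc
    have hwN : w * nsq c = d * vsq c := by rw [hw]; field_simp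
    rw [div_le_iff₀ hm2]
    nlinarith [mul_le_mul_of_nonneg_left hm hw0]
  have h4 : √w * √w = w := Real.mul_self_sqrt hw0
  have h5 := Real.sqrt_nonneg w
  by_cases h : 1 ≤ 4 * √w
  · linarith
  · push Not at h; nlinarith

lemma sum_pt (a x y : ℝ) (ha : 0 < a) (hx : 0 ≤ x) (hy : 0 ≤ y) : a / (a + x) ≤ y / (x + y) + a / (a + y) := by
  rcases hy.eq_or_lt with h | h
  · subst h
    have : a / (a + x) ≤ 1 := div_le_one_of_le₀ (by linarith) (by linarith)
    simp [ha.ne']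
    exact this
  · rw [div_add_div _ _ (by positivity) (by positivity), div_le_div_iff₀ (by positivity) (by positivity)]
    nlinarith [mul_nonneg hx hy, mul_nonneg ha.le hx, mul_nonneg ha.le hy, mul_nonneg (mul_nonneg ha.le hx) hx,
      mul_nonneg (mul_nonneg ha.le hx) hy, mul_nonneg (mul_nonneg ha.le ha.le) hy, mul_nonneg (mul_nonneg ha.le ha.le) hx,
      mul_nonneg (mul_nonneg ha.le hy) hy, mul_nonneg (mul_nonneg hx hx) hy, mul_nonneg (mul_nonneg hx hy) hy]

set_option maxHeartbeats 1000000 in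
lemma carbery_wright : ∃ K : ℝ, 16 ≤ K ∧ ∀ (d : ℕ), 1 ≤ d → ∀ (n : ℕ) (c : Finset (Fin n) → ℝ), DegLe d c → 0 < nsq c →
    ∀ η : ℝ, 0 < η → Lam (nsq c * η ^ (2 * d + 1)) c ≤ K * (d:ℝ) ^ 4 * η := by
  obtain ⟨C, hC, hmain⟩ := gauss_main
  set K := max 16 (4 * C) with hK
  have hK16 : 16 ≤ K := le_max_left _ _
  have hKC : 4 * C ≤ K := le_max_right _ _
  refine ⟨K, hK16, ?_⟩
  intro d hd
  induction d, hd using Nat.le_induction with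
  | base =>
    intro n c hc hN η hη
    refine (cw_base c hc hN η hη).trans ?_
    simp only [Nat.cast_one, one_pow, mul_one]
    exact mul_le_mul_of_nonneg_right hK16 hη.le
  | succ e he ih =>
    intro n c hc hN η hη
    have he' : (1:ℝ) ≤ e := by exact_mod_cast he
    have hd4 : (1:ℝ) ≤ ((e + 1 : ℕ) : ℝ) ^ 4 := one_le_pow₀ (by push_cast; linarith)
    have hK1 : 16 * η ≤ K * ((e + 1 : ℕ) : ℝ) ^ 4 * η := by
      apply mul_le_mul_of_nonneg_right _ hη.le
      nlinarith
    set a := nsq c * η ^ (2 * (e + 1) + 1) with hadef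
    have ha : 0 < a := by positivity
    by_cases h16 : 1 / 16 ≤ η
    · exact (Lam_le_one _ ha c).trans (by linarith)
    push Not at h16
    by_cases hs : vsq c ≤ η ^ 2 * nsq c
    · refine (cw_small (e + 1) c hN η hη h16.le (hs.trans ?_)).trans hK1
      apply mul_le_mul_of_nonneg_right _ hN.le
      nlinarith
    push Not at hs
    have hv : 0 < vsq c := lt_trans (by positivity) hs
    set δ := η * √(nsq c / vsq c) with hδ
    have hδ0 : 0 < δ := by positivity
    have hδ2 : δ ^ 2 = η ^ 2 * (nsq c / vsq c) := by rw [hδ, mul_pow, Real.sq_sqrt (by positivity)]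
    have hδ1 : δ ≤ 1 := by
      have : δ ^ 2 ≤ 1 := by rw [hδ2, ← mul_div_assoc, div_le_one hv]; exact hs.le
      nlinarith
    set b := vsq c * η ^ (2 * e + 1) with hb
    have hb0 : 0 < b := by positivity
    have hab : a = δ ^ 2 * b := by
      rw [hδ2, hb, hadef]; field_simp; ring
    set μ := (gamn n).prod (gamn n) with hμ
    have hI1 : Integrable (fun z : (Fin n → ℝ) × (Fin n → ℝ) => b / (b + vv c z.1 z.2 ^ 2)) μ := by
      apply Integrable.of_bound (C := 1)
      · apply Continuous.aestronglyMeasurable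
        apply Continuous.div continuous_const
        · have := vv_continuous c; fun_prop
        · intro x; positivity
      · filter_upwards with z
        rw [Real.norm_of_nonneg (by positivity)]
        apply div_le_one_of_le₀ _ (by positivity)
        nlinarith [sq_nonneg (vv c z.1 z.2)]
    have hI2 := Phi_vv_integrable μ c δ
    have hL : Lam a c = ∫ z, a / (a + ml c z.1 ^ 2) ∂μ := by
      rw [hμ, integral_fun_fst (fun x => a / (a + ml c x ^ 2))]
      simp [Lam]
    have hI0 : Integrable (fun z : (Fin n → ℝ) × (Fin n → ℝ) => a / (a + ml c z.1 ^ 2)) μ :=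
      (Lam_integrable a ha c).comp_fst _
    have hsplit : Lam a c ≤ ∫ z, Phi δ (ml c z.1) (vv c z.1 z.2) ∂μ + ∫ z, b / (b + vv c z.1 z.2 ^ 2) ∂μ := by
      rw [hL, ← integral_add hI2 hI1]
      apply integral_mono hI0 (hI2.add hI1)
      intro z
      have := sum_pt a (ml c z.1 ^ 2) (δ ^ 2 * vv c z.1 z.2 ^ 2) ha (by positivity) (by positivity)
      refine this.trans (le_of_eq ?_)
      simp only [Pi.add_apply, Phi]
      congr 1
      rw [hab, ← mul_add, mul_div_mul_left _ _ (by positivity)]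
    have hfirst : ∫ z, Phi δ (ml c z.1) (vv c z.1 z.2) ∂μ ≤ 4 * C * ((e + 1 : ℕ) : ℝ) ^ 3 * η := by
      refine (hmain n (e + 1) (by omega) c hc δ hδ0 hδ1).trans ?_
      have h1 := Phi1_bound (e + 1) (by omega) c hc hN
      refine (mul_le_mul_of_nonneg_left h1 (by positivity)).trans (le_of_eq ?_)
      have h2 : √(nsq c / vsq c) * √(vsq c / nsq c) = 1 := by
        rw [← Real.sqrt_mul (by positivity)]
        rw [show nsq c / vsq c * (vsq c / nsq c) = 1 by field_simp, Real.sqrt_one]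
      have h3 : √((e + 1 : ℕ) : ℝ) * √((e + 1 : ℕ) : ℝ) = ((e + 1 : ℕ) : ℝ) := Real.mul_self_sqrt (by positivity)
      rw [hδ]
      calc _ = 4 * C * ((e + 1 : ℕ) : ℝ) ^ 2 * (√((e + 1 : ℕ) : ℝ) * √((e + 1 : ℕ) : ℝ)) * η * (√(nsq c / vsq c) * √(vsq c / nsq c)) := by ring
        _ = _ := by rw [h2, h3]; ring
    set s : ℝ := 2 / (2 * e + 1) with hsdef
    have hs0 : 0 < s := by positivity
    have hs1 : s ≤ 2 / 3 := by
      rw [hsdef]; apply div_le_div_of_nonneg_left (by norm_num) (by norm_num); linarith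
    obtain ⟨G, hG1, hG2, hG3⟩ := neg_q c hv s hs0 hs1
    have hsecond : ∫ z, b / (b + vv c z.1 z.2 ^ 2) ∂μ ≤ K * (e:ℝ) ^ 4 * η * (1 + 12 / 5 * s) := by
      rw [hμ, integral_prod_symm _ hI1]
      calc _ ≤ ∫ y, K * (e:ℝ) ^ 4 * η * G y ∂(gamn n) := by
            apply integral_mono_of_nonneg
            · filter_upwards with y; exact integral_nonneg (fun x => by positivity)
            · exact hG1.const_mul _
            · filter_upwards [hG3] with y hy
              obtain ⟨hq, hy⟩ := hy
              simp only [vv_eq_ml]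
              set η' := η * (vsq c / nsq (vcf c y)) ^ (s / 2) with hη'
              have hη'0 : 0 < η' := by positivity
              have hih := ih n (vcf c y) (by simpa using vcf_deg hc y) hq η' hη'0
              have hb' : nsq (vcf c y) * η' ^ (2 * e + 1) = b := by
                rw [hη', mul_pow, ← Real.rpow_natCast ((vsq c / nsq (vcf c y)) ^ (s / 2)), ← Real.rpow_mul (by positivity)]
                have : s / 2 * ((2 * e + 1 : ℕ) : ℝ) = 1 := by rw [hsdef]; push_cast; field_simp
                rw [this, Real.rpow_one, hb]; field_simp
              rw [hb'] at hih
              refine hih.trans ?_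
              rw [hη', ← mul_assoc]
              exact mul_le_mul_of_nonneg_left hy (by positivity)
        _ = K * (e:ℝ) ^ 4 * η * ∫ y, G y ∂(gamn n) := integral_const_mul _ _
        _ ≤ _ := mul_le_mul_of_nonneg_left hG2 (by positivity)
    refine hsplit.trans ((add_le_add hfirst hsecond).trans ?_)
    have h5 : s * e ≤ 1 := by
      rw [hsdef, div_mul_eq_mul_div, div_le_one (by positivity)]; linarith
    have h6 : (e:ℝ) ^ 4 * (1 + 12 / 5 * s) ≤ (e:ℝ) ^ 4 + 12 / 5 * (e:ℝ) ^ 3 := by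
      have : (e:ℝ) ^ 4 * s = e ^ 3 * (s * e) := by ring
      nlinarith [mul_le_mul_of_nonneg_left h5 (show (0:ℝ) ≤ (e:ℝ) ^ 3 by positivity)]
    have h7 : (e + 1 : ℝ) ^ 3 + ((e:ℝ) ^ 4 + 12 / 5 * (e:ℝ) ^ 3) ≤ (e + 1 : ℝ) ^ 4 := by
      nlinarith [pow_pos (show (0:ℝ) < e by linarith) 2, pow_pos (show (0:ℝ) < e by linarith) 3]
    push_cast
    have h8 : 4 * C * ((e:ℝ) + 1) ^ 3 ≤ K * ((e:ℝ) + 1) ^ 3 := mul_le_mul_of_nonneg_right hKC (by positivity)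
    have hK0 : 0 ≤ K := by linarith
    have h9 := mul_le_mul_of_nonneg_left h6 hK0
    have h10 := mul_le_mul_of_nonneg_left h7 hK0
    have h11 : 4 * C * ((e:ℝ) + 1) ^ 3 + K * ((e:ℝ) ^ 4 * (1 + 12 / 5 * s)) ≤ K * ((e:ℝ) + 1) ^ 4 := by linarith
    refine le_trans (le_of_eq ?_) (mul_le_mul_of_nonneg_right h11 hη.le)
    ring

end partD3

section partB4
open MeasureTheory ProbabilityTheory

lemma sum_sumfinset {α β : Type*} [Fintype α] [Fintype β] (f : Finset (α ⊕ β) → ℝ) :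
    ∑ S, f S = ∑ A : Finset α, ∑ B : Finset β, f (A.disjSum B) := by
  rw [← Fintype.sum_prod_type' (f := fun (A : Finset α) (B : Finset β) => f (A.disjSum B))]
  rw [← Equiv.sum_comp (Finset.sumEquiv (α := α) (β := β)).symm.toEquiv f]
  rfl

/-- coefficients of `ml c` on the doubled index set -/
noncomputable def lc {n : ℕ} (c : Finset (Fin n) → ℝ) : Finset (Fin n ⊕ Fin n) → ℝ :=
  fun S => if S.toRight = ∅ then c S.toLeft else 0

/-- coefficients of `vv c` on the doubled index set -/
noncomputable def vc {n : ℕ} (c : Finset (Fin n) → ℝ) : Finset (Fin n ⊕ Fin n) → ℝ :=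
  fun S => ∑ j, if S.toRight = {j} then dc j c S.toLeft else 0

lemma ml_lc {n : ℕ} (c : Finset (Fin n) → ℝ) (w : Fin n ⊕ Fin n → ℝ) :
    ml (lc c) w = ml c (fun i => w (Sum.inl i)) := by
  unfold ml
  rw [sum_sumfinset]
  apply Finset.sum_congr rfl
  intro A _
  rw [Finset.sum_eq_single ∅]
  · simp only [lc, Finset.prod_disjSum, Finset.toRight_disjSum, Finset.toLeft_disjSum]; simp
  · intro B _ hB; simp [lc, hB]
  · simp

lemma ml_vc {n : ℕ} (c : Finset (Fin n) → ℝ) (w : Fin n ⊕ Fin n → ℝ) :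
    ml (vc c) w = vv c (fun i => w (Sum.inl i)) (fun i => w (Sum.inr i)) := by
  unfold vv ml
  rw [sum_sumfinset]
  simp only [Finset.mul_sum]
  rw [Finset.sum_comm (s := (univ : Finset (Fin n)))]
  apply Finset.sum_congr rfl
  intro A _
  simp only [vc, Finset.sum_mul]
  rw [Finset.sum_comm]
  apply Finset.sum_congr rfl
  intro j _
  rw [Finset.sum_eq_single {j}]
  · simp [Finset.prod_disjSum]; ring
  · intro B _ hB; simp [hB]
  · simp

lemma vc_sq {n : ℕ} (c : Finset (Fin n) → ℝ) (S : Finset (Fin n ⊕ Fin n)) :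
    vc c S ^ 2 = ∑ j, if S.toRight = {j} then dc j c S.toLeft ^ 2 else 0 := by
  unfold vc
  by_cases h : ∃ k, S.toRight = {k}
  · obtain ⟨k, hk⟩ := h
    simp only [hk, Finset.singleton_inj]
    simp
  · push Not at h
    simp [h]

lemma sum_vc_sq {n : ℕ} (c : Finset (Fin n) → ℝ) (P : Finset (Fin n ⊕ Fin n) → Prop)
    [DecidablePred P] :
    ∑ S, (if P S then vc c S ^ 2 else 0) =
      ∑ A : Finset (Fin n), ∑ j, if P (A.disjSum {j}) then dc j c A ^ 2 else 0 := by
  rw [sum_sumfinset]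
  apply Finset.sum_congr rfl
  intro A _
  simp only [vc_sq, Finset.toRight_disjSum, Finset.toLeft_disjSum]
  have : ∀ B : Finset (Fin n), (if P (A.disjSum B) then ∑ j, (if B = {j} then dc j c A ^ 2 else 0) else 0) =
      ∑ j, if B = {j} then (if P (A.disjSum {j}) then dc j c A ^ 2 else 0) else 0 := by
    intro B
    split_ifs with h
    · apply Finset.sum_congr rfl
      intro j _
      split_ifs with h1 h2 <;> first | rfl | (subst h1; contradiction)
    · symm; apply Finset.sum_eq_zero
      intro j _
      split_ifs with h1 h2 <;> first | rfl | (subst h1; contradiction)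
  simp only [this]
  rw [Finset.sum_comm]
  simp

lemma lc_deg {n d : ℕ} (c : Finset (Fin n) → ℝ) (h : DegLe d c) : DegLe d (lc c) := by
  intro S hS
  unfold lc
  split_ifs with h1
  · apply h
    rw [← Finset.card_toLeft_add_card_toRight, h1] at hS
    simpa using hS
  · rfl

lemma vc_deg {n d : ℕ} (hd : 1 ≤ d) (c : Finset (Fin n) → ℝ) (h : DegLe d c) : DegLe d (vc c) := by
  intro S hS
  unfold vc
  apply Finset.sum_eq_zero
  intro j _
  split_ifs with h1
  · apply h.dc j
    rw [← Finset.card_toLeft_add_card_toRight, h1] at hS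
    simp at hS
    omega
  · rfl

/-- influence -/
noncomputable def inf1 {n : ℕ} (c : Finset (Fin n) → ℝ) (j : Fin n) : ℝ := ∑ S, dc j c S ^ 2

lemma inf1_nonneg {n : ℕ} (c : Finset (Fin n) → ℝ) (j : Fin n) : 0 ≤ inf1 c j := by
  unfold inf1; positivity

lemma lc_inl {n : ℕ} (c : Finset (Fin n) → ℝ) (j : Fin n) :
    ∑ S, dc (Sum.inl j) (lc c) S ^ 2 = inf1 c j := by
  unfold inf1
  rw [sum_dc_sq, sum_dc_sq, sum_sumfinset]
  apply Finset.sum_congr rfl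
  intro A _
  rw [Finset.sum_eq_single ∅]
  · simp only [lc, Finset.toRight_disjSum, Finset.toLeft_disjSum, Finset.inl_mem_disjSum]; simp
  · intro B _ hB; simp [lc, hB]
  · simp

lemma lc_inr {n : ℕ} (c : Finset (Fin n) → ℝ) (j : Fin n) :
    ∑ S, dc (Sum.inr j) (lc c) S ^ 2 = 0 := by
  rw [sum_dc_sq, sum_sumfinset]
  apply Finset.sum_eq_zero
  intro A _
  apply Finset.sum_eq_zero
  intro B _
  by_cases hB : B = ∅
  · simp [hB]
  · simp [lc, hB]

lemma vc_inr {n : ℕ} (c : Finset (Fin n) → ℝ) (j : Fin n) :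
    ∑ S, dc (Sum.inr j) (vc c) S ^ 2 = inf1 c j := by
  unfold inf1
  have e := sum_vc_sq c (fun S => Sum.inr j ∈ S)
  rw [sum_dc_sq]
  refine Eq.trans (by congr!) (e.trans ?_)
  simp

lemma vc_inl {n d : ℕ} (c : Finset (Fin n) → ℝ) (h : DegLe d c) (j : Fin n) :
    ∑ S, dc (Sum.inl j) (vc c) S ^ 2 ≤ d * inf1 c j := by
  have e := sum_vc_sq c (fun S => Sum.inl j ∈ S)
  rw [sum_dc_sq]
  refine le_trans (le_of_eq (by congr!)) (e.le.trans ?_)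
  set c' : Finset (Fin n) → ℝ := fun S => if j ∈ S then c S else 0 with hc'
  have h1 : ∑ A : Finset (Fin n), ∑ k, (if Sum.inl j ∈ (A.disjSum {k} : Finset (Fin n ⊕ Fin n)) then dc k c A ^ 2 else 0)
      ≤ dsq c' := by
    rw [← sum_dc_eq_dsq, Finset.sum_comm]
    apply Finset.sum_le_sum
    intro k _
    apply Finset.sum_le_sum
    intro A _
    simp only [Finset.inl_mem_disjSum]
    split_ifs with hj
    · simp only [dc, hc']
      split_ifs with h1 h2
      · rfl
      · rfl
      · exact absurd (by simp [hj]) h2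
    · positivity
  have h2 : DegLe d c' := by
    intro S hS; simp [hc', h S hS]
  refine h1.trans ((dsq_le d c' h2).trans ?_)
  gcongr
  have h3 : vsq c' ≤ nsq c' := by rw [nsq_eq]; nlinarith [sq_nonneg (c' ∅)]
  refine h3.trans (le_of_eq ?_)
  unfold nsq inf1
  rw [sum_dc_sq]
  apply Finset.sum_congr rfl
  intro S _
  simp only [hc']; split_ifs <;> simp

lemma pi_sum_prod (n : ℕ) (ν : Measure ℝ) [IsProbabilityMeasure ν] :
    MeasurePreserving (fun z : (Fin n → ℝ) × (Fin n → ℝ) => (Sum.elim z.1 z.2 : Fin n ⊕ Fin n → ℝ))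
      ((Measure.pi (fun _ : Fin n => ν)).prod (Measure.pi (fun _ : Fin n => ν)))
      (Measure.pi (fun _ : Fin n ⊕ Fin n => ν)) := by
  have hm : Measurable (fun z : (Fin n → ℝ) × (Fin n → ℝ) => (Sum.elim z.1 z.2 : Fin n ⊕ Fin n → ℝ)) := by
    rw [measurable_pi_iff]
    rintro (i | i)
    · simp only [Sum.elim_inl]; fun_prop
    · simp only [Sum.elim_inr]; fun_prop
  refine ⟨hm, ?_⟩
  symm
  apply Measure.pi_eq
  intro s hs
  rw [Measure.map_apply hm (MeasurableSet.univ_pi hs)]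
  have : (fun z : (Fin n → ℝ) × (Fin n → ℝ) => (Sum.elim z.1 z.2 : Fin n ⊕ Fin n → ℝ)) ⁻¹' (Set.univ.pi s) =
      (Set.univ.pi (fun i => s (Sum.inl i))) ×ˢ (Set.univ.pi (fun i => s (Sum.inr i))) := by
    ext z
    simp [Set.mem_pi]
  rw [this, Measure.prod_prod, Measure.pi_pi, Measure.pi_pi, Fintype.prod_sum_type]

lemma pi_sum_integral (n : ℕ) (ν : Measure ℝ) [IsProbabilityMeasure ν] (F : (Fin n ⊕ Fin n → ℝ) → ℝ) (hF : Continuous F) :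
    ∫ w, F w ∂(Measure.pi (fun _ : Fin n ⊕ Fin n => ν)) =
    ∫ z, F (Sum.elim z.1 z.2) ∂((Measure.pi (fun _ : Fin n => ν)).prod (Measure.pi (fun _ : Fin n => ν))) := by
  have h := pi_sum_prod n ν
  rw [← h.map_eq, integral_map h.measurable.aemeasurable hF.aestronglyMeasurable]

lemma ml_smul {ι : Type*} [Fintype ι] (s : ℝ) (c : Finset ι → ℝ) (x : ι → ℝ) :
    ml (fun S => s * c S) x = s * ml c x := by
  unfold ml; rw [Finset.mul_sum]; apply Finset.sum_congr rfl; intro S _; ring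

lemma dc_smul {ι : Type*} [Fintype ι] (s : ℝ) (c : Finset ι → ℝ) (i : ι) :
    ∑ S, dc i (fun S => s * c S) S ^ 2 = s ^ 2 * ∑ S, dc i c S ^ 2 := by
  rw [Finset.mul_sum]; apply Finset.sum_congr rfl; intro S _
  unfold dc; split_ifs <;> ring

lemma invariance_sum {n d : ℕ} (hd : 1 ≤ d) (c : Finset (Fin n) → ℝ) (hc : DegLe d c) (τ : ℝ) (hτ0 : 0 ≤ τ)
    (hτ : ∀ j, inf1 c j ≤ τ) (hv : vsq c ≤ 1) (r ε : ℝ) (hε : 0 ≤ ε) (hε1 : ε ≤ 1) :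
    ∑ i, ((∑ S, dc i (fun S => r * lc c S) S ^ 2) ^ 2 + (∑ S, dc i (fun S => r * ε * vc c S) S ^ 2) ^ 2) ≤
     3 * d ^ 3 * τ * r ^ 4 := by
  rw [Fintype.sum_sum_type]
  simp only [dc_smul, lc_inl, lc_inr, vc_inr]
  have hd' : (1:ℝ) ≤ d := by exact_mod_cast hd
  have hε2 : ε ^ 2 ≤ 1 := by nlinarith
  have e4 : ε ^ 4 ≤ 1 := by nlinarith [sq_nonneg ε]
  rw [← Finset.sum_add_distrib]
  have hsum : ∑ j, inf1 c j ≤ d := by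
    have := dsq_le d c hc
    rw [← sum_dc_eq_dsq] at this
    unfold inf1
    nlinarith
  calc _ ≤ ∑ j, 3 * d ^ 2 * τ * r ^ 4 * inf1 c j := by
        apply Finset.sum_le_sum
        intro j _
        have a0 := inf1_nonneg c j
        have a1 := vc_inl c hc j
        have a2 : 0 ≤ ∑ S, dc (Sum.inl j) (vc c) S ^ 2 := by positivity
        have a3 : (∑ S, dc (Sum.inl j) (vc c) S ^ 2) ^ 2 ≤ (d * inf1 c j) ^ 2 := by gcongr
        have a4 : inf1 c j ^ 2 ≤ τ * inf1 c j := by nlinarith [hτ j]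
        have d2 : (1:ℝ) ≤ d ^ 2 := by nlinarith
        have a6 : inf1 c j ^ 2 ≤ d ^ 2 * (τ * inf1 c j) := by nlinarith [sq_nonneg (inf1 c j)]
        have a5 : (∑ S, dc (Sum.inl j) (vc c) S ^ 2) ^ 2 ≤ d ^ 2 * (τ * inf1 c j) := by nlinarith
        have r4 : 0 ≤ r ^ 4 := by positivity
        calc _ = r ^ 4 * (inf1 c j ^ 2 + ε ^ 4 * (∑ S, dc (Sum.inl j) (vc c) S ^ 2) ^ 2 + ε ^ 4 * inf1 c j ^ 2) := by ring
          _ ≤ r ^ 4 * (d ^ 2 * (τ * inf1 c j) + 1 * (d ^ 2 * (τ * inf1 c j)) + 1 * (d ^ 2 * (τ * inf1 c j))) := by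
            gcongr
          _ = _ := by ring
    _ = 3 * d ^ 2 * τ * r ^ 4 * ∑ j, inf1 c j := by rw [Finset.mul_sum]
    _ ≤ 3 * d ^ 2 * τ * r ^ 4 * d := by
        gcongr
    _ = _ := by ring

lemma tf_transfer {n : ℕ} (c : Finset (Fin n) → ℝ) (r s : ℝ) (k : Bool) (ν : Measure ℝ) [IsProbabilityMeasure ν] :
    ∫ w, tf k (ml (fun S => r * lc c S) w) (ml (fun S => s * vc c S) w) ∂(Measure.pi (fun _ : Fin n ⊕ Fin n => ν)) =
    ∫ z, tf k (r * ml c z.1) (s * vv c z.1 z.2) ∂((Measure.pi (fun _ : Fin n => ν)).prod (Measure.pi (fun _ : Fin n => ν))) := by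
  have hcont : Continuous (fun w => tf k (ml (fun S => r * lc c S) w) (ml (fun S => s * vc c S) w)) := by
    have h1 := ml_continuous (fun S => r * lc c S)
    have h2 := ml_continuous (fun S => s * vc c S)
    exact (tf_cont k).comp (h1.prodMk h2)
  refine (pi_sum_integral n ν _ hcont).trans ?_
  apply integral_congr_ae
  filter_upwards with z
  simp only [ml_smul, ml_lc, ml_vc, Sum.elim_inl, Sum.elim_inr]

lemma invariance {n d : ℕ} (hd : 1 ≤ d) (c : Finset (Fin n) → ℝ) (hc : DegLe d c) (τ : ℝ) (hτ0 : 0 ≤ τ)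
    (hτ : ∀ j, inf1 c j ≤ τ) (hv : vsq c ≤ 1) (r ε : ℝ) (hε : 0 ≤ ε) (hε1 : ε ≤ 1) (k : Bool) :
    |∫ z, tf k (r * ml c z.1) (r * ε * vv c z.1 z.2) ∂((Measure.pi (fun _ : Fin n => rad)).prod (Measure.pi (fun _ : Fin n => rad)))
    - ∫ z, tf k (r * ml c z.1) (r * ε * vv c z.1 z.2) ∂((gamn n).prod (gamn n))| ≤
     408 * 9 ^ d * (3 * d ^ 3 * τ * r ^ 4) := by
  have key := lindeberg_full rad gam good_rad good_gam k d (fun S => r * lc c S) (fun S => r * ε * vc c S)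
    (fun S hS => by simp only [lc_deg c hc S hS, mul_zero]) (fun S hS => by simp only [vc_deg hd c hc S hS, mul_zero])
  rw [tf_transfer c r (r * ε) k rad, tf_transfer c r (r * ε) k gam] at key
  refine key.trans ?_
  exact mul_le_mul_of_nonneg_left (invariance_sum hd c hc τ hτ0 hτ hv r ε hε hε1) (by positivity)

end partB4

section partE1
open MeasureTheory ProbabilityTheory

lemma num_i (d : ℕ) (hd : 1 ≤ d) (T : ℝ) (hT : 0 < T) (hT1 : 9 * (d:ℝ) ^ 4 * T < 1) :
    (d:ℝ) ^ 2 * √d * T ^ (7 * (d:ℝ) / (4 * d + 2)) ≤ 243 * T := by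
  have hd' : (1:ℝ) ≤ d := by exact_mod_cast hd
  have hd4 : (1:ℝ) ≤ (d:ℝ) ^ 4 := one_le_pow₀ hd'
  have hTle : T ≤ 1 := by nlinarith
  rcases Nat.lt_or_ge d 10 with h | h
  · have hd9 : (d:ℝ) ≤ 9 := by exact_mod_cast (by omega : d ≤ 9)
    have h1 : √(d:ℝ) ≤ 3 := by
      rw [Real.sqrt_le_left (by norm_num)]; linarith
    have h2 : T ^ (7 * (d:ℝ) / (4 * d + 2)) ≤ T := by
      calc _ ≤ T ^ (1:ℝ) := by
            apply Real.rpow_le_rpow_of_exponent_ge hT hTle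
            rw [le_div_iff₀ (by positivity)]; linarith
        _ = T := Real.rpow_one T
    have h3 : (d:ℝ) ^ 2 ≤ 81 := by nlinarith
    calc _ ≤ 81 * 3 * T := by gcongr
      _ = _ := by ring
  · have hd10 : (10:ℝ) ≤ d := by exact_mod_cast h
    have h2 : T ^ (7 * (d:ℝ) / (4 * d + 2)) ≤ T ^ ((5/3 : ℝ)) := by
      apply Real.rpow_le_rpow_of_exponent_ge hT hTle
      rw [le_div_iff₀ (by positivity)]; linarith
    have h4 : (d:ℝ) ^ 2 * √d = ((d:ℝ) ^ 4) ^ (5/8 : ℝ) := by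
      rw [Real.sqrt_eq_rpow, ← Real.rpow_natCast, ← Real.rpow_add (by positivity), ← Real.rpow_natCast,
        ← Real.rpow_mul (by positivity)]
      norm_num
    have h5 : ((d:ℝ) ^ 4) ^ (5/8 : ℝ) ≤ T ^ (-(5/8 : ℝ)) := by
      rw [Real.rpow_neg hT.le, ← Real.inv_rpow hT.le]
      apply Real.rpow_le_rpow (by positivity) _ (by norm_num)
      rw [le_inv_comm₀ (by positivity) hT, ← one_div, le_div_iff₀ (by positivity)]
      nlinarith
    calc _ ≤ T ^ (-(5/8 : ℝ)) * T ^ ((5/3 : ℝ)) := by rw [h4]; gcongr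
      _ = T ^ (25/24 : ℝ) := by rw [← Real.rpow_add hT]; norm_num
      _ ≤ T ^ (1:ℝ) := Real.rpow_le_rpow_of_exponent_ge hT hTle (by norm_num)
      _ = T := Real.rpow_one T
      _ ≤ _ := by linarith

lemma num_ii (d : ℕ) (hd : 1 ≤ d) (T : ℝ) (hT : 0 < T) (hT1 : 9 * (d:ℝ) ^ 4 * T < 1) :
    (d:ℝ) ^ 2 * (9 ^ d * T ^ d) ≤ 9 * T := by
  have hd' : (1:ℝ) ≤ d := by exact_mod_cast hd
  obtain ⟨k, rfl⟩ : ∃ k, d = k + 1 := ⟨d - 1, by omega⟩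
  rw [← mul_pow]
  have h0 : (1:ℝ) ≤ ((k+1 : ℕ):ℝ) ^ 4 := one_le_pow₀ hd'
  rcases k with _ | k
  · simp
  · have h1 : (9 * T) ^ (k + 1) ≤ 9 * T := by
      apply pow_le_of_le_one (by positivity) _ (by omega)
      nlinarith
    have h2 : ((k + 1 + 1 : ℕ):ℝ) ^ 2 ≤ ((k+1+1 : ℕ):ℝ) ^ 4 := pow_le_pow_right₀ hd' (by norm_num)
    rw [pow_succ (9 * T) (k + 1)]
    calc _ ≤ ((k+1+1 : ℕ):ℝ) ^ 4 * ((9 * T) * (9 * T)) := by gcongr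
      _ ≤ _ := by nlinarith

lemma Phi_le_tf (ε r u v : ℝ) (hr : 0 < r) :
    Phi ε u v ≤ tf true (r * u) (r * ε * v) + tf false (r * u) (r * ε * v) := by
  unfold Phi tf
  simp only [if_true, Bool.false_eq_true, if_false]
  rw [← add_div]
  by_cases h : u ^ 2 + ε ^ 2 * v ^ 2 = 0
  · rw [h]; simp; positivity
  have hp : 0 < u ^ 2 + ε ^ 2 * v ^ 2 := lt_of_le_of_ne (by positivity) (Ne.symm h)
  rw [div_le_div_iff₀ hp (by positivity)]
  nlinarith [sq_nonneg u]

lemma tf_true_le (ε r u v : ℝ) (hr : 0 < r) : tf true (r * u) (r * ε * v) ≤ Phi ε u v := by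
  unfold Phi tf
  simp only [if_true]
  by_cases h : u ^ 2 + ε ^ 2 * v ^ 2 = 0
  · have : (r * ε * v) ^ 2 = 0 := by
      have : ε ^ 2 * v ^ 2 = 0 := by nlinarith [sq_nonneg u, sq_nonneg (ε * v)]
      calc _ = r ^ 2 * (ε ^ 2 * v ^ 2) := by ring
        _ = 0 := by rw [this, mul_zero]
    rw [h, this]; simp
  have hp : 0 < u ^ 2 + ε ^ 2 * v ^ 2 := lt_of_le_of_ne (by positivity) (Ne.symm h)
  rw [div_le_div_iff₀ (by positivity) hp]
  nlinarith [sq_nonneg (ε * v)]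

lemma tf_false_le (ε r u v : ℝ) (hr : 0 < r) (b : ℝ) (hb : 1 / r ^ 2 ≤ b) :
    tf false (r * u) (r * ε * v) ≤ b / (b + u ^ 2) := by
  unfold tf
  simp only [Bool.false_eq_true, if_false]
  rw [div_le_iff₀ (by positivity)] at hb
  have hb0 : 0 < b := by
    by_contra hh
    push Not at hh
    nlinarith [sq_nonneg r]
  rw [div_le_div_iff₀ (by positivity) (by positivity)]
  have : u ^ 2 ≤ b * r ^ 2 * u ^ 2 := by nlinarith [sq_nonneg u]
  nlinarith [mul_nonneg hb0.le (sq_nonneg (r * ε * v)), sq_nonneg (r * ε * v)]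

end partE1

section partE2
open MeasureTheory ProbabilityTheory

/-- Rademacher product. -/
noncomputable abbrev radn (n : ℕ) : Measure (Fin n → ℝ) := Measure.pi (fun _ : Fin n => rad)

/-- Expectation of Phi. -/
noncomputable def EP {n : ℕ} (μ : Measure ((Fin n → ℝ) × (Fin n → ℝ))) (ε : ℝ) (c : Finset (Fin n) → ℝ) : ℝ :=
  ∫ z, Phi ε (ml c z.1) (vv c z.1 z.2) ∂μ

/-- Expectation of tf. -/
noncomputable def ET {n : ℕ} (μ : Measure ((Fin n → ℝ) × (Fin n → ℝ))) (k : Bool) (r ε : ℝ) (c : Finset (Fin n) → ℝ) : ℝ :=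
  ∫ z, tf k (r * ml c z.1) (r * ε * vv c z.1 z.2) ∂μ

lemma ET_integrable {n : ℕ} (μ : Measure ((Fin n → ℝ) × (Fin n → ℝ))) [IsProbabilityMeasure μ] (k : Bool)
    (r ε : ℝ) (c : Finset (Fin n) → ℝ) :
    Integrable (fun z => tf k (r * ml c z.1) (r * ε * vv c z.1 z.2)) μ := by
  have h1 : Continuous (fun z : (Fin n → ℝ) × (Fin n → ℝ) => r * ml c z.1) :=
    continuous_const.mul ((ml_continuous c).comp continuous_fst)
  have h2 : Continuous (fun z : (Fin n → ℝ) × (Fin n → ℝ) => r * ε * vv c z.1 z.2) :=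
    continuous_const.mul (vv_continuous c)
  apply Integrable.of_bound ((tf_cont k).comp (h1.prodMk h2)).aestronglyMeasurable 1
  filter_upwards with x
  change ‖tf k (r * ml c x.1) (r * ε * vv c x.1 x.2)‖ ≤ 1
  rw [Real.norm_of_nonneg (tf_nonneg _ _ _)]
  exact tf_le_one _ _ _

lemma EP_nonneg {n : ℕ} (μ : Measure ((Fin n → ℝ) × (Fin n → ℝ))) (ε : ℝ) (c : Finset (Fin n) → ℝ) :
    0 ≤ EP μ ε c := integral_nonneg (fun _ => Phi_nonneg _ _ _)

lemma EP_le_one {n : ℕ} (μ : Measure ((Fin n → ℝ) × (Fin n → ℝ))) [IsProbabilityMeasure μ] (ε : ℝ) (c : Finset (Fin n) → ℝ) :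
    EP μ ε c ≤ 1 := by
  have := integral_mono (Phi_vv_integrable μ c ε) (integrable_const (1:ℝ)) (fun z => Phi_le_one _ _ _)
  simpa [EP] using this

lemma EP_le_ET {n : ℕ} (μ : Measure ((Fin n → ℝ) × (Fin n → ℝ))) [IsProbabilityMeasure μ] (r ε : ℝ) (hr : 0 < r)
    (c : Finset (Fin n) → ℝ) : EP μ ε c ≤ ET μ true r ε c + ET μ false r ε c := by
  unfold EP ET
  rw [← integral_add (ET_integrable μ _ r ε c) (ET_integrable μ _ r ε c)]
  exact integral_mono (Phi_vv_integrable μ c ε) ((ET_integrable μ _ r ε c).add (ET_integrable μ _ r ε c))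
    (fun z => Phi_le_tf ε r _ _ hr)

lemma ET_le_EP {n : ℕ} (μ : Measure ((Fin n → ℝ) × (Fin n → ℝ))) [IsProbabilityMeasure μ] (r ε : ℝ) (hr : 0 < r)
    (c : Finset (Fin n) → ℝ) : ET μ true r ε c ≤ EP μ ε c :=
  integral_mono (ET_integrable μ _ r ε c) (Phi_vv_integrable μ c ε) (fun z => tf_true_le ε r _ _ hr)

lemma ET_le_Lam {n : ℕ} (r ε : ℝ) (hr : 0 < r) (b : ℝ) (hb0 : 0 < b) (hb : 1 / r ^ 2 ≤ b)
    (c : Finset (Fin n) → ℝ) : ET ((gamn n).prod (gamn n)) false r ε c ≤ Lam b c := by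
  have hi : Integrable (fun z : (Fin n → ℝ) × (Fin n → ℝ) => b / (b + ml c z.1 ^ 2)) ((gamn n).prod (gamn n)) :=
    (Lam_integrable b hb0 c).comp_fst (gamn n)
  have := integral_mono (ET_integrable ((gamn n).prod (gamn n)) false r ε c) hi
    (fun z => tf_false_le ε r _ _ hr b hb)
  refine this.trans (le_of_eq ?_)
  unfold Lam
  have := integral_fun_fst (μ := gamn n) (ν := gamn n) (fun x => b / (b + ml c x ^ 2))
  simpa using this

set_option maxHeartbeats 1000000 in
lemma main_norm : ∃ C : ℝ, 0 < C ∧ ∀ (n d : ℕ) (_ : 1 ≤ d) (c : Finset (Fin n) → ℝ) (_ : DegLe d c)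
    (T : ℝ) (_ : 0 < T) (_ : vsq c = 1) (_ : ∀ j, inf1 c j ≤ T ^ (8 * d)) (ε : ℝ) (_ : 0 < ε) (_ : ε ≤ 1),
    EP ((radn n).prod (radn n)) ε c ≤ C * (d ^ 3 * ε * EP ((radn n).prod (radn n)) 1 c + d ^ 4 * T) := by
  obtain ⟨C, hC, hG⟩ := gauss_main
  obtain ⟨K, hK, hL⟩ := carbery_wright
  refine ⟨C + 9 + (C + 2) * (243 * K + 408 * 3 * 9), by positivity, ?_⟩
  intro n d hd c hc T hT hv hinf ε hε hε1
  have hd' : (1:ℝ) ≤ d := by exact_mod_cast hd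
  have hd4 : (1:ℝ) ≤ (d:ℝ) ^ 4 := one_le_pow₀ hd'
  set R := (radn n).prod (radn n) with hR
  set G := (gamn n).prod (gamn n) with hGG
  have hR1 := EP_nonneg R 1 c
  have hmain0 : 0 ≤ (d:ℝ) ^ 3 * ε * EP R 1 c := by positivity
  have hdT : 0 < (d:ℝ) ^ 4 * T := by positivity
  have hCC : 0 ≤ (C + 2) * (243 * K + 408 * 3 * 9) := by positivity
  by_cases hbig : 1 ≤ 9 * (d:ℝ) ^ 4 * T
  · refine (EP_le_one R ε c).trans ?_
    have : 9 * ((d:ℝ) ^ 4 * T) ≤ (C + 9 + (C + 2) * (243 * K + 408 * 3 * 9)) * (d ^ 3 * ε * EP R 1 c + d ^ 4 * T) := by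
      apply mul_le_mul <;> nlinarith
    linarith
  push Not at hbig
  set η := T ^ (7 * (d:ℝ) / (4 * d + 2)) with hη
  have hη0 : 0 < η := Real.rpow_pos_of_pos hT _
  have hη2 : η ^ (4 * d + 2) = T ^ (7 * d) := by
    rw [hη, ← Real.rpow_natCast, ← Real.rpow_mul hT.le, ← Real.rpow_natCast]
    congr 1
    push_cast
    field_simp
  set r := 1 / √(η ^ (2 * d + 1)) with hr
  have hr0 : 0 < r := by positivity
  have hr2 : 1 / r ^ 2 = η ^ (2 * d + 1) := by
    rw [hr, div_pow, one_pow, one_div_one_div, Real.sq_sqrt (by positivity)]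
  have hr4 : T ^ (8 * d) * r ^ 4 = T ^ d := by
    have h1 : r ^ 4 = 1 / T ^ (7 * d) := by
      rw [← hη2, hr, div_pow, one_pow, show (4:ℕ) = 2 * 2 from rfl, pow_mul, Real.sq_sqrt (by positivity), ← pow_mul]
      congr 2; ring
    rw [h1, show 8 * d = d + 7 * d by ring, pow_add]
    field_simp
  have hns : 1 ≤ nsq c := by rw [nsq_eq, hv]; nlinarith [sq_nonneg (c ∅)]
  set L := Lam (nsq c * η ^ (2 * d + 1)) c with hLdef
  have hLb := hL d hd n c hc (by linarith) η hη0
  have hL0 : 0 ≤ L := Lam_nonneg _ (by positivity) _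
  set err := 408 * 9 ^ d * (3 * (d:ℝ) ^ 3 * T ^ (8 * d) * r ^ 4) with herr
  have herr' : err = 408 * 3 * d ^ 3 * (9 ^ d * T ^ d) := by
    rw [herr, ← hr4]; ring
  have herr0 : 0 ≤ err := by positivity
  have hetL : ∀ e, ET G false r e c ≤ L := by
    intro e
    apply ET_le_Lam r e hr0 _ (by positivity)
    rw [hr2]
    nlinarith [pow_pos hη0 (2 * d + 1)]
  have hinv : ∀ k e, 0 ≤ e → e ≤ 1 → |ET R k r e c - ET G k r e c| ≤ err := by
    intro k e h0 h1
    exact invariance hd c hc _ (by positivity) hinf hv.le r e h0 h1 k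
  have s1 : EP R ε c ≤ EP G ε c + L + 2 * err := by
    have a1 := EP_le_ET R r ε hr0 c
    have a2 := abs_le.1 (hinv true ε hε.le hε1)
    have a3 := abs_le.1 (hinv false ε hε.le hε1)
    have a4 := ET_le_EP G r ε hr0 c
    have a5 := hetL ε
    linarith [a2.2, a3.2]
  have s2 : EP G 1 c ≤ EP R 1 c + L + err := by
    have a1 := EP_le_ET G r 1 hr0 c
    have a2 := abs_le.1 (hinv true 1 zero_le_one le_rfl)
    have a4 := ET_le_EP R r 1 hr0 c
    have a5 := hetL 1
    linarith [a2.1]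
  have s3 : EP G ε c ≤ C * (d ^ 2 * √d) * ε * EP G 1 c := hG n d hd c hc ε hε hε1
  have hsd : √(d:ℝ) ≤ d := by
    rw [Real.sqrt_le_left (by positivity)]; nlinarith
  have hsd1 : 1 ≤ √(d:ℝ) := by rw [Real.one_le_sqrt]; exact hd'
  set X := (d:ℝ) ^ 2 * √d with hX
  have hX3 : X ≤ d ^ 3 := by rw [hX, pow_succ (d:ℝ) 2]; gcongr
  have hX1 : 1 ≤ X := by rw [hX]; nlinarith
  have n1 : X * L ≤ 243 * K * (d ^ 4 * T) := by
    have := num_i d hd T hT hbig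
    calc X * L ≤ X * (K * d ^ 4 * η) := by gcongr
      _ = K * d ^ 4 * (X * η) := by ring
      _ ≤ K * d ^ 4 * (243 * T) := by gcongr
      _ = _ := by ring
  have n2 : X * err ≤ 408 * 3 * 9 * (d ^ 4 * T) := by
    have := num_ii d hd T hT hbig
    calc X * err ≤ d ^ 3 * err := by gcongr
      _ = 408 * 3 * d ^ 4 * (d ^ 2 * (9 ^ d * T ^ d)) := by rw [herr']; ring
      _ ≤ 408 * 3 * d ^ 4 * (9 * T) := by gcongr
      _ = _ := by ring
  have s4 : EP G ε c ≤ C * (d ^ 3 * ε * EP R 1 c) + C * (X * L + X * err) := by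
    calc EP G ε c ≤ C * X * ε * EP G 1 c := s3
      _ ≤ C * X * ε * (EP R 1 c + L + err) := by gcongr
      _ = C * (X * ε * EP R 1 c) + ε * (C * (X * L + X * err)) := by ring
      _ ≤ C * (d ^ 3 * ε * EP R 1 c) + 1 * (C * (X * L + X * err)) := by gcongr
      _ = _ := by ring
  have s5 : L ≤ X * L := le_mul_of_one_le_left hL0 hX1
  have s6 : err ≤ X * err := le_mul_of_one_le_left herr0 hX1
  have s7 : EP R ε c ≤ C * (d ^ 3 * ε * EP R 1 c) + (C + 2) * (X * L + X * err) := by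
    have : (C + 2) * (X * L + X * err) = C * (X * L + X * err) + 2 * (X * L + X * err) := by ring
    linarith
  have s8 : (C + 2) * (X * L + X * err) ≤ (C + 2) * (243 * K + 408 * 3 * 9) * (d ^ 4 * T) := by
    calc (C + 2) * (X * L + X * err) ≤ (C + 2) * (243 * K * (d ^ 4 * T) + 408 * 3 * 9 * (d ^ 4 * T)) := by gcongr
      _ = _ := by ring
  have s9 : (C + 9 + (C + 2) * (243 * K + 408 * 3 * 9)) * (d ^ 3 * ε * EP R 1 c + d ^ 4 * T) =
    C * (d ^ 3 * ε * EP R 1 c) + (C + 2) * (243 * K + 408 * 3 * 9) * (d ^ 4 * T) + 9 * (d ^ 3 * ε * EP R 1 c) +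
      ((C + 2) * (243 * K + 408 * 3 * 9)) * (d ^ 3 * ε * EP R 1 c) + (C + 9) * (d ^ 4 * T) := by ring
  have s10 : 0 ≤ ((C + 2) * (243 * K + 408 * 3 * 9)) * (d ^ 3 * ε * EP R 1 c) := mul_nonneg hCC hmain0
  have s11 : 0 ≤ (C + 9) * (d ^ 4 * T) := by positivity
  linarith

lemma EP_smul {n : ℕ} (μ : Measure ((Fin n → ℝ) × (Fin n → ℝ))) (ε s : ℝ) (hs : s ≠ 0) (c : Finset (Fin n) → ℝ) :
    EP μ ε (fun S => s * c S) = EP μ ε c := by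
  unfold EP
  congr 1
  ext z
  have h1 : vv (fun S => s * c S) z.1 z.2 = s * vv c z.1 z.2 := by
    unfold vv
    rw [Finset.mul_sum]
    apply Finset.sum_congr rfl
    intro j _
    have : dc j (fun S => s * c S) = fun S => s * dc j c S := by
      ext S; unfold dc; split_ifs <;> simp
    rw [this, ml_smul]; ring
  rw [h1, ml_smul]
  unfold Phi
  have : (s ^ 2) ≠ 0 := by positivity
  rw [← mul_div_mul_left (ε ^ 2 * vv c z.1 z.2 ^ 2) _ this]
  congr 1 <;> ring

lemma main_M : ∃ C : ℝ, 0 < C ∧ ∀ (n d : ℕ) (_ : 1 ≤ d) (c : Finset (Fin n) → ℝ) (_ : DegLe d c)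
    (τ : ℝ) (_ : 0 < τ) (_ : ∀ j, inf1 c j ≤ τ * vsq c) (ε : ℝ) (_ : 0 < ε) (_ : ε ≤ 1),
    EP ((radn n).prod (radn n)) ε c ≤
      C * (d ^ 3 * ε * EP ((radn n).prod (radn n)) 1 c + d ^ 4 * τ ^ (1 / (8 * (d:ℝ)))) := by
  obtain ⟨C, hC, hN⟩ := main_norm
  refine ⟨C, hC, ?_⟩
  intro n d hd c hc τ hτ hinf ε hε hε1
  rcases (vsq_nonneg c).eq_or_lt with h0 | h0
  · have hz : EP ((radn n).prod (radn n)) ε c = 0 := by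
      have h1 := dsq_le d c hc
      rw [← h0, mul_zero, ← sum_dc_eq_dsq] at h1
      have h2 : ∑ j, ∑ T, dc j c T ^ 2 = 0 := le_antisymm h1 (by positivity)
      have h3 : ∀ j T, dc j c T = 0 := by
        intro j T
        have := (Finset.sum_eq_zero_iff_of_nonneg (fun j _ => by positivity)).1 h2 j (Finset.mem_univ j)
        have := (Finset.sum_eq_zero_iff_of_nonneg (fun j _ => by positivity)).1 this T (Finset.mem_univ T)
        exact pow_eq_zero_iff (two_ne_zero) |>.1 this
      have h4 : ∀ x y, vv c x y = 0 := by
        intro x y; simp [vv, ml, h3]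
      unfold EP
      simp [h4, Phi]
    rw [hz]
    have := EP_nonneg ((radn n).prod (radn n)) 1 c
    positivity
  · set s := 1 / √(vsq c) with hs
    have hs0 : 0 < s := by positivity
    have hs2 : s ^ 2 * vsq c = 1 := by
      rw [hs, div_pow, one_pow, Real.sq_sqrt h0.le]; field_simp
    have hT0 : 0 < τ ^ (1 / (8 * (d:ℝ))) := Real.rpow_pos_of_pos hτ _
    have hTT : (τ ^ (1 / (8 * (d:ℝ)))) ^ (8 * d) = τ := by
      rw [← Real.rpow_natCast, ← Real.rpow_mul hτ.le]
      have : 1 / (8 * (d:ℝ)) * ((8 * d : ℕ):ℝ) = 1 := by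
        have : (d:ℝ) ≠ 0 := by positivity
        push_cast; field_simp
      rw [this, Real.rpow_one]
    have := hN n d hd (fun S => s * c S) (fun S hS => by simp only [hc S hS, mul_zero]) _ hT0 ?_ ?_ ε hε hε1
    · rwa [EP_smul _ _ _ hs0.ne', EP_smul _ _ _ hs0.ne'] at this
    · rw [← hs2]
      unfold vsq nsq nc
      rw [Finset.mul_sum]
      apply Finset.sum_congr rfl
      intro S _
      split_ifs <;> ring
    · intro j
      rw [hTT]
      unfold inf1
      rw [dc_smul]
      have := hinf j
      unfold inf1 at this
      calc _ ≤ s ^ 2 * (τ * vsq c) := by gcongr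
        _ = τ * (s ^ 2 * vsq c) := by ring
        _ = τ := by rw [hs2, mul_one]

end partE2

section partF1
open MeasureTheory ProbabilityTheory

/-- indicator exponent vector -/
noncomputable def ind {n : ℕ} (S : Finset (Fin n)) : Fin n →₀ ℕ :=
  Finsupp.equivFunOnFinite.symm (fun i => if i ∈ S then 1 else 0)

lemma ind_apply {n : ℕ} (S : Finset (Fin n)) (i : Fin n) : ind S i = if i ∈ S then 1 else 0 := rfl

lemma ind_inj {n : ℕ} : Function.Injective (ind : Finset (Fin n) → _) := by
  intro S T h
  ext i
  have := DFunLike.congr_fun h i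
  rw [ind_apply, ind_apply] at this
  by_cases h1 : i ∈ S <;> by_cases h2 : i ∈ T <;> simp_all

lemma ind_support {n : ℕ} (m : Fin n →₀ ℕ) (h : ∀ i, m i ≤ 1) : ind m.support = m := by
  ext i
  rw [ind_apply]
  have := h i
  split_ifs with h1
  · rw [Finsupp.mem_support_iff] at h1; omega
  · rw [Finsupp.notMem_support_iff] at h1; omega

lemma ind_sum {n : ℕ} (S : Finset (Fin n)) : ∑ i ∈ (ind S).support, ind S i = S.card := by
  have : (ind S).support = S := by
    ext i; rw [Finsupp.mem_support_iff, ind_apply]; simp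
  rw [this]
  simp only [ind_apply]
  simp

/-- coefficients of a polynomial -/
noncomputable def cf {n : ℕ} (p : MvPolynomial (Fin n) ℝ) : Finset (Fin n) → ℝ := fun S => p.coeff (ind S)

/-- polynomial with given coefficients -/
noncomputable def mkp {n : ℕ} (c : Finset (Fin n) → ℝ) : MvPolynomial (Fin n) ℝ :=
  ∑ S, MvPolynomial.monomial (ind S) (c S)

lemma prod_ind {n : ℕ} (S : Finset (Fin n)) (x : Fin n → ℝ) : ∏ i, x i ^ (ind S i) = ∏ i ∈ S, x i := by
  simp only [ind_apply]
  rw [← Finset.prod_filter_mul_prod_filter_not univ (fun i => i ∈ S)]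
  rw [Finset.prod_congr (s₁ := univ.filter (fun i => i ∉ S)) (g := fun _ => (1:ℝ)) rfl (by intro i hi; simp at hi; simp [hi]),
    Finset.prod_congr (s₂ := S) (g := x) (by ext; simp) (by intro i hi; simp [hi])]
  simp

lemma eval_cf {n : ℕ} (p : MvPolynomial (Fin n) ℝ) (hp : ∀ m ∈ p.support, ∀ i, m i ≤ 1) (x : Fin n → ℝ) :
    MvPolynomial.eval x p = ml (cf p) x := by
  rw [MvPolynomial.eval_eq']
  unfold ml cf
  have : ∑ S : Finset (Fin n), p.coeff (ind S) * ∏ i ∈ S, x i =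
      ∑ m ∈ univ.image (ind : Finset (Fin n) → _), p.coeff m * ∏ i, x i ^ m i := by
    rw [Finset.sum_image (fun a _ b _ h => ind_inj h)]
    apply Finset.sum_congr rfl
    intro S _
    rw [prod_ind]
  rw [this]
  apply Finset.sum_subset
  · intro m hm
    rw [Finset.mem_image]
    exact ⟨m.support, Finset.mem_univ _, ind_support m (hp m hm)⟩
  · intro m _ hm
    rw [MvPolynomial.notMem_support_iff.1 hm, zero_mul]

lemma pev_cf {n : ℕ} (p : MvPolynomial (Fin n) ℝ) (hp : ∀ m ∈ p.support, ∀ i, m i ≤ 1) (x : Fin n → Bool) :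
    pev p x = ml (cf p) (fun i => chi (x i)) := eval_cf p hp _

lemma cf_deg {n d : ℕ} (p : MvPolynomial (Fin n) ℝ) (h : p.totalDegree ≤ d) : DegLe d (cf p) := by
  intro S hS
  apply MvPolynomial.coeff_eq_zero_of_totalDegree_lt
  rw [ind_sum]; omega

lemma mkp_support {n : ℕ} (c : Finset (Fin n) → ℝ) : ∀ m ∈ (mkp c).support, ∀ i, m i ≤ 1 := by
  intro m hm i
  have := MvPolynomial.support_sum hm
  rw [Finset.mem_biUnion] at this
  obtain ⟨S, _, hS⟩ := this
  have := MvPolynomial.support_monomial_subset hS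
  rw [Finset.mem_singleton] at this
  rw [this, ind_apply]; split_ifs <;> simp

lemma mkp_deg {n d : ℕ} (c : Finset (Fin n) → ℝ) (h : DegLe d c) : (mkp c).totalDegree ≤ d := by
  apply MvPolynomial.totalDegree_finsetSum_le
  intro S _
  by_cases hS : d < S.card
  · rw [h S hS]; simp
  · refine (MvPolynomial.totalDegree_monomial_le _ _).trans ?_
    have := ind_sum S
    simp only [Finsupp.sum, id]
    rw [this]; omega

lemma mkp_pev {n : ℕ} (c : Finset (Fin n) → ℝ) (x : Fin n → Bool) :
    pev (mkp c) x = ml c (fun i => chi (x i)) := by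
  unfold pev mkp ml
  rw [map_sum]
  apply Finset.sum_congr rfl
  intro S _
  rw [MvPolynomial.eval_monomial, Finsupp.prod_fintype _ _ (by simp), prod_ind]

lemma chi_not (b : Bool) : chi (!b) = - chi b := by cases b <;> simp [chi]
lemma chi_sq (b : Bool) : chi b ^ 2 = 1 := by cases b <;> simp [chi]
lemma chi_mul (a b : Bool) : chi (a == b) = chi a * chi b := by cases a <;> cases b <;> simp [chi]

lemma chi_flip {n : ℕ} (x : Fin n → Bool) (j : Fin n) :
    (fun i => chi (flipAt x j i)) = Function.update (fun i => chi (x i)) j (- chi (x j)) := by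
  ext i
  unfold flipAt
  by_cases h : i = j
  · subst h; simp [chi_not]
  · simp [Function.update_of_ne h]

lemma ml_flip {n : ℕ} (c : Finset (Fin n) → ℝ) (x : Fin n → Bool) (j : Fin n) :
    (ml c (fun i => chi (x i)) - ml c (fun i => chi (flipAt x j i))) / 2 =
      chi (x j) * ml (dc j c) (fun i => chi (x i)) := by
  have h := ml_update j c (fun i => chi (x i)) (- chi (x j))
  have h2 : ml c (Function.update (fun i => chi (x i)) j (- chi (x j))) =
    ml (rc j c) (fun i => chi (x i)) + (- chi (x j)) * ml (dc j c) (fun i => chi (x i)) := by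
    rw [← h]; congr!
  rw [chi_flip, h2, ml_split j c]; ring

lemma integral_radn {n : ℕ} (F : (Fin n → ℝ) → ℝ) (hF : Measurable F) :
    ∫ x, F x ∂(radn n) = (∑ x : Fin n → Bool, F (fun i => chi (x i))) / 2 ^ n := by
  rw [integral_rad_pi F hF, Fintype.card_fin]
  congr!

lemma ml_second_sum {n : ℕ} (c : Finset (Fin n) → ℝ) :
    (∑ x : Fin n → Bool, ml c (fun i => chi (x i)) ^ 2) / 2 ^ n = ∑ S, c S ^ 2 := by
  have h := ml_second (fun _ : Fin n => rad) (fun _ => good_rad) c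
  have hF : Continuous (fun x => ml c x ^ 2) := (ml_continuous c).pow 2
  rw [integral_radn _ hF.measurable] at h
  exact h

lemma ml_fourth_sum {n : ℕ} (d : ℕ) (c : Finset (Fin n) → ℝ) (hd : DegLe d c) :
    (∑ x : Fin n → Bool, ml c (fun i => chi (x i)) ^ 4) / 2 ^ n ≤ 9 ^ d * (∑ S, c S ^ 2) ^ 2 := by
  have h := ml_fourth (fun _ : Fin n => rad) (fun _ => good_rad) d c hd
  have hF : Continuous (fun x => ml c x ^ 4) := (ml_continuous c).pow 4
  rw [integral_radn _ hF.measurable] at h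
  exact h

lemma ml_first_sum {n : ℕ} (c : Finset (Fin n) → ℝ) :
    (∑ x : Fin n → Bool, ml c (fun i => chi (x i))) / 2 ^ n = c ∅ := by
  have h1 := ml_second_sum c
  have h2 := ml_second_sum (fun S => c S + if S = ∅ then 1 else 0)
  have h3 : ∀ x, ml (fun S => c S + if S = ∅ then 1 else 0) x = ml c x + 1 := by
    intro x
    unfold ml
    simp [add_mul, Finset.sum_add_distrib]
  simp only [h3, add_sq] at h2
  rw [Finset.sum_add_distrib, Finset.sum_add_distrib, Finset.sum_add_distrib, Finset.sum_add_distrib, add_div, add_div, h1] at h2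
  simp at h2
  rw [← Finset.mul_sum] at h2
  rw [mul_div_assoc] at h2
  linarith

lemma pInf_eq {n : ℕ} (p : MvPolynomial (Fin n) ℝ) (hp : ∀ m ∈ p.support, ∀ i, m i ≤ 1) (j : Fin n) :
    pInf p j = inf1 (cf p) j := by
  unfold pInf inf1
  rw [← ml_second_sum]
  congr 1
  apply Finset.sum_congr rfl
  intro x _
  rw [pev_cf p hp, pev_cf p hp, ml_flip, mul_pow, chi_sq, one_mul]

lemma pVar_eq {n : ℕ} (p : MvPolynomial (Fin n) ℝ) (hp : ∀ m ∈ p.support, ∀ i, m i ≤ 1) :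
    pVar p = vsq (cf p) := by
  unfold pVar
  simp only [pev_cf p hp]
  rw [ml_second_sum, ml_first_sum]
  have := nsq_eq (cf p)
  unfold nsq at this
  rw [this]; ring

/-- `D_B p (A)`. -/
noncomputable def DB {n : ℕ} (p : MvPolynomial (Fin n) ℝ) (A B : Fin n → Bool) : ℝ :=
  ∑ j, chi (B j) * ((pev p A - pev p (flipAt A j)) / 2)

lemma integral_radn2 {n : ℕ} (F : (Fin n → ℝ) × (Fin n → ℝ) → ℝ) (hF : Measurable F)
    (hI : Integrable F ((radn n).prod (radn n))) :
    ∫ z, F z ∂((radn n).prod (radn n)) =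
      (∑ A : Fin n → Bool, ∑ B : Fin n → Bool, F (fun i => chi (A i), fun i => chi (B i))) / (2 ^ n * 2 ^ n) := by
  rw [integral_prod _ hI]
  have h1 : ∀ x, ∫ y, F (x, y) ∂(radn n) = (∑ B : Fin n → Bool, F (x, fun i => chi (B i))) / 2 ^ n := by
    intro x
    exact integral_radn (fun y => F (x, y)) (hF.comp measurable_prodMk_left)
  simp only [h1]
  have h2 := integral_radn (fun x => (∑ B : Fin n → Bool, F (x, fun i => chi (B i))) / 2 ^ n)
    ((Finset.measurable_sum _ (fun B _ => hF.comp (measurable_id.prodMk measurable_const))).div_const _)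
  rw [h2, ← Finset.sum_div, div_div]

lemma EP_eq {n : ℕ} (p : MvPolynomial (Fin n) ℝ) (hp : ∀ m ∈ p.support, ∀ i, m i ≤ 1) (ε : ℝ) :
    EP ((radn n).prod (radn n)) ε (cf p) =
      (∑ A : Fin n → Bool, ∑ B : Fin n → Bool, Phi ε (pev p A) (DB p A B)) / (2 ^ n * 2 ^ n) := by
  unfold EP
  have hm : Measurable (fun z : (Fin n → ℝ) × (Fin n → ℝ) => Phi ε (ml (cf p) z.1) (vv (cf p) z.1 z.2)) :=
    by exact (Phi_measurable ε).comp (((ml_continuous (cf p)).measurable.comp measurable_fst).prodMk (vv_continuous (cf p)).measurable)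
  have h3 := Phi_vv_integrable ((radn n).prod (radn n)) (cf p) ε
  rw [integral_radn2 _ hm h3]
  congr 1
  apply Finset.sum_congr rfl
  intro A _
  have hinv : Function.Involutive (fun (B : Fin n → Bool) => (fun j => B j == A j)) := by
    intro B; ext j; simp only; cases B j <;> cases A j <;> rfl
  rw [← Equiv.sum_comp hinv.toPerm]
  apply Finset.sum_congr rfl
  intro B _
  rw [pev_cf p hp]
  congr 1
  unfold vv DB
  apply Finset.sum_congr rfl
  intro j _
  rw [pev_cf p hp, pev_cf p hp, ml_flip]
  simp only [Function.Involutive.coe_toPerm, chi_mul]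
  ring

end partF1

section partF2
open MeasureTheory ProbabilityTheory

/-- linear form coefficients -/
noncomputable def lcf {n : ℕ} (a : Fin n → ℝ) : Finset (Fin n) → ℝ :=
  fun S => ∑ j, if S = {j} then a j else 0

lemma lcf_ml {n : ℕ} (a : Fin n → ℝ) (x : Fin n → ℝ) : ml (lcf a) x = ∑ j, x j * a j := by
  unfold ml lcf
  simp only [Finset.sum_mul]
  rw [Finset.sum_comm]
  apply Finset.sum_congr rfl
  intro j _
  rw [Finset.sum_eq_single {j}]
  · simp; ring
  · intro B _ hB; simp [hB]
  · simp

lemma lcf_sq {n : ℕ} (a : Fin n → ℝ) : ∑ S, lcf a S ^ 2 = ∑ j, a j ^ 2 := by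
  have : ∀ S, lcf a S ^ 2 = ∑ j, if S = {j} then a j ^ 2 else 0 := by
    intro S
    unfold lcf
    by_cases h : ∃ k, S = {k}
    · obtain ⟨k, hk⟩ := h
      simp only [hk, Finset.singleton_inj]
      simp
    · push Not at h
      simp [h]
  simp only [this]
  rw [Finset.sum_comm]
  simp

lemma lcf_deg {n : ℕ} (a : Fin n → ℝ) : DegLe 1 (lcf a) := by
  intro S hS
  unfold lcf
  apply Finset.sum_eq_zero
  intro j _
  split_ifs with h
  · subst h; simp at hS
  · rfl

lemma lin2 {n : ℕ} (a : Fin n → ℝ) :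
    (∑ B : Fin n → Bool, (∑ j, chi (B j) * a j) ^ 2) / 2 ^ n = ∑ j, a j ^ 2 := by
  have := ml_second_sum (lcf a)
  simpa only [lcf_ml, lcf_sq] using this

lemma lin4 {n : ℕ} (a : Fin n → ℝ) :
    (∑ B : Fin n → Bool, (∑ j, chi (B j) * a j) ^ 4) / 2 ^ n ≤ 9 * (∑ j, a j ^ 2) ^ 2 := by
  have := ml_fourth_sum 1 (lcf a) (lcf_deg a)
  simpa only [lcf_ml, lcf_sq, pow_one] using this

lemma min_upper {n : ℕ} (a : Fin n → ℝ) (s : ℝ) :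
    (∑ B : Fin n → Bool, min 1 (s * (∑ j, chi (B j) * a j) ^ 2)) / 2 ^ n ≤ min 1 (s * ∑ j, a j ^ 2) := by
  apply le_min
  · rw [div_le_one (by positivity)]
    calc _ ≤ ∑ B : Fin n → Bool, (1:ℝ) := Finset.sum_le_sum (fun B _ => min_le_left _ _)
      _ = _ := by simp
  · rw [← lin2 a, ← mul_div_assoc, Finset.mul_sum]
    gcongr
    exact min_le_right _ _

lemma min_lower_small {n : ℕ} (a : Fin n → ℝ) (s : ℝ) :
    s * (∑ j, a j ^ 2) - 9 / 4 * (s * (∑ j, a j ^ 2)) ^ 2 ≤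
      (∑ B : Fin n → Bool, min 1 (s * (∑ j, chi (B j) * a j) ^ 2)) / 2 ^ n := by
  have h1 : ∀ x : ℝ, x - x ^ 2 / 4 ≤ min 1 x := by
    intro x
    apply le_min
    · nlinarith [sq_nonneg (x - 2)]
    · nlinarith [sq_nonneg x]
  have h2 := lin2 a
  have h4 := lin4 a
  calc _ ≤ s * ((∑ B : Fin n → Bool, (∑ j, chi (B j) * a j) ^ 2) / 2 ^ n) -
        s ^ 2 / 4 * ((∑ B : Fin n → Bool, (∑ j, chi (B j) * a j) ^ 4) / 2 ^ n) := by
        rw [h2]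
        have : s ^ 2 / 4 * ((∑ B : Fin n → Bool, (∑ j, chi (B j) * a j) ^ 4) / 2 ^ n) ≤
          s ^ 2 / 4 * (9 * (∑ j, a j ^ 2) ^ 2) := by gcongr
        nlinarith
    _ = (∑ B : Fin n → Bool, (s * (∑ j, chi (B j) * a j) ^ 2 - (s * (∑ j, chi (B j) * a j) ^ 2) ^ 2 / 4)) / 2 ^ n := by
        rw [← mul_div_assoc, ← mul_div_assoc, ← sub_div, Finset.mul_sum, Finset.mul_sum, ← Finset.sum_sub_distrib]
        congr 1
        apply Finset.sum_congr rfl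
        intro B _; ring
    _ ≤ _ := by
        gcongr
        exact h1 _

lemma min_lower {n : ℕ} (a : Fin n → ℝ) (s : ℝ) (hs : 0 ≤ s) :
    min 1 (s * ∑ j, a j ^ 2) ≤ 9 *
      ((∑ B : Fin n → Bool, min 1 (s * (∑ j, chi (B j) * a j) ^ 2)) / 2 ^ n) := by
  set q := s * ∑ j, a j ^ 2 with hq
  have hσ : 0 ≤ ∑ j, a j ^ 2 := by positivity
  have hq0 : 0 ≤ q := by positivity
  by_cases h : q ≤ 2 / 9
  · have := min_lower_small a s
    rw [← hq] at this
    refine (min_le_right _ _).trans ?_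
    nlinarith
  · push Not at h
    set l := 2 / 9 / q with hl
    have hl0 : 0 ≤ l := by positivity
    have hl1 : l ≤ 1 := by rw [hl, div_le_one (by linarith)]; linarith
    have h3 := min_lower_small a (l * s)
    have h4 : l * s * ∑ j, a j ^ 2 = 2 / 9 := by
      rw [mul_assoc, ← hq, hl, div_mul_cancel₀ _ (by linarith)]
    rw [h4] at h3
    refine (min_le_left _ _).trans ?_
    have h5 : (∑ B : Fin n → Bool, min 1 (l * s * (∑ j, chi (B j) * a j) ^ 2)) / 2 ^ n ≤
       (∑ B : Fin n → Bool, min 1 (s * (∑ j, chi (B j) * a j) ^ 2)) / 2 ^ n := by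
      gcongr
      nlinarith
    linarith

lemma min_le_Phi (u v ε : ℝ) (hu : u ≠ 0) : min 1 (ε ^ 2 / u ^ 2 * v ^ 2) ≤ 2 * Phi ε u v := by
  unfold Phi
  have hu2 : 0 < u ^ 2 := by positivity
  have hw : 0 ≤ ε ^ 2 * v ^ 2 := by positivity
  rw [div_mul_eq_mul_div, mul_div_assoc', le_div_iff₀ (by positivity)]
  rcases le_total (ε ^ 2 * v ^ 2) (u ^ 2) with h | h
  · calc _ ≤ (ε ^ 2 * v ^ 2 / u ^ 2) * (u ^ 2 + ε ^ 2 * v ^ 2) := by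
          gcongr; exact min_le_right _ _
      _ ≤ (ε ^ 2 * v ^ 2 / u ^ 2) * (u ^ 2 + u ^ 2) := by gcongr
      _ = _ := by field_simp; ring
  · calc _ ≤ 1 * (u ^ 2 + ε ^ 2 * v ^ 2) := by
          gcongr; exact min_le_left _ _
      _ ≤ _ := by linarith

lemma Phi_le_min (u v : ℝ) (hu : u ≠ 0) : Phi 1 u v ≤ min 1 (v ^ 2 / u ^ 2) := by
  apply le_min (Phi_le_one _ _ _)
  unfold Phi
  have hu2 : 0 < u ^ 2 := by positivity
  rw [one_pow, one_mul]
  gcongr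
  nlinarith [sq_nonneg v]

lemma EP_one_le {n : ℕ} (p : MvPolynomial (Fin n) ℝ) (hp : ∀ m ∈ p.support, ∀ i, m i ≤ 1)
    (h0 : ∀ x, pev p x ≠ 0) : EP ((radn n).prod (radn n)) 1 (cf p) ≤ alphaP p := by
  rw [EP_eq p hp]
  unfold alphaP
  gcongr with A _ B _
  exact Phi_le_min _ _ (h0 A)

/-- the gradient bound -/
lemma grad_le_EP {n : ℕ} (p : MvPolynomial (Fin n) ℝ) (hp : ∀ m ∈ p.support, ∀ i, m i ≤ 1)
    (h0 : ∀ x, pev p x ≠ 0) (ε : ℝ) :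
    (∑ A : Fin n → Bool, min 1 (ε ^ 2 / pev p A ^ 2 * ∑ j, ((pev p A - pev p (flipAt A j)) / 2) ^ 2)) / 2 ^ n
      ≤ 18 * EP ((radn n).prod (radn n)) ε (cf p) := by
  rw [EP_eq p hp]
  rw [← div_div, ← mul_div_assoc]
  gcongr
  rw [Finset.sum_div, Finset.mul_sum]
  gcongr with A _
  refine (min_lower _ _ (by positivity)).trans ?_
  rw [mul_div_assoc', mul_div_assoc', Finset.mul_sum, Finset.mul_sum]
  apply div_le_div_of_nonneg_right _ (by positivity)
  apply Finset.sum_le_sum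
  intro B _
  have := min_le_Phi (pev p A) (DB p A B) ε (h0 A)
  unfold DB at this ⊢
  linarith

end partF2

section partF3
open MeasureTheory ProbabilityTheory

/-- Put the values `y` on the coordinates in the range of `e`. -/
noncomputable def glue {m n : ℕ} (e : Fin m ↪ Fin n) (x : Fin n → Bool) (y : Fin m → Bool) : Fin n → Bool :=
  fun i => if h : ∃ k, e k = i then y h.choose else x i

lemma glue_e {m n : ℕ} (e : Fin m ↪ Fin n) (x : Fin n → Bool) (y : Fin m → Bool) (k : Fin m) :
    glue e x y (e k) = y k := by
  unfold glue
  have h : ∃ k', e k' = e k := ⟨k, rfl⟩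
  rw [dif_pos h, e.injective h.choose_spec]

lemma glue_ne {m n : ℕ} (e : Fin m ↪ Fin n) (x : Fin n → Bool) (y : Fin m → Bool) (i : Fin n) (h : ¬ ∃ k, e k = i) :
    glue e x y i = x i := by
  unfold glue; rw [dif_neg h]

lemma glue_flip {m n : ℕ} (e : Fin m ↪ Fin n) (x : Fin n → Bool) (y : Fin m → Bool) (k : Fin m) :
    glue e x (flipAt y k) = flipAt (glue e x y) (e k) := by
  ext i
  by_cases h : ∃ k', e k' = i
  · obtain ⟨k', rfl⟩ := h
    rw [glue_e]
    unfold flipAt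
    by_cases hk : k' = k
    · subst hk; simp [glue_e]
    · rw [Function.update_of_ne hk, Function.update_of_ne (fun h => hk (e.injective h)), glue_e]
  · rw [glue_ne e _ _ _ h]
    unfold flipAt
    rw [Function.update_of_ne (fun h' => h ⟨k, h'.symm⟩), glue_ne e _ _ _ h]

lemma glue_sum {m n : ℕ} (e : Fin m ↪ Fin n) (F : (Fin n → Bool) → ℝ) :
    ∑ x : Fin n → Bool, ∑ y : Fin m → Bool, F (glue e x y) = 2 ^ m * ∑ A : Fin n → Bool, F A := by
  have hinv : Function.Involutive (fun z : (Fin n → Bool) × (Fin m → Bool) =>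
      ((glue e z.1 z.2, fun k => z.1 (e k)) : (Fin n → Bool) × (Fin m → Bool))) := by
    rintro ⟨x, y⟩
    simp only [Prod.mk.injEq]
    constructor
    · ext i
      by_cases h : ∃ k', e k' = i
      · obtain ⟨k', rfl⟩ := h
        rw [glue_e]
      · rw [glue_ne e _ _ _ h, glue_ne e _ _ _ h]
    · ext k; rw [glue_e]
  rw [← Fintype.sum_prod_type' (f := fun x y => F (glue e x y))]
  rw [← Equiv.sum_comp hinv.toPerm (fun z : (Fin n → Bool) × (Fin m → Bool) => F (glue e z.1 z.2))]
  have : ∀ z : (Fin n → Bool) × (Fin m → Bool), F (glue e ((Function.Involutive.toPerm _ hinv) z).1 ((Function.Involutive.toPerm _ hinv) z).2) = F z.1 := by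
    intro z
    have h := hinv z
    have h2 := congrArg Prod.fst h
    simp only at h2
    simp only [Function.Involutive.coe_toPerm]
    rw [h2]
  simp only [this]
  rw [Fintype.sum_prod_type]
  simp [Finset.mul_sum]

/-- coefficients of the restriction -/
noncomputable def resc {m n : ℕ} (e : Fin m ↪ Fin n) (x : Fin n → Bool) (c : Finset (Fin n) → ℝ) :
    Finset (Fin m) → ℝ :=
  fun S' => ∑ S : Finset (Fin n), if S.preimage e e.injective.injOn = S' then
    c S * ∏ i ∈ S.filter (fun i => ¬ ∃ k, e k = i), chi (x i) else 0

lemma resc_deg {m n d : ℕ} (e : Fin m ↪ Fin n) (x : Fin n → Bool) (c : Finset (Fin n) → ℝ) (h : DegLe d c) :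
    DegLe d (resc e x c) := by
  intro S' hS'
  unfold resc
  apply Finset.sum_eq_zero
  intro S _
  split_ifs with h1
  · rw [h S, zero_mul]
    refine lt_of_lt_of_le hS' ?_
    rw [← h1]
    rw [← Finset.card_map e]
    apply Finset.card_le_card
    intro i hi
    simp only [Finset.mem_map, Finset.mem_preimage] at hi
    obtain ⟨k, hk, rfl⟩ := hi
    exact hk
  · rfl

lemma resc_ml {m n : ℕ} (e : Fin m ↪ Fin n) (x : Fin n → Bool) (c : Finset (Fin n) → ℝ) (y : Fin m → Bool) :
    ml (resc e x c) (fun k => chi (y k)) = ml c (fun i => chi (glue e x y i)) := by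
  unfold ml resc
  simp only [Finset.sum_mul]
  rw [Finset.sum_comm]
  apply Finset.sum_congr rfl
  intro S _
  rw [Finset.sum_eq_single (S.preimage e e.injective.injOn)]
  · rw [if_pos rfl, ← Finset.prod_filter_mul_prod_filter_not S (fun i => ∃ k, e k = i), mul_assoc]
    congr 1
    rw [mul_comm]
    congr 1
    · have : S.filter (fun i => ∃ k, e k = i) = (S.preimage e e.injective.injOn).map e := by
        ext i
        simp only [Finset.mem_filter, Finset.mem_map, Finset.mem_preimage]
        constructor
        · rintro ⟨h1, k, rfl⟩; exact ⟨k, h1, rfl⟩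
        · rintro ⟨k, h1, rfl⟩; exact ⟨h1, k, rfl⟩
      rw [this, Finset.prod_map]
      apply Finset.prod_congr rfl
      intro k _
      rw [glue_e]
    · apply Finset.prod_congr rfl
      intro i hi
      rw [glue_ne e x y i (Finset.mem_filter.1 hi).2]
  · intro S' _ hS'; rw [if_neg (Ne.symm hS'), zero_mul]
  · simp

/-- the restricted polynomial -/
noncomputable def resp {m n : ℕ} (e : Fin m ↪ Fin n) (x : Fin n → Bool) (p : MvPolynomial (Fin n) ℝ) :
    MvPolynomial (Fin m) ℝ := mkp (resc e x (cf p))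

lemma resp_pev {m n : ℕ} (e : Fin m ↪ Fin n) (x : Fin n → Bool) (p : MvPolynomial (Fin n) ℝ)
    (hp : ∀ m ∈ p.support, ∀ i, m i ≤ 1) (y : Fin m → Bool) :
    pev (resp e x p) y = pev p (glue e x y) := by
  unfold resp
  rw [mkp_pev, resc_ml, pev_cf p hp]

/-- alpha of the restriction, averaged over `x` -/
lemma alpha_avg {m n : ℕ} (e : Fin m ↪ Fin n) (p : MvPolynomial (Fin n) ℝ)
    (hp : ∀ m ∈ p.support, ∀ i, m i ≤ 1) :
    ∑ x : Fin n → Bool, alphaP (resp e x p) ≤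
      ∑ A : Fin n → Bool, min 1 (1 / pev p A ^ 2 * ∑ k, ((pev p A - pev p (flipAt A (e k))) / 2) ^ 2) := by
  set F : (Fin n → Bool) → ℝ := fun A =>
    (∑ B : Fin m → Bool, min 1 (1 / pev p A ^ 2 * (∑ k, chi (B k) * ((pev p A - pev p (flipAt A (e k))) / 2)) ^ 2)) / 2 ^ m with hF
  have h1 : ∀ x, alphaP (resp e x p) = (∑ y : Fin m → Bool, F (glue e x y)) / 2 ^ m := by
    intro x
    unfold alphaP
    rw [← div_div, Finset.sum_div]
    congr 1
    apply Finset.sum_congr rfl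
    intro y _
    simp only [hF, resp_pev e x p hp, glue_flip]
    congr 1
    apply Finset.sum_congr rfl
    intro B _
    congr 1
    ring
  simp only [h1]
  rw [← Finset.sum_div, glue_sum, mul_div_cancel_left₀ _ (by positivity)]
  apply Finset.sum_le_sum
  intro A _
  exact min_upper _ _

/-- sensitivity inside the range of `e` -/
noncomputable def sensE {m n : ℕ} (e : Fin m ↪ Fin n) (f : (Fin n → Bool) → ℝ) (A : Fin n → Bool) : ℕ :=
  (univ.filter (fun k => f (flipAt A (e k)) ≠ f A)).card

lemma bsa_avg {m n : ℕ} (e : Fin m ↪ Fin n) (f : (Fin n → Bool) → ℝ) :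
    ∑ x : Fin n → Bool, BSA (fun y => f (glue e x y)) = ∑ A : Fin n → Bool, √(sensE e f A) := by
  have h1 : ∀ x, BSA (fun y => f (glue e x y)) = (∑ y : Fin m → Bool, √(sensE e f (glue e x y))) / 2 ^ m := by
    intro x
    unfold BSA sens sensE
    simp only [glue_flip]
  simp only [h1]
  rw [← Finset.sum_div, glue_sum e (fun A => √(sensE e f A)), mul_div_cancel_left₀ _ (by positivity)]

end partF3

section partF4
open MeasureTheory ProbabilityTheory

lemma perm_sum1 {n : ℕ} (f : Fin n → ℝ) (i : Fin n) :
    (n : ℝ) * ∑ σ : Equiv.Perm (Fin n), f (σ i) = (Fintype.card (Equiv.Perm (Fin n)) : ℝ) * ∑ j, f j := by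
  have h1 : ∀ i' : Fin n, ∑ σ : Equiv.Perm (Fin n), f (σ i') = ∑ σ : Equiv.Perm (Fin n), f (σ i) := by
    intro i'
    rw [← Equiv.sum_comp (Equiv.mulRight (Equiv.swap i' i)) (fun σ : Equiv.Perm (Fin n) => f (σ i'))]
    apply Finset.sum_congr rfl
    intro σ _
    simp
  have h2 : ∑ i' : Fin n, ∑ σ : Equiv.Perm (Fin n), f (σ i') = (n : ℝ) * ∑ σ : Equiv.Perm (Fin n), f (σ i) := by
    simp only [h1]
    simp
  rw [← h2, Finset.sum_comm]
  have h3 : ∀ σ : Equiv.Perm (Fin n), ∑ i', f (σ i') = ∑ j, f j := fun σ => Equiv.sum_comp σ f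
  simp only [h3]
  simp only [Finset.sum_const, nsmul_eq_mul, Finset.card_univ]

lemma perm_two {n : ℕ} (i i' l l' : Fin n) (h : i ≠ i') (h' : l ≠ l') :
    ∃ π : Equiv.Perm (Fin n), π l = i ∧ π l' = i' := by
  refine ⟨Equiv.swap (Equiv.swap l i l') i' * Equiv.swap l i, ?_, ?_⟩
  · simp only [Equiv.Perm.mul_apply, Equiv.swap_apply_left]
    apply Equiv.swap_apply_of_ne_of_ne _ h
    intro h2
    have : Equiv.swap l i l = Equiv.swap l i l' := by rw [← h2]; simp
    exact h' ((Equiv.swap l i).injective this)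
  · simp

lemma perm_sum2 {n : ℕ} (g : Fin n → Fin n → ℝ) (i i' : Fin n) (h : i ≠ i') :
    (n : ℝ) * ((n : ℝ) - 1) * ∑ σ : Equiv.Perm (Fin n), g (σ i) (σ i') =
      (Fintype.card (Equiv.Perm (Fin n)) : ℝ) * ∑ j, ∑ k, if j = k then 0 else g j k := by
  have h1 : ∀ l l' : Fin n, l ≠ l' →
      ∑ σ : Equiv.Perm (Fin n), g (σ l) (σ l') = ∑ σ : Equiv.Perm (Fin n), g (σ i) (σ i') := by
    intro l l' hl
    obtain ⟨π, h1, h2⟩ := perm_two l l' i i' hl h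
    rw [← Equiv.sum_comp (Equiv.mulRight π) (fun σ : Equiv.Perm (Fin n) => g (σ i) (σ i'))]
    apply Finset.sum_congr rfl
    intro σ _
    simp [h1, h2]
  set Q := ∑ σ : Equiv.Perm (Fin n), g (σ i) (σ i') with hQ
  have h2 : ∑ l : Fin n, ∑ l' : Fin n, ∑ σ : Equiv.Perm (Fin n), (if σ l = σ l' then 0 else g (σ l) (σ l'))
      = (n : ℝ) * ((n : ℝ) - 1) * Q := by
    have h3 : ∀ l l' : Fin n, ∑ σ : Equiv.Perm (Fin n), (if σ l = σ l' then 0 else g (σ l) (σ l'))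
        = Q - if l = l' then Q else 0 := by
      intro l l'
      by_cases hl : l = l'
      · subst hl; simp
      · have hi : ∀ σ : Equiv.Perm (Fin n), ¬ (σ l = σ l') := fun σ h => hl (σ.injective h)
        simp only [hi, if_false, h1 l l' hl, if_neg hl, sub_zero]
    simp only [h3, Finset.sum_sub_distrib]
    simp
    ring
  rw [← h2]
  have h4 : ∀ l, ∑ l' : Fin n, ∑ σ : Equiv.Perm (Fin n), (if σ l = σ l' then 0 else g (σ l) (σ l')) =
      ∑ σ : Equiv.Perm (Fin n), ∑ k, (if σ l = k then 0 else g (σ l) k) := by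
    intro l
    rw [Finset.sum_comm]
    apply Finset.sum_congr rfl
    intro σ _
    exact Equiv.sum_comp σ (fun k => if σ l = k then 0 else g (σ l) k)
  simp only [h4]
  rw [Finset.sum_comm]
  have h5 : ∀ σ : Equiv.Perm (Fin n), ∑ l, ∑ k, (if σ l = k then 0 else g (σ l) k) =
      ∑ j, ∑ k, if j = k then 0 else g j k :=
    fun σ => Equiv.sum_comp σ (fun j => ∑ k, if j = k then 0 else g j k)
  simp only [h5]
  simp only [Finset.sum_const, nsmul_eq_mul, Finset.card_univ]

section samp
variable {m n : ℕ} (ι : Fin m ↪ Fin n) (t : Fin n → ℝ)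

lemma samp1 : (n : ℝ) * ∑ σ : Equiv.Perm (Fin n), ∑ k, t (σ (ι k)) =
    (Fintype.card (Equiv.Perm (Fin n)) : ℝ) * (m * ∑ j, t j) := by
  rw [Finset.sum_comm, Finset.mul_sum]
  simp only [perm_sum1]
  simp
  ring

lemma samp2 (ht : ∀ j, t j ^ 2 = t j) :
    (n : ℝ) * ((n : ℝ) - 1) * ∑ σ : Equiv.Perm (Fin n), (∑ k, t (σ (ι k))) ^ 2 =
    (Fintype.card (Equiv.Perm (Fin n)) : ℝ) *
      (((n : ℝ) - 1) * m * (∑ j, t j) + m * ((m : ℝ) - 1) * ((∑ j, t j) ^ 2 - ∑ j, t j)) := by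
  set P := (Fintype.card (Equiv.Perm (Fin n)) : ℝ)
  set S := ∑ j, t j with hS
  have hg : ∑ j, ∑ k, (if j = k then 0 else t j * t k) = S ^ 2 - S := by
    have : ∀ j k, (if j = k then 0 else t j * t k) = t j * t k - if j = k then t j else 0 := by
      intro j k
      by_cases h : j = k
      · subst h; simp only [if_true]; rw [← pow_two, ht]; ring
      · simp [h]
    simp only [this, Finset.sum_sub_distrib]
    congr 1
    · rw [pow_two, hS, Finset.sum_mul_sum]
    · simp [hS]
  have h1 : ∀ k k' : Fin m, (n : ℝ) * ((n : ℝ) - 1) * ∑ σ : Equiv.Perm (Fin n), t (σ (ι k)) * t (σ (ι k')) =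
      P * (S ^ 2 - S) + if k = k' then P * (((n : ℝ) - 1) * S - (S ^ 2 - S)) else 0 := by
    intro k k'
    by_cases h : k = k'
    · subst h
      simp only [← pow_two, ht, if_true]
      have := perm_sum1 t (ι k)
      calc (n : ℝ) * ((n : ℝ) - 1) * ∑ σ : Equiv.Perm (Fin n), t (σ (ι k))
          = ((n : ℝ) - 1) * ((n : ℝ) * ∑ σ : Equiv.Perm (Fin n), t (σ (ι k))) := by ring
        _ = _ := by rw [this]; ring
    · rw [perm_sum2 (fun j k => t j * t k) (ι k) (ι k') (fun h' => h (ι.injective h')), hg]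
      simp [h, P]
  have h2 : ∑ σ : Equiv.Perm (Fin n), (∑ k, t (σ (ι k))) ^ 2 =
      ∑ k, ∑ k', ∑ σ : Equiv.Perm (Fin n), t (σ (ι k)) * t (σ (ι k')) := by
    have : ∀ σ : Equiv.Perm (Fin n), (∑ k, t (σ (ι k))) ^ 2 = ∑ k, ∑ k', t (σ (ι k)) * t (σ (ι k')) := by
      intro σ; rw [pow_two, Finset.sum_mul_sum]
    simp only [this]
    rw [Finset.sum_comm]
    apply Finset.sum_congr rfl
    intro k _
    rw [Finset.sum_comm]
  rw [h2, Finset.mul_sum]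
  simp only [Finset.mul_sum (s := (univ : Finset (Fin m))), h1, Finset.sum_add_distrib]
  simp
  ring

lemma sqrt_ge_quad (y : ℝ) (hy : 0 ≤ y) : (3 * y - y ^ 2) / 2 ≤ √y := by
  have h := Real.sq_sqrt hy
  have h0 := Real.sqrt_nonneg y
  set u := √y
  rw [← h]
  have : 0 ≤ u * ((u - 1) ^ 2 * (u + 2)) := by positivity
  nlinarith

set_option maxHeartbeats 1000000 in
lemma samp_sqrt (b : ℕ) (hb : 1 ≤ b) (hn : 2 ≤ n) (hm : 1 ≤ m) (hmn : m ≤ n) (hmb : n ≤ m * b)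
    (ht : ∀ j, t j = 0 ∨ t j = 1) :
    (Fintype.card (Equiv.Perm (Fin n)) : ℝ) * √(∑ j, t j) ≤
      √b * ∑ σ : Equiv.Perm (Fin n), √(∑ k, t (σ (ι k))) + b * (Fintype.card (Equiv.Perm (Fin n)) : ℝ) := by
  have ht2 : ∀ j, t j ^ 2 = t j := by
    intro j; rcases ht j with h | h <;> simp [h]
  have ht0 : ∀ j, 0 ≤ t j := by
    intro j; rcases ht j with h | h <;> simp [h]
  have hs1 := samp1 ι t
  have hs2 := samp2 ι t ht2
  have hP : 0 < (Fintype.card (Equiv.Perm (Fin n)) : ℝ) := by exact_mod_cast Fintype.card_pos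
  set P := (Fintype.card (Equiv.Perm (Fin n)) : ℝ)
  have hSint : ∑ j, t j = 0 ∨ 1 ≤ ∑ j, t j := by
    by_cases h : ∀ j, t j = 0
    · left; simp [h]
    · right
      push Not at h
      obtain ⟨j, hj⟩ := h
      have : t j = 1 := (ht j).resolve_left hj
      rw [← this]
      exact Finset.single_le_sum (fun i _ => ht0 i) (Finset.mem_univ j)
  have hX : ∀ σ : Equiv.Perm (Fin n), 0 ≤ ∑ k, t (σ (ι k)) := fun σ => Finset.sum_nonneg (fun _ _ => ht0 _)
  set X : Equiv.Perm (Fin n) → ℝ := fun σ => ∑ k, t (σ (ι k)) with hXd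
  change ∀ σ, 0 ≤ X σ at hX
  change (n : ℝ) * ∑ σ, X σ = _ at hs1
  change (n : ℝ) * ((n : ℝ) - 1) * ∑ σ, X σ ^ 2 = _ at hs2
  change _ ≤ √b * ∑ σ, √(X σ) + b * P
  set S := ∑ j, t j
  have hb' : (1 : ℝ) ≤ b := by exact_mod_cast hb
  have hR : 0 ≤ √b * ∑ σ, √(X σ) := mul_nonneg (Real.sqrt_nonneg _) (Finset.sum_nonneg (fun _ _ => Real.sqrt_nonneg _))
  rcases hSint with hS0 | hS1
  · rw [hS0, Real.sqrt_zero, mul_zero]; positivity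
  have hn' : (2 : ℝ) ≤ n := by exact_mod_cast hn
  have hm' : (1 : ℝ) ≤ m := by exact_mod_cast hm
  have hmn' : (m : ℝ) ≤ n := by exact_mod_cast hmn
  have hmb' : (n : ℝ) ≤ m * b := by exact_mod_cast hmb
  obtain ⟨π, hπ⟩ : ∃ π : ℝ, π = m / n := ⟨_, rfl⟩
  have hπ0 : 0 < π := by rw [hπ]; positivity
  have hπm : (m : ℝ) = π * n := by rw [hπ]; field_simp
  have hπb : 1 ≤ π * b := by
    rw [hπm] at hmb'
    have : (n : ℝ) * 1 ≤ n * (π * b) := by linarith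
    exact le_of_mul_le_mul_left this (by linarith)
  have hπ1 : π ≤ 1 := by rw [hπ]; exact div_le_one_of_le₀ hmn' (by linarith)
  have e1 : ∑ σ, X σ = P * (π * S) := by
    have : (n : ℝ) * ∑ σ, X σ = n * (P * (π * S)) := by rw [hs1, hπm]; ring
    exact mul_left_cancel₀ (by positivity) this
  have e2 : ∑ σ, X σ ^ 2 ≤ P * (π * S + (π * S) ^ 2) := by
    have h3 : (n : ℝ) * ((n : ℝ) - 1) * ∑ σ, X σ ^ 2 ≤ n * ((n : ℝ) - 1) * (P * (π * S + (π * S) ^ 2)) := by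
      rw [hs2, hπm]
      have k1 : (π * n - 1) * (S ^ 2 - S) ≤ π * ((n : ℝ) - 1) * S ^ 2 := by
        have : 0 ≤ π * n - 1 := by linarith
        have k2 : (π * n - 1) * (S ^ 2 - S) ≤ (π * n - 1) * S ^ 2 := by
          apply mul_le_mul_of_nonneg_left _ this; linarith
        have k3 : (π * n - 1) * S ^ 2 ≤ π * ((n : ℝ) - 1) * S ^ 2 := by
          apply mul_le_mul_of_nonneg_right _ (sq_nonneg _); nlinarith
        linarith
      have k4 : 0 ≤ P * (π * n) := by positivity
      have k5 := mul_le_mul_of_nonneg_left k1 k4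
      nlinarith
    have : 0 < (n : ℝ) * ((n : ℝ) - 1) := by
      apply mul_pos <;> linarith
    exact le_of_mul_le_mul_left h3 this
  have hπS : 0 < π * S := by positivity
  have e3 : ∀ σ, √(π * S) * ((3 * (X σ / (π * S)) - (X σ / (π * S)) ^ 2) / 2) ≤ √(X σ) := by
    intro σ
    have : √(X σ) = √(π * S) * √(X σ / (π * S)) := by
      rw [← Real.sqrt_mul hπS.le]; congr 1; field_simp
    rw [this]
    exact mul_le_mul_of_nonneg_left (sqrt_ge_quad _ (div_nonneg (hX σ) hπS.le)) (Real.sqrt_nonneg _)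
  have e4 : P * (√(π * S) * (1 - 1 / (2 * (π * S)))) ≤ ∑ σ, √(X σ) := by
    refine le_trans ?_ (Finset.sum_le_sum (fun σ _ => e3 σ))
    rw [← Finset.mul_sum, ← Finset.sum_div, Finset.sum_sub_distrib, ← Finset.mul_sum]
    simp only [div_pow]
    rw [← Finset.sum_div, ← Finset.sum_div, e1]
    have : (∑ σ, X σ ^ 2) / (π * S) ^ 2 ≤ P * (1 / (π * S) + 1) := by
      rw [div_le_iff₀ (by positivity)]
      refine e2.trans (le_of_eq ?_)
      field_simp
    have h6 : P * (π * S) / (π * S) = P := by field_simp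
    rw [h6]
    have h7 : P * (√(π * S) * (1 - 1 / (2 * (π * S)))) = √(π * S) * ((3 * P - P * (1 / (π * S) + 1)) / 2) := by
      field_simp; ring
    rw [h7]
    apply mul_le_mul_of_nonneg_left _ (Real.sqrt_nonneg _)
    linarith
  have hsS : √S ≤ S := by
    rw [Real.sqrt_le_left (by linarith)]; nlinarith
  have hsS1 : 1 ≤ √S := by rw [Real.one_le_sqrt]; exact hS1
  by_cases hc : 1 ≤ 2 * (π * S)
  · have hfac : 0 ≤ 1 - 1 / (2 * (π * S)) := by
      rw [sub_nonneg, div_le_one (by positivity)]; exact hc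
    have h8 : √S ≤ √b * √(π * S) := by
      rw [← Real.sqrt_mul (by linarith)]
      apply Real.sqrt_le_sqrt
      nlinarith
    have h9 : √S * (1 - 1 / (2 * (π * S))) ≤ √b * √(π * S) * (1 - 1 / (2 * (π * S))) :=
      mul_le_mul_of_nonneg_right h8 hfac
    have h10 : √S * (1 / (2 * (π * S))) ≤ b := by
      rw [mul_one_div, div_le_iff₀ (by positivity)]
      nlinarith
    have h11 : √S ≤ √b * √(π * S) * (1 - 1 / (2 * (π * S))) + b := by linarith
    have h12 := mul_le_mul_of_nonneg_left h11 hP.le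
    have h13 := mul_le_mul_of_nonneg_left e4 (Real.sqrt_nonneg (b : ℝ))
    nlinarith
  · push Not at hc
    have h20 : S * 1 ≤ S * (π * b) := mul_le_mul_of_nonneg_left hπb (by linarith)
    have h21 : (2 * (π * S)) * b ≤ 1 * b := mul_le_mul_of_nonneg_right hc.le (by linarith)
    have : S ≤ b := by linarith
    have : P * √S ≤ P * b := mul_le_mul_of_nonneg_left (by linarith) hP.le
    linarith
end samp

end partF4

section partF5
open MeasureTheory ProbabilityTheory

/-- the random embedding -/
def embP {m n : ℕ} (ι : Fin m ↪ Fin n) (σ : Equiv.Perm (Fin n)) : Fin m ↪ Fin n := ι.trans σ.toEmbedding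

lemma embP_apply {m n : ℕ} (ι : Fin m ↪ Fin n) (σ : Equiv.Perm (Fin n)) (k : Fin m) :
    embP ι σ k = σ (ι k) := rfl

lemma alphaP_nonneg {n : ℕ} (p : MvPolynomial (Fin n) ℝ) : 0 ≤ alphaP p := by
  unfold alphaP
  apply div_nonneg _ (by positivity)
  apply Finset.sum_nonneg; intro A _
  apply Finset.sum_nonneg; intro B _
  exact le_min zero_le_one (by positivity)

lemma min_avg {m n : ℕ} (ι : Fin m ↪ Fin n) (g : Fin n → ℝ) (hg : ∀ j, 0 ≤ g j) (c : ℝ) (hc : 0 ≤ c)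
    (b : ℕ) (hb : 1 ≤ b) (hn : 1 ≤ n) (hmb : m * b ≤ 2 * n) :
    ∑ σ : Equiv.Perm (Fin n), min 1 (c * ∑ k, g (σ (ι k))) ≤
      (Fintype.card (Equiv.Perm (Fin n)) : ℝ) * (2 * min 1 (c * (1 / b) * ∑ j, g j)) := by
  have h1 := samp1 ι g
  have hb' : (0 : ℝ) < b := by exact_mod_cast hb
  have hn' : (0 : ℝ) < n := by exact_mod_cast hn
  have hmb' : (m : ℝ) * b ≤ 2 * n := by exact_mod_cast hmb
  have hG : 0 ≤ ∑ j, g j := Finset.sum_nonneg (fun j _ => hg j)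
  have hP : 0 ≤ (Fintype.card (Equiv.Perm (Fin n)) : ℝ) := by positivity
  have h2 : ∑ σ : Equiv.Perm (Fin n), min 1 (c * ∑ k, g (σ (ι k))) ≤ (Fintype.card (Equiv.Perm (Fin n)) : ℝ) := by
    refine (Finset.sum_le_sum (fun σ _ => min_le_left _ _)).trans (le_of_eq ?_)
    simp only [Finset.sum_const, nsmul_eq_mul, Finset.card_univ, mul_one]
  have h3 : ∑ σ : Equiv.Perm (Fin n), min 1 (c * ∑ k, g (σ (ι k))) ≤
      c * ∑ σ : Equiv.Perm (Fin n), ∑ k, g (σ (ι k)) := by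
    rw [Finset.mul_sum]
    exact Finset.sum_le_sum (fun σ _ => min_le_right _ _)
  set P := (Fintype.card (Equiv.Perm (Fin n)) : ℝ)
  set Q := ∑ σ : Equiv.Perm (Fin n), ∑ k, g (σ (ι k))
  set G := ∑ j, g j
  have h4 : Q ≤ P * (2 * (1 / b * G)) := by
    have : Q = P * ((m / n) * G) := by
      have : (n : ℝ) * Q = n * (P * ((m / n) * G)) := by rw [h1]; field_simp
      exact mul_left_cancel₀ hn'.ne' this
    rw [this]
    apply mul_le_mul_of_nonneg_left _ hP
    rw [← mul_assoc]
    apply mul_le_mul_of_nonneg_right _ hG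
    rw [mul_one_div, div_le_div_iff₀ hn' hb']
    exact hmb'
  rcases le_total 1 (c * (1 / b) * G) with h | h
  · rw [min_eq_left h]; linarith
  · rw [min_eq_right h]
    have := mul_le_mul_of_nonneg_left h4 hc
    calc _ ≤ _ := h3
      _ ≤ _ := this
      _ = _ := by ring

lemma alpha_total {m n : ℕ} (ι : Fin m ↪ Fin n) (p : MvPolynomial (Fin n) ℝ)
    (hp : ∀ m ∈ p.support, ∀ i, m i ≤ 1) (h0 : ∀ x, pev p x ≠ 0)
    (b : ℕ) (hb : 1 ≤ b) (hn : 1 ≤ n) (hmb : m * b ≤ 2 * n) :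
    ∑ σ : Equiv.Perm (Fin n), ∑ x, alphaP (resp (embP ι σ) x p) ≤
      (Fintype.card (Equiv.Perm (Fin n)) : ℝ) * 2 ^ n *
        (36 * EP ((radn n).prod (radn n)) ((b : ℝ) ^ (-(1 : ℝ) / 2)) (cf p)) := by
  have hg := grad_le_EP p hp h0 ((b : ℝ) ^ (-(1 : ℝ) / 2))
  have hb' : (0 : ℝ) < b := by exact_mod_cast hb
  have he : ((b : ℝ) ^ (-(1 : ℝ) / 2)) ^ 2 = 1 / b := by
    rw [← Real.rpow_natCast, ← Real.rpow_mul hb'.le]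
    norm_num
    rw [Real.rpow_neg_one]
  rw [he, div_le_iff₀ (by positivity)] at hg
  have h1 : ∑ σ : Equiv.Perm (Fin n), ∑ x, alphaP (resp (embP ι σ) x p) ≤
      ∑ σ : Equiv.Perm (Fin n), ∑ A : Fin n → Bool,
        min 1 (1 / pev p A ^ 2 * ∑ k, ((pev p A - pev p (flipAt A (σ (ι k)))) / 2) ^ 2) :=
    Finset.sum_le_sum (fun σ _ => alpha_avg (embP ι σ) p hp)
  rw [Finset.sum_comm (s := univ) (t := univ) (f := fun (σ : Equiv.Perm (Fin n)) (A : Fin n → Bool) =>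
        min 1 (1 / pev p A ^ 2 * ∑ k, ((pev p A - pev p (flipAt A (σ (ι k)))) / 2) ^ 2))] at h1
  refine h1.trans ?_
  have h2 : ∀ A : Fin n → Bool, ∑ σ : Equiv.Perm (Fin n),
        min 1 (1 / pev p A ^ 2 * ∑ k, ((pev p A - pev p (flipAt A (σ (ι k)))) / 2) ^ 2) ≤
      (Fintype.card (Equiv.Perm (Fin n)) : ℝ) * (2 * min 1 (1 / b / pev p A ^ 2 * ∑ j, ((pev p A - pev p (flipAt A j)) / 2) ^ 2)) := by
    intro A
    have := min_avg ι (fun j => ((pev p A - pev p (flipAt A j)) / 2) ^ 2) (fun j => sq_nonneg _)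
      (1 / pev p A ^ 2) (by positivity) b hb hn hmb
    refine this.trans (le_of_eq ?_)
    congr 4
    ring
  refine (Finset.sum_le_sum (fun A _ => h2 A)).trans ?_
  rw [← Finset.mul_sum, ← Finset.mul_sum]
  have hP : 0 ≤ (Fintype.card (Equiv.Perm (Fin n)) : ℝ) := by positivity
  rw [mul_assoc (Fintype.card (Equiv.Perm (Fin n)) : ℝ)]
  apply mul_le_mul_of_nonneg_left _ hP
  linarith

lemma bsa_total {m n : ℕ} (ι : Fin m ↪ Fin n) (f : (Fin n → Bool) → ℝ)
    (b : ℕ) (hb : 1 ≤ b) (hn : 2 ≤ n) (hm : 1 ≤ m) (hmn : m ≤ n) (hmb : n ≤ m * b) :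
    (Fintype.card (Equiv.Perm (Fin n)) : ℝ) * 2 ^ n * BSA f ≤
      √b * ∑ σ : Equiv.Perm (Fin n), ∑ x, BSA (fun y => f (glue (embP ι σ) x y)) +
        b * ((Fintype.card (Equiv.Perm (Fin n)) : ℝ) * 2 ^ n) := by
  simp only [bsa_avg]
  rw [Finset.sum_comm]
  have h1 : ∀ A : Fin n → Bool, (Fintype.card (Equiv.Perm (Fin n)) : ℝ) * √(sens f A) ≤
      √b * ∑ σ : Equiv.Perm (Fin n), √(sensE (embP ι σ) f A) + b * (Fintype.card (Equiv.Perm (Fin n)) : ℝ) := by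
    intro A
    have := samp_sqrt ι (fun j => if f (flipAt A j) ≠ f A then 1 else 0) b hb hn hm hmn hmb
      (fun j => by by_cases h : f (flipAt A j) ≠ f A <;> simp [h])
    simp only [Finset.sum_boole] at this
    exact this
  have h2 := Finset.sum_le_sum (s := univ) (fun A _ => h1 A)
  rw [← Finset.mul_sum, Finset.sum_add_distrib, ← Finset.mul_sum] at h2
  have h3 : ∑ A : Fin n → Bool, √(sens f A) = 2 ^ n * BSA f := by
    unfold BSA; field_simp
  rw [h3] at h2
  have h4 : ∑ A : Fin n → Bool, b * (Fintype.card (Equiv.Perm (Fin n)) : ℝ) =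
      b * ((Fintype.card (Equiv.Perm (Fin n)) : ℝ) * 2 ^ n) := by
    simp only [Finset.sum_const, nsmul_eq_mul, Finset.card_univ]
    simp
    ring
  rw [h4] at h2
  linarith

lemma BSA_nonneg {n : ℕ} (f : (Fin n → Bool) → ℝ) : 0 ≤ BSA f := by
  unfold BSA; positivity

lemma BSA_finite (n : ℕ) : (Set.range (fun f : (Fin n → Bool) → ℝ => BSA f)).Finite := by
  apply Set.Finite.subset (Set.finite_range (fun g : (Fin n → Bool) → Fin (n + 1) =>
    (∑ x, √((g x : ℕ) : ℝ)) / 2 ^ n))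
  rintro _ ⟨f, rfl⟩
  refine ⟨fun x => ⟨sens f x, ?_⟩, rfl⟩
  unfold sens
  refine Nat.lt_succ_of_le ((Finset.card_le_univ _).trans ?_)
  simp

lemma BSA_le_MBSA {d n : ℕ} (a : ℝ) (f : (Fin n → Bool) → ℝ) (p : MvPolynomial (Fin n) ℝ)
    (h1 : ∀ m ∈ p.support, ∀ i, m i ≤ 1) (h2 : p.totalDegree ≤ d)
    (h3 : ∀ x, pev p x ≠ 0 ∧ f x = Real.sign (pev p x)) (h4 : alphaP p ≤ a) : BSA f ≤ MBSA d n a := by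
  unfold MBSA
  apply le_csSup
  · apply Set.Finite.bddAbove
    apply (BSA_finite n).subset
    rintro _ ⟨f, p, _, _, _, _, rfl⟩
    exact ⟨f, rfl⟩
  · exact ⟨f, p, h1, h2, h3, h4, rfl⟩

lemma MBSA_nonneg (d n : ℕ) (a : ℝ) : 0 ≤ MBSA d n a := by
  unfold MBSA
  apply Real.sSup_nonneg
  rintro _ ⟨f, p, _, _, _, _, rfl⟩
  exact BSA_nonneg f

lemma MRBSA_attained (d n : ℕ) (a τ : ℝ) : MRBSA d n a τ = 0 ∨
    ∃ (f : (Fin n → Bool) → ℝ) (p : MvPolynomial (Fin n) ℝ),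
    (∀ m ∈ p.support, ∀ i, m i ≤ 1) ∧ p.totalDegree ≤ d ∧
    (∀ x, pev p x ≠ 0 ∧ f x = Real.sign (pev p x)) ∧ alphaP p ≤ a ∧
    PolyRegular τ p ∧ MRBSA d n a τ = BSA f := by
  unfold MRBSA
  set s := {s : ℝ | ∃ (f : (Fin n → Bool) → ℝ) (p : MvPolynomial (Fin n) ℝ),
    (∀ m ∈ p.support, ∀ i, m i ≤ 1) ∧ p.totalDegree ≤ d ∧
    (∀ x, pev p x ≠ 0 ∧ f x = Real.sign (pev p x)) ∧ alphaP p ≤ a ∧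
    PolyRegular τ p ∧ s = BSA f} with hs
  have hfin : s.Finite := by
    apply (BSA_finite n).subset
    rintro _ ⟨f, p, _, _, _, _, _, rfl⟩
    exact ⟨f, rfl⟩
  rcases s.eq_empty_or_nonempty with h | h
  · left; rw [h, Real.sSup_empty]
  · right
    exact h.csSup_mem hfin

/-- padding with a dummy variable -/
lemma pad_pev {n : ℕ} (p : MvPolynomial (Fin n) ℝ) (x : Fin (n + 1) → Bool) :
    pev (MvPolynomial.rename Fin.succ p) x = pev p (Fin.tail x) := by
  unfold pev
  rw [MvPolynomial.eval_rename]
  rfl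

lemma tail_flip_succ {n : ℕ} (x : Fin (n + 1) → Bool) (j : Fin n) :
    Fin.tail (flipAt x j.succ) = flipAt (Fin.tail x) j := by
  unfold flipAt
  rw [Fin.tail_update_succ]; rfl

lemma tail_flip_zero {n : ℕ} (x : Fin (n + 1) → Bool) :
    Fin.tail (flipAt x 0) = Fin.tail x := by
  unfold flipAt
  rw [Fin.tail_update_zero]

lemma pad_sum {n : ℕ} (F : (Fin n → Bool) → ℝ) :
    ∑ x : Fin (n + 1) → Bool, F (Fin.tail x) = 2 * ∑ x, F x := by
  rw [← Equiv.sum_comp (Fin.consEquiv (fun _ : Fin (n + 1) => Bool)) (fun x => F (Fin.tail x))]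
  rw [Fintype.sum_prod_type]
  simp [Fin.consEquiv, two_mul]

lemma pad_BSA {n : ℕ} (f : (Fin n → Bool) → ℝ) :
    BSA (fun x : Fin (n + 1) → Bool => f (Fin.tail x)) = BSA f := by
  unfold BSA
  have : ∀ x : Fin (n + 1) → Bool, sens (fun x : Fin (n + 1) → Bool => f (Fin.tail x)) x = sens f (Fin.tail x) := by
    intro x
    unfold sens
    simp only [Finset.card_filter]
    rw [Fin.sum_univ_succ]
    simp [tail_flip_zero, tail_flip_succ]
  simp only [this]
  rw [pad_sum (fun x => √(sens f x)), pow_succ]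
  field_simp

lemma pad_alpha {n : ℕ} (p : MvPolynomial (Fin n) ℝ) :
    alphaP (MvPolynomial.rename Fin.succ p) = alphaP p := by
  unfold alphaP
  simp only [pad_pev, Fin.sum_univ_succ, tail_flip_zero, tail_flip_succ, sub_self, zero_div, mul_zero, zero_add]
  have h1 : ∀ A : Fin n → Bool, ∑ B : Fin (n + 1) → Bool,
      min 1 ((∑ j : Fin n, chi (B j.succ) * ((pev p A - pev p (flipAt A j)) / 2)) ^ 2 / pev p A ^ 2) =
      2 * ∑ B : Fin n → Bool, min 1 ((∑ j : Fin n, chi (B j) * ((pev p A - pev p (flipAt A j)) / 2)) ^ 2 / pev p A ^ 2) :=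
    fun A => pad_sum (fun B : Fin n → Bool => min 1 ((∑ j : Fin n, chi (B j) * ((pev p A - pev p (flipAt A j)) / 2)) ^ 2 / pev p A ^ 2))
  simp only [h1]
  rw [pad_sum (fun A : Fin n → Bool => 2 * ∑ B : Fin n → Bool, min 1 ((∑ j : Fin n, chi (B j) * ((pev p A - pev p (flipAt A j)) / 2)) ^ 2 / pev p A ^ 2))]
  rw [← Finset.mul_sum, pow_succ]
  field_simp

lemma pad_support {n : ℕ} (p : MvPolynomial (Fin n) ℝ) (hp : ∀ m ∈ p.support, ∀ i, m i ≤ 1) :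
    ∀ m ∈ (MvPolynomial.rename Fin.succ p : MvPolynomial (Fin (n + 1)) ℝ).support, ∀ i, m i ≤ 1 := by
  intro m hm i
  rw [MvPolynomial.support_rename_of_injective (Fin.succ_injective n)] at hm
  obtain ⟨m', hm', rfl⟩ := Finset.mem_image.1 hm
  by_cases h : i ∈ Set.range (Fin.succ : Fin n → Fin (n + 1))
  · obtain ⟨j, rfl⟩ := h
    rw [Finsupp.mapDomain_apply (Fin.succ_injective n)]
    exact hp m' hm' j
  · rw [Finsupp.mapDomain_of_notMem_range _ _ h]
    exact zero_le_one

end partF5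

section partF6
open MeasureTheory ProbabilityTheory

lemma final_bound :
    ∃ C : ℝ, 0 < C ∧ ∀ d n b : ℕ, 1 ≤ d → 1 ≤ n → 1 ≤ b → b ≤ n →
      ∀ a τ : ℝ, 0 < a → 0 < τ →
        ∃ (N : ℕ) (w t : Fin N → ℝ),
          (∀ i, 0 ≤ w i) ∧ (∑ i, w i = 1) ∧ (∀ i, 0 ≤ t i) ∧
          (∑ i, w i * t i ≤
            C * ((d : ℝ) ^ 3 * a * (b : ℝ) ^ (-(1 : ℝ) / 2) +
              (d : ℝ) ^ 4 * τ ^ (1 / (8 * (d : ℝ))))) ∧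
          MRBSA d n a τ ≤ Real.sqrt b * (∑ i, w i * MBSA d (n / b + 1) (t i)) + b := by
  obtain ⟨C0, hC0, hM⟩ := main_M
  refine ⟨36 * C0 + 1, by positivity, ?_⟩
  intro d n b hd hn hb hbn a τ ha hτ
  have hd' : (1 : ℝ) ≤ d := by exact_mod_cast hd
  have hb' : (1 : ℝ) ≤ b := by exact_mod_cast hb
  have hε0 : 0 < (b : ℝ) ^ (-(1 : ℝ) / 2) := by positivity
  have hτ0 : 0 < τ ^ (1 / (8 * (d : ℝ))) := by positivity
  rcases MRBSA_attained d n a τ with h0 | ⟨f, p, hp, hdeg, hf, hα, hreg, hBSA⟩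
  · refine ⟨1, fun _ => 1, fun _ => 0, by simp, by simp, by simp, ?_, ?_⟩
    · simp only [mul_zero, Finset.sum_const_zero]; positivity
    · rw [h0]
      have := MBSA_nonneg d (n / b + 1) 0
      simp only [one_mul, Finset.sum_const, Finset.card_univ, Fintype.card_fin, one_smul]
      positivity
  rw [hBSA]
  have hne : ∀ x, pev p x ≠ 0 := fun x => (hf x).1
  rcases Nat.lt_or_ge 1 b with hb2 | hb1
  · -- main case
    have hn2 : 2 ≤ n := by omega
    have hdm := Nat.div_add_mod n b
    have hmod := Nat.mod_lt n (show 0 < b by omega)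
    have hmn : n / b + 1 ≤ n := by
      have : n / b ≤ n / 2 := Nat.div_le_div_left hb2 (by norm_num)
      omega
    have e1 : (n / b + 1) * b = b * (n / b) + b := by ring
    set ι : Fin (n / b + 1) ↪ Fin n := Fin.castLEEmb hmn
    have hA := alpha_total ι p hp hne b hb hn (by omega)
    have hB := bsa_total ι f b hb hn2 (Nat.le_add_left 1 _) hmn (by omega)
    have hE : EP ((radn n).prod (radn n)) ((b : ℝ) ^ (-(1 : ℝ) / 2)) (cf p) ≤
        C0 * ((d : ℝ) ^ 3 * a * (b : ℝ) ^ (-(1 : ℝ) / 2) + (d : ℝ) ^ 4 * τ ^ (1 / (8 * (d : ℝ)))) := by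
      refine (hM n d hd (cf p) (cf_deg p hdeg) τ hτ ?_ _ hε0 ?_).trans ?_
      · intro j
        rw [← pInf_eq p hp, ← pVar_eq p hp]
        exact hreg j
      · exact Real.rpow_le_one_of_one_le_of_nonpos hb' (by norm_num)
      · apply mul_le_mul_of_nonneg_left _ hC0.le
        have h1 := (EP_one_le p hp hne).trans hα
        have h2 : (d : ℝ) ^ 3 * (b : ℝ) ^ (-(1 : ℝ) / 2) * EP ((radn n).prod (radn n)) 1 (cf p) ≤
          (d : ℝ) ^ 3 * (b : ℝ) ^ (-(1 : ℝ) / 2) * a := mul_le_mul_of_nonneg_left h1 (by positivity)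
        linarith
    have hcard : (Fintype.card (Equiv.Perm (Fin n) × (Fin n → Bool)) : ℝ) =
        (Fintype.card (Equiv.Perm (Fin n)) : ℝ) * 2 ^ n := by
      rw [Fintype.card_prod]; push_cast; simp
    have hK : 0 < (Fintype.card (Equiv.Perm (Fin n)) : ℝ) * 2 ^ n := by
      have : 0 < (Fintype.card (Equiv.Perm (Fin n)) : ℝ) := by exact_mod_cast Fintype.card_pos
      positivity
    set K := (Fintype.card (Equiv.Perm (Fin n)) : ℝ) * 2 ^ n
    let eq := Fintype.equivFin (Equiv.Perm (Fin n) × (Fin n → Bool))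
    let T : Equiv.Perm (Fin n) × (Fin n → Bool) → ℝ := fun z => alphaP (resp (embP ι z.1) z.2 p)
    have hsum : ∀ F : Equiv.Perm (Fin n) × (Fin n → Bool) → ℝ, ∑ i, 1 / K * F (eq.symm i) =
        (∑ σ : Equiv.Perm (Fin n), ∑ x : Fin n → Bool, F (σ, x)) / K := by
      intro F
      rw [Equiv.sum_comp eq.symm (fun z => 1 / K * F z), ← Finset.mul_sum, Fintype.sum_prod_type]
      ring
    refine ⟨_, fun _ => 1 / K, fun i => T (eq.symm i), fun _ => by positivity, ?_,
      fun i => alphaP_nonneg _, ?_, ?_⟩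
    · simp only [Finset.sum_const, nsmul_eq_mul, Finset.card_univ, Fintype.card_fin]
      rw [hcard]
      exact mul_one_div_cancel hK.ne'
    · rw [hsum T, div_le_iff₀ hK]
      refine hA.trans ?_
      rw [mul_comm K]
      apply mul_le_mul_of_nonneg_right _ hK.le
      have : 0 ≤ ((d : ℝ) ^ 3 * a * (b : ℝ) ^ (-(1 : ℝ) / 2) + (d : ℝ) ^ 4 * τ ^ (1 / (8 * (d : ℝ)))) := by positivity
      linarith
    · rw [hsum (fun z => MBSA d (n / b + 1) (T z))]
      have h3 : ∑ σ : Equiv.Perm (Fin n), ∑ x, BSA (fun y => f (glue (embP ι σ) x y)) ≤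
          ∑ σ : Equiv.Perm (Fin n), ∑ x : Fin n → Bool, MBSA d (n / b + 1) (T (σ, x)) := by
        apply Finset.sum_le_sum; intro σ _
        apply Finset.sum_le_sum; intro x _
        apply BSA_le_MBSA _ _ (resp (embP ι σ) x p) (mkp_support _) (mkp_deg _ (resc_deg _ _ _ (cf_deg p hdeg)))
        · intro y
          rw [resp_pev _ _ _ hp]
          exact hf _
        · exact le_refl _
      have h4 := mul_le_mul_of_nonneg_left h3 (Real.sqrt_nonneg (b : ℝ))
      have h5 : K * BSA f ≤ K * (√b * ((∑ σ : Equiv.Perm (Fin n), ∑ x : Fin n → Bool,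
          MBSA d (n / b + 1) (T (σ, x))) / K) + b) := by
        refine (hB.trans (add_le_add_left h4 _)).trans (le_of_eq ?_)
        field_simp
      exact le_of_mul_le_mul_left h5 hK
  · have hb0 : b = 1 := by omega
    subst hb0
    rw [Nat.div_one]
    refine ⟨1, fun _ => 1, fun _ => alphaP p, by simp, by simp, fun _ => alphaP_nonneg p, ?_, ?_⟩
    · simp only [one_mul, Finset.sum_const, Finset.card_univ, Fintype.card_fin, one_smul, Nat.cast_one,
        Real.one_rpow, mul_one]
      have h1 : (1 : ℝ) ≤ (d : ℝ) ^ 3 := one_le_pow₀ hd'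
      have h2 : 0 < (d : ℝ) ^ 4 * τ ^ (1 / (8 * (d : ℝ))) := by positivity
      have h3 : a ≤ (d : ℝ) ^ 3 * a := le_mul_of_one_le_left ha.le h1
      have h4 : 0 ≤ C0 * ((d : ℝ) ^ 3 * a + (d : ℝ) ^ 4 * τ ^ (1 / (8 * (d : ℝ)))) := by positivity
      linarith
    · have h1 : BSA f ≤ MBSA d (n + 1) (alphaP p) := by
        rw [← pad_BSA f]
        apply BSA_le_MBSA _ _ (MvPolynomial.rename Fin.succ p) (pad_support p hp)
          ((MvPolynomial.totalDegree_rename_le _ _).trans hdeg)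
        · intro x
          rw [pad_pev]
          exact hf _
        · rw [pad_alpha]
      simp
      linarith

end partF6

/-- Recursive bound for `MRBSA` in terms of `MBSA` in lower dimension, via a finitely
supported probability measure (given by weights `w` at points `t`) with small mean. -/
theorem mrbsa_recursive_bound :
    ∃ C : ℝ, 0 < C ∧ ∀ d n b : ℕ, 1 ≤ d → 1 ≤ n → 1 ≤ b → b ≤ n →
      ∀ a τ : ℝ, 0 < a → 0 < τ →
        ∃ (N : ℕ) (w t : Fin N → ℝ),
          (∀ i, 0 ≤ w i) ∧ (∑ i, w i = 1) ∧ (∀ i, 0 ≤ t i) ∧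
          (∑ i, w i * t i ≤
            C * ((d : ℝ) ^ 3 * a * (b : ℝ) ^ (-(1 : ℝ) / 2) +
              (d : ℝ) ^ 4 * τ ^ (1 / (8 * (d : ℝ))))) ∧
          MRBSA d n a τ ≤ Real.sqrt b * (∑ i, w i * MBSA d (n / b + 1) (t i)) + b := by
  exact final_bound
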